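/- Assume 1/4 < s' ≤ 1, 1/2 < s ≤ 1, max(3/2 − 2s, s/2 − 1/8) < s' < 4s − 3/2, 1/2 < θ₀ < 3/4, and max(1/2, 1 − s') < θ₁ < min(3/4, 4s − s' − 1, 2s − 1/2). Then there exists ε₀ > 0 such that for every ε with 0 < ε ≤ ε₀ there exists a constant C > 0 such that for all Schwartz functions u, v on ℝ^{1+2}, ‖uv‖_{H^{s'−3/2, θ₁−1/2+ε}} ≤ C ‖u‖_{H^{s−1/2, θ₀}} ‖v‖_{H^{s−1/2, θ₀}}. -/

import Mathlib

open MeasureTheory Real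
open scoped FourierTransform

noncomputable section

/-- Space-time ℝ^{1+2}: coordinate 0 is time `t`, coordinates 1,2 are space `x`. -/
abbrev SpaceTime := EuclideanSpace ℝ (Fin 3)

/-- The magnitude `|ξ|` of the spatial part of a frequency point `(τ, ξ) ∈ ℝ × ℝ²`. -/
def spFreq (ζ : SpaceTime) : ℝ := Real.sqrt ((ζ 1) ^ 2 + (ζ 2) ^ 2)

/-- The wave-Sobolev norm
`‖u‖_{H^{s,b}} = (∫ (1+|ξ|²)^s (1+||τ|-|ξ||)^{2b} |û(τ,ξ)|² dτ dξ)^{1/2}`. -/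
def waveNorm (s b : ℝ) (f : SpaceTime → ℂ) : ℝ :=
  (∫ ζ : SpaceTime, (1 + (spFreq ζ) ^ 2) ^ s * (1 + |(|ζ 0| - spFreq ζ)|) ^ (2 * b) *
    ‖𝓕 f ζ‖ ^ 2) ^ (1/2 : ℝ)

open scoped ENNReal

/-! ### One-dimensional integrals of powers of `1 + |t|` -/

/-- The Japanese bracket `1 + |t|`. -/
def jb (t : ℝ) : ℝ := 1 + |t|

lemma one_le_jb (t : ℝ) : 1 ≤ jb t := by simp [jb]

lemma jb_pos (t : ℝ) : 0 < jb t := one_pos.trans_le (one_le_jb t)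

lemma jb_neg (t : ℝ) : jb (-t) = jb t := by simp [jb]

lemma jb_add_le (s t : ℝ) : jb (s + t) ≤ jb s + |t| := by
  unfold jb; linarith [abs_add_le s t]

lemma jb_le_jb {s t : ℝ} (h : |s| ≤ |t|) : jb s ≤ jb t := by
  unfold jb; linarith

@[fun_prop]
lemma continuous_jb : Continuous jb := by unfold jb; fun_prop

@[fun_prop]
lemma measurable_jb : Measurable jb := continuous_jb.measurable

lemma jb_rpow_nonneg (t b : ℝ) : 0 ≤ jb t ^ b := (rpow_pos_of_pos (jb_pos t) b).le

lemma jb_rpow_neg_le_one (t : ℝ) {b : ℝ} (hb : 0 ≤ b) : jb t ^ (-b) ≤ 1 :=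
  rpow_le_one_of_one_le_of_nonpos (one_le_jb t) (by linarith)

/-- The constant `∫ (1 + |t|)^(-Θ) dt`. -/
def jbMass (Θ : ℝ) : ℝ := (∫⁻ t : ℝ, ENNReal.ofReal (jb t ^ (-Θ))).toReal

lemma jbMass_nonneg (Θ : ℝ) : 0 ≤ jbMass Θ := ENNReal.toReal_nonneg

lemma lintegral_jb_rpow {Θ : ℝ} (hΘ : 1 < Θ) :
    ∫⁻ t : ℝ, ENNReal.ofReal (jb t ^ (-Θ)) = ENNReal.ofReal (jbMass Θ) := by
  refine (ENNReal.ofReal_toReal (ne_of_lt ?_)).symm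
  exact finite_integral_one_add_norm (E := ℝ) (by simpa using hΘ)

lemma lintegral_jb_sub_right {Θ : ℝ} (hΘ : 1 < Θ) (c : ℝ) :
    ∫⁻ t : ℝ, ENNReal.ofReal (jb (t - c) ^ (-Θ)) = ENNReal.ofReal (jbMass Θ) := by
  rw [← lintegral_jb_rpow hΘ]
  exact lintegral_sub_right_eq_self (fun t => ENNReal.ofReal (jb t ^ (-Θ))) c

lemma lintegral_jb_sub_left {Θ : ℝ} (hΘ : 1 < Θ) (c : ℝ) :
    ∫⁻ t : ℝ, ENNReal.ofReal (jb (c - t) ^ (-Θ)) = ENNReal.ofReal (jbMass Θ) := by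
  rw [← lintegral_jb_rpow hΘ]
  exact lintegral_sub_left_eq_self (fun t => ENNReal.ofReal (jb t ^ (-Θ))) c

lemma jb_mul_jb_le {Θ : ℝ} (hΘ : 0 ≤ Θ) (s t : ℝ) :
    jb s ^ (-Θ) * jb t ^ (-Θ) ≤
      2 ^ Θ * jb (s + t) ^ (-Θ) * (jb s ^ (-Θ) + jb t ^ (-Θ)) := by
  have key : ∀ s t : ℝ, |t| ≤ |s| →
      jb s ^ (-Θ) * jb t ^ (-Θ) ≤ 2 ^ Θ * jb (s + t) ^ (-Θ) * jb t ^ (-Θ) := by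
    intro s t h
    gcongr ?_ * _
    · exact jb_rpow_nonneg _ _
    have h1 : jb (s + t) / 2 ≤ jb s := by
      unfold jb; linarith [abs_add_le s t, abs_nonneg s]
    calc jb s ^ (-Θ) ≤ (jb (s + t) / 2) ^ (-Θ) :=
          rpow_le_rpow_of_nonpos (by linarith [jb_pos (s + t)]) h1 (by linarith)
      _ = 2 ^ Θ * jb (s + t) ^ (-Θ) := by
          rw [div_rpow (jb_pos _).le two_pos.le, rpow_neg two_pos.le, div_inv_eq_mul, mul_comm]
  have h2 : 0 ≤ 2 ^ Θ * jb (s + t) ^ (-Θ) := mul_nonneg (by positivity) (jb_rpow_nonneg _ _)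
  rcases le_total |t| |s| with h | h
  · nlinarith [key s t h, mul_nonneg h2 (jb_rpow_nonneg s (-Θ))]
  · have := key t s h
    rw [add_comm t s] at this
    nlinarith [mul_nonneg h2 (jb_rpow_nonneg t (-Θ))]

/-- Convolving two powers `(1 + |t|)^(-Θ)`, `Θ > 1`, gives a function of the same size. -/
lemma lintegral_jb_mul_jb {Θ : ℝ} (hΘ : 1 < Θ) (t α β : ℝ) :
    ∫⁻ s : ℝ, ENNReal.ofReal (jb (s - α) ^ (-Θ) * jb (t - s - β) ^ (-Θ)) ≤
      ENNReal.ofReal (2 ^ Θ * (2 * jbMass Θ) * jb (t - α - β) ^ (-Θ)) := by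
  calc ∫⁻ s : ℝ, ENNReal.ofReal (jb (s - α) ^ (-Θ) * jb (t - s - β) ^ (-Θ))
      ≤ ∫⁻ s : ℝ, ENNReal.ofReal (2 ^ Θ * jb (t - α - β) ^ (-Θ)) *
          (ENNReal.ofReal (jb (s - α) ^ (-Θ)) + ENNReal.ofReal (jb ((t - β) - s) ^ (-Θ))) := by
        refine lintegral_mono fun s => ?_
        rw [← ENNReal.ofReal_add (jb_rpow_nonneg _ _) (jb_rpow_nonneg _ _),
          ← ENNReal.ofReal_mul (mul_nonneg (by positivity) (jb_rpow_nonneg _ _))]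
        refine ENNReal.ofReal_le_ofReal ?_
        have := jb_mul_jb_le (by linarith : 0 ≤ Θ) (s - α) (t - s - β)
        rwa [show s - α + (t - s - β) = t - α - β by ring,
          show t - s - β = t - β - s by ring] at *
    _ = ENNReal.ofReal (2 ^ Θ * (2 * jbMass Θ) * jb (t - α - β) ^ (-Θ)) := by
        rw [lintegral_const_mul' _ _ ENNReal.ofReal_ne_top, lintegral_add_left (by fun_prop),
          lintegral_jb_sub_right hΘ, lintegral_jb_sub_left hΘ,
          ← ENNReal.ofReal_add (jbMass_nonneg _) (jbMass_nonneg _),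
          ← ENNReal.ofReal_mul (mul_nonneg (by positivity) (jb_rpow_nonneg _ _))]
        congr 1; ring

lemma setLIntegral_Ioo_rpow_neg_half {a : ℝ} (ha : 0 ≤ a) :
    ∫⁻ u in Set.Ioo 0 a, ENNReal.ofReal (|u| ^ (-(1 / 2) : ℝ)) = ENNReal.ofReal (2 * √a) := by
  have hi : IntervalIntegrable (fun x : ℝ => x ^ (-(1 / 2) : ℝ)) volume 0 a :=
    intervalIntegral.intervalIntegrable_rpow' (by norm_num)
  have h1 : ∫ x in (0 : ℝ)..a, x ^ (-(1 / 2) : ℝ) = 2 * √a := by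
    rw [integral_rpow (Or.inl (by norm_num)), sqrt_eq_rpow]
    norm_num
    ring
  rw [← h1, intervalIntegral.integral_of_le ha, ofReal_integral_eq_lintegral_ofReal,
    ← restrict_Ioo_eq_restrict_Ioc]
  · refine setLIntegral_congr_fun measurableSet_Ioo fun u hu => ?_
    simp only [abs_of_pos hu.1]
  · exact (intervalIntegrable_iff_integrableOn_Ioc_of_le ha).1 hi
  · filter_upwards [ae_restrict_mem measurableSet_Ioc] with x hx
    exact rpow_nonneg hx.1.le _

lemma setLIntegral_abs_lt_rpow_neg_half {a : ℝ} (ha : 0 ≤ a) :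
    ∫⁻ u in {u : ℝ | |u| < a}, ENNReal.ofReal (|u| ^ (-(1 / 2) : ℝ)) ≤
      ENNReal.ofReal (4 * √a) := by
  have hneg : ∫⁻ u in Set.Ioo (-a) 0, ENNReal.ofReal (|u| ^ (-(1 / 2) : ℝ)) =
      ENNReal.ofReal (2 * √a) := by
    rw [← setLIntegral_Ioo_rpow_neg_half ha]
    have := (Measure.measurePreserving_neg (volume : Measure ℝ)).setLIntegral_comp_preimage
      (s := Set.Ioo 0 a) measurableSet_Ioo
      (f := fun u : ℝ => ENNReal.ofReal (|u| ^ (-(1 / 2) : ℝ))) (by fun_prop)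
    rw [← this]
    simp
  have hsub : {u : ℝ | |u| < a} ⊆ (Set.Ioo (-a) 0 ∪ {0}) ∪ Set.Ioo 0 a := by
    intro u hu
    rcases lt_trichotomy u 0 with h | h | h
    · exact Or.inl (Or.inl ⟨(abs_lt.1 hu).1, h⟩)
    · exact Or.inl (Or.inr h)
    · exact Or.inr ⟨h, (abs_lt.1 hu).2⟩
  calc _ ≤ _ := lintegral_mono_set hsub
    _ ≤ _ := (lintegral_union_le _ _ _).trans (add_le_add_left (lintegral_union_le _ _ _) _)
    _ = ENNReal.ofReal (4 * √a) := by
      rw [hneg, setLIntegral_Ioo_rpow_neg_half ha]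
      simp only [Measure.restrict_singleton, volume_singleton, zero_smul, lintegral_zero_measure,
        add_zero]
      rw [← ENNReal.ofReal_add (by positivity) (by positivity)]
      congr 1; ring

/-- The integral of `|t - c|^(-1/2)` over a set of measure at most `ℓ` is `O(√ℓ)`. -/
lemma setLIntegral_jb_rpow_neg_half {s : Set ℝ} {ℓ : ℝ} (hℓ : 0 < ℓ)
    (hvol : volume s ≤ ENNReal.ofReal ℓ) (c : ℝ) :
    ∫⁻ t in s, ENNReal.ofReal (jb (t - c) ^ (-(1 / 2) : ℝ)) ≤ ENNReal.ofReal (5 * √ℓ) := by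
  have hne : ∀ᵐ t : ℝ, t ≠ c := by simp [ae_iff]
  have hpt : ∀ᵐ t : ℝ, ENNReal.ofReal (jb (t - c) ^ (-(1 / 2) : ℝ)) ≤
      {u : ℝ | |u| < ℓ}.indicator (fun u => ENNReal.ofReal (|u| ^ (-(1 / 2) : ℝ))) (t - c) +
        ENNReal.ofReal (ℓ ^ (-(1 / 2) : ℝ)) := by
    filter_upwards [hne] with t ht
    have ht' : 0 < |t - c| := abs_pos.2 (sub_ne_zero.2 ht)
    by_cases h : |t - c| < ℓ
    · rw [Set.indicator_of_mem (by exact h)]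
      refine le_add_right (ENNReal.ofReal_le_ofReal ?_)
      exact rpow_le_rpow_of_nonpos ht' (by unfold jb; linarith) (by norm_num)
    · refine le_add_left (ENNReal.ofReal_le_ofReal ?_)
      exact rpow_le_rpow_of_nonpos hℓ (by unfold jb; linarith) (by norm_num)
  calc _ ≤ ∫⁻ t in s, ({u : ℝ | |u| < ℓ}.indicator
          (fun u => ENNReal.ofReal (|u| ^ (-(1 / 2) : ℝ))) (t - c) +
        ENNReal.ofReal (ℓ ^ (-(1 / 2) : ℝ))) := lintegral_mono_ae (ae_restrict_of_ae hpt)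
    _ ≤ ENNReal.ofReal (4 * √ℓ) + ENNReal.ofReal (ℓ ^ (-(1 / 2) : ℝ)) * ENNReal.ofReal ℓ := by
      rw [lintegral_add_right _ measurable_const, setLIntegral_const]
      gcongr
      refine (setLIntegral_le_lintegral _ _).trans ?_
      rw [lintegral_sub_right_eq_self (μ := volume) (fun t => {u : ℝ | |u| < ℓ}.indicator
          (fun u => ENNReal.ofReal (|u| ^ (-(1 / 2) : ℝ))) t) c,
        lintegral_indicator (measurableSet_lt (by fun_prop) (by fun_prop))]
      exact setLIntegral_abs_lt_rpow_neg_half hℓ.le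
    _ = ENNReal.ofReal (5 * √ℓ) := by
      rw [← ENNReal.ofReal_mul (by positivity), ← ENNReal.ofReal_add (by positivity)
        (by positivity)]
      congr 1
      have : ℓ ^ (-(1 / 2) : ℝ) * ℓ = √ℓ := by
        rw [sqrt_eq_rpow]
        nth_rw 2 [← rpow_one ℓ]
        rw [← rpow_add hℓ]; norm_num
      rw [this]; ring

/-- The constant in `lintegral_jb_mul_rpow_neg_half`. -/
def singConst (Θ : ℝ) : ℝ := 2 * jbMass Θ + 4

lemma singConst_nonneg (Θ : ℝ) : 0 ≤ singConst Θ := by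
  unfold singConst; linarith [jbMass_nonneg Θ]

/-- Convolving `(1 + |t|)^(-Θ)`, `Θ > 1`, with `|t|^(-1/2)`. -/
lemma lintegral_jb_mul_rpow_neg_half {Θ : ℝ} (hΘ : 1 < Θ) (D : ℝ) :
    ∫⁻ u : ℝ, ENNReal.ofReal (jb (D - u) ^ (-Θ) * |u| ^ (-(1 / 2) : ℝ)) ≤
      ENNReal.ofReal (singConst Θ * jb D ^ (-(1 / 2) : ℝ)) := by
  have hD := jb_pos D
  have hpt : ∀ u : ℝ, ENNReal.ofReal (jb (D - u) ^ (-Θ) * |u| ^ (-(1 / 2) : ℝ)) ≤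
      ENNReal.ofReal (2 * jb D ^ (-(1 / 2) : ℝ)) * ENNReal.ofReal (jb (D - u) ^ (-Θ)) +
      {u : ℝ | |u| < jb D / 4}.indicator (fun u => ENNReal.ofReal (2 * (jb D)⁻¹) *
        ENNReal.ofReal (|u| ^ (-(1 / 2) : ℝ))) u := by
    intro u
    by_cases h : |u| < jb D / 4
    · rw [Set.indicator_of_mem (by exact h)]
      refine le_add_left ?_
      rw [← ENNReal.ofReal_mul (by positivity)]
      refine ENNReal.ofReal_le_ofReal ?_
      gcongr ?_ * _
      have h1 : jb D / 2 ≤ jb (D - u) := by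
        have : jb D ≤ jb (D - u) + |u| := by simpa using jb_add_le (D - u) u
        linarith
      calc jb (D - u) ^ (-Θ) ≤ jb (D - u) ^ (-1 : ℝ) :=
            rpow_le_rpow_of_exponent_le (one_le_jb _) (by linarith)
        _ ≤ (jb D / 2) ^ (-1 : ℝ) := rpow_le_rpow_of_nonpos (by linarith) h1 (by norm_num)
        _ = 2 * (jb D)⁻¹ := by rw [rpow_neg_one]; field_simp
    · rw [← ENNReal.ofReal_mul (by positivity)]
      refine le_add_right (ENNReal.ofReal_le_ofReal ?_)
      rw [mul_comm]
      gcongr ?_ * _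
      · exact jb_rpow_nonneg _ _
      calc |u| ^ (-(1 / 2) : ℝ) ≤ (jb D / 4) ^ (-(1 / 2) : ℝ) :=
            rpow_le_rpow_of_nonpos (by linarith) (by linarith) (by norm_num)
        _ = 2 * jb D ^ (-(1 / 2) : ℝ) := by
            rw [div_rpow hD.le (by norm_num), rpow_neg (by norm_num : (0 : ℝ) ≤ 4),
              ← sqrt_eq_rpow, show (4 : ℝ) = 2 ^ 2 by norm_num, sqrt_sq two_pos.le,
              div_inv_eq_mul, mul_comm]
  calc _ ≤ _ := lintegral_mono hpt
    _ ≤ ENNReal.ofReal (2 * jb D ^ (-(1 / 2) : ℝ)) * ENNReal.ofReal (jbMass Θ) +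
        ENNReal.ofReal (2 * (jb D)⁻¹) * ENNReal.ofReal (4 * √(jb D / 4)) := by
      rw [lintegral_add_left (by fun_prop), lintegral_const_mul' _ _ ENNReal.ofReal_ne_top,
        lintegral_jb_sub_left hΘ,
        lintegral_indicator (measurableSet_lt (by fun_prop) (by fun_prop)),
        lintegral_const_mul' _ _ ENNReal.ofReal_ne_top]
      gcongr
      exact setLIntegral_abs_lt_rpow_neg_half (by positivity)
    _ = _ := by
      rw [← ENNReal.ofReal_mul (by positivity), ← ENNReal.ofReal_mul (by positivity),
        ← ENNReal.ofReal_add (mul_nonneg (by positivity) (jbMass_nonneg _)) (by positivity)]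
      congr 1
      have h4 : √(jb D / 4) = √(jb D) / 2 := by
        rw [sqrt_div hD.le, show (4 : ℝ) = 2 ^ 2 by norm_num, sqrt_sq two_pos.le]
      have h5 : (jb D)⁻¹ * √(jb D) = jb D ^ (-(1 / 2) : ℝ) := by
        rw [sqrt_eq_rpow, ← rpow_neg_one, ← rpow_add hD]; norm_num
      rw [h4, ← h5]; unfold singConst; ring

/-- If `f` increases at unit-size speed `κ` on `s`, then `∫ₛ (1 + |T - f|)^(-Θ)` is bounded
uniformly in `T`. -/
lemma setLIntegral_jb_of_expanding {Θ κ : ℝ} (hΘ : 1 < Θ) (hκ : 0 < κ) (hκ1 : κ ≤ 1) {s : Set ℝ}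
    (hs : MeasurableSet s) {f : ℝ → ℝ}
    (hf : ∀ x ∈ s, ∀ y ∈ s, κ * |x - y| ≤ |f x - f y|) (T : ℝ) :
    ∫⁻ x in s, ENNReal.ofReal (jb (T - f x) ^ (-Θ)) ≤
      ENNReal.ofReal ((2 / κ) ^ Θ * jbMass Θ) := by
  rcases s.eq_empty_or_nonempty with rfl | hne
  · simp
  obtain ⟨x₀, hx₀, hmin⟩ : ∃ x₀ ∈ s, ∀ x ∈ s, |T - f x₀| ≤ |T - f x| + 1 := by
    set S := (fun x => |T - f x|) '' s
    have hS : S.Nonempty := hne.image _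
    have hb : BddBelow S := ⟨0, by rintro _ ⟨x, -, rfl⟩; exact abs_nonneg _⟩
    obtain ⟨_, ⟨x₀, hx₀, rfl⟩, hlt⟩ := exists_lt_of_csInf_lt hS (lt_add_one (sInf S))
    exact ⟨x₀, hx₀, fun x hx => hlt.le.trans (by
      have := csInf_le hb (Set.mem_image_of_mem (fun x => |T - f x|) hx); linarith)⟩
  calc _ ≤ ∫⁻ x in s, ENNReal.ofReal ((2 / κ) ^ Θ) * ENNReal.ofReal (jb (x - x₀) ^ (-Θ)) := by
        refine setLIntegral_mono (by fun_prop) fun x hx => ?_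
        rw [← ENNReal.ofReal_mul (by positivity)]
        refine ENNReal.ofReal_le_ofReal ?_
        have h1 : κ / 2 * jb (x - x₀) ≤ jb (T - f x) := by
          have h2 := hf x hx x₀ hx₀
          have h3 : |f x - f x₀| ≤ |T - f x| + |T - f x₀| := by
            rw [abs_sub_comm T (f x)]
            simpa using abs_add_le (f x - T) (T - f x₀)
          have := hmin x hx
          unfold jb; nlinarith
        calc jb (T - f x) ^ (-Θ) ≤ (κ / 2 * jb (x - x₀)) ^ (-Θ) :=
              rpow_le_rpow_of_nonpos (mul_pos (by positivity) (jb_pos _)) h1 (by linarith)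
          _ = (2 / κ) ^ Θ * jb (x - x₀) ^ (-Θ) := by
              rw [mul_rpow (by positivity) (jb_pos _).le, rpow_neg (by positivity),
                ← inv_rpow (by positivity), inv_div]
    _ ≤ ∫⁻ x, ENNReal.ofReal ((2 / κ) ^ Θ) * ENNReal.ofReal (jb (x - x₀) ^ (-Θ)) :=
        setLIntegral_le_lintegral _ _
    _ = _ := by
        rw [lintegral_const_mul' _ _ ENNReal.ofReal_ne_top, lintegral_jb_sub_right hΘ,
          ← ENNReal.ofReal_mul (by positivity)]

/-! ### Angular integrals in the plane -/

/-- The length of the third side of a triangle with sides `p`, `r` enclosing the angle `φ`. -/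
def thirdSide (p r φ : ℝ) : ℝ := √(p ^ 2 + r ^ 2 - 2 * p * r * cos φ)

section thirdSide

variable {p r φ : ℝ}

@[fun_prop]
lemma measurable_thirdSide {α : Type*} [MeasurableSpace α] {f g h : α → ℝ} (hf : Measurable f)
    (hg : Measurable g) (hh : Measurable h) :
    Measurable fun x => thirdSide (f x) (g x) (h x) := by
  unfold thirdSide; fun_prop

lemma thirdSide_sq (hp : 0 ≤ p) (hr : 0 ≤ r) :
    thirdSide p r φ ^ 2 = p ^ 2 + r ^ 2 - 2 * p * r * cos φ :=
  sq_sqrt (by nlinarith [cos_le_one φ, mul_nonneg hp hr, sq_nonneg (p - r)])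

lemma thirdSide_nonneg : 0 ≤ thirdSide p r φ := sqrt_nonneg _

lemma abs_sub_le_thirdSide (hp : 0 ≤ p) (hr : 0 ≤ r) : |p - r| ≤ thirdSide p r φ := by
  rw [← abs_of_nonneg (thirdSide_nonneg : 0 ≤ thirdSide p r φ), ← sq_le_sq, thirdSide_sq hp hr]
  nlinarith [cos_le_one φ, mul_nonneg hp hr]

lemma thirdSide_le_add (hp : 0 ≤ p) (hr : 0 ≤ r) : thirdSide p r φ ≤ p + r := by
  refine le_of_sq_le_sq ?_ (by positivity)
  rw [thirdSide_sq hp hr]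
  nlinarith [neg_one_le_cos φ, mul_nonneg hp hr]

lemma abs_sub_lt_thirdSide (hp : 0 < p) (hr : 0 < r) (hφ : φ ∈ Set.Ioo 0 π) :
    |p - r| < thirdSide p r φ := by
  rw [← abs_of_nonneg (thirdSide_nonneg : 0 ≤ thirdSide p r φ), ← sq_lt_sq,
    thirdSide_sq hp.le hr.le]
  have : cos φ < 1 := by
    simpa using cos_lt_cos_of_nonneg_of_le_pi le_rfl hφ.2.le hφ.1
  nlinarith [mul_pos hp hr]

lemma thirdSide_lt_add (hp : 0 < p) (hr : 0 < r) (hφ : φ ∈ Set.Ioo 0 π) :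
    thirdSide p r φ < p + r := by
  refine lt_of_pow_lt_pow_left₀ 2 (by positivity) ?_
  rw [thirdSide_sq hp.le hr.le]
  have : -1 < cos φ := by
    simpa using cos_lt_cos_of_nonneg_of_le_pi hφ.1.le le_rfl hφ.2
  nlinarith [mul_pos hp hr]

lemma hasDerivAt_thirdSide (hp : 0 < p) (hr : 0 < r) (hφ : φ ∈ Set.Ioo 0 π) :
    HasDerivAt (thirdSide p r) (p * r * sin φ / thirdSide p r φ) φ := by
  have hpos : 0 < thirdSide p r φ := (abs_nonneg _).trans_lt (abs_sub_lt_thirdSide hp hr hφ)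
  have h1 : HasDerivAt (fun φ => p ^ 2 + r ^ 2 - 2 * p * r * cos φ)
      (2 * p * r * sin φ) φ := by
    have := ((hasDerivAt_cos φ).const_mul (2 * p * r)).const_sub (p ^ 2 + r ^ 2)
    convert! this using 1
    ring
  have h2 := h1.sqrt (by rw [← thirdSide_sq hp.le hr.le]; positivity)
  refine h2.congr_deriv ?_
  change _ / (2 * thirdSide p r φ) = _
  field_simp

lemma injOn_thirdSide (hp : 0 < p) (hr : 0 < r) : Set.InjOn (thirdSide p r) (Set.Ioo 0 π) := by
  intro x hx y hy hxy
  have h : thirdSide p r x ^ 2 = thirdSide p r y ^ 2 := by rw [hxy]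
  rw [thirdSide_sq hp.le hr.le, thirdSide_sq hp.le hr.le] at h
  have h2 : cos x = cos y :=
    mul_left_cancel₀ (by positivity : 2 * p * r ≠ 0) (by linarith)
  exact injOn_cos ⟨hx.1.le, hx.2.le⟩ ⟨hy.1.le, hy.2.le⟩ h2

/-- The density of the angle with respect to the length of the third side has only inverse square
root singularities, at the two degenerate triangles. -/
lemma one_le_deriv_thirdSide_mul (hp : 0 < p) (hr : 0 < r) (hφ : φ ∈ Set.Ioo 0 π) :
    1 ≤ |p * r * sin φ / thirdSide p r φ| * (2 * min p r ^ (-(1 / 2) : ℝ) *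
      (|(thirdSide p r φ - |p - r|)| ^ (-(1 / 2) : ℝ) +
        |thirdSide p r φ - (p + r)| ^ (-(1 / 2) : ℝ))) := by
  set q := thirdSide p r φ
  set μ := min p r with hμ
  have h0 : |p - r| < q := abs_sub_lt_thirdSide hp hr hφ
  have h1 : q < p + r := thirdSide_lt_add hp hr hφ
  have hq : 0 < q := (abs_nonneg _).trans_lt h0
  have hμpos : 0 < μ := lt_min hp hr
  have hsin : 0 < sin φ := sin_pos_of_pos_of_lt_pi hφ.1 hφ.2
  set a := q - |p - r| with ha
  set b := p + r - q with hb
  have hapos : 0 < a := sub_pos.2 h0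
  have hbpos : 0 < b := sub_pos.2 h1
  have hab : a + b = 2 * μ := by
    rw [ha, hb, hμ]
    rcases le_total p r with h | h
    · rw [min_eq_left h, abs_of_nonpos (by linarith)]; ring
    · rw [min_eq_right h, abs_of_nonneg (by linarith)]; ring
  have hq2 : q ^ 2 = p ^ 2 + r ^ 2 - 2 * p * r * cos φ := thirdSide_sq hp.le hr.le
  have hprod : a * (q + |p - r|) * (b * (q + (p + r))) = 4 * (p * r * sin φ) ^ 2 := by
    have e1 : a * (q + |p - r|) = q ^ 2 - (p - r) ^ 2 := by
      rw [← sq_abs (p - r)]; ring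
    have e2 : b * (q + (p + r)) = (p + r) ^ 2 - q ^ 2 := by ring
    rw [e1, e2, hq2, mul_pow, sin_sq]; ring
  have hle : √a * √b ≤ 2 * (p * r * sin φ / q) := by
    rw [← sqrt_mul hapos.le]
    refine sqrt_le_iff.2 ⟨by positivity, ?_⟩
    have : a * b * q ^ 2 ≤ 4 * (p * r * sin φ) ^ 2 := by
      rw [← hprod]
      have : q ^ 2 ≤ (q + |p - r|) * (q + (p + r)) := by
        nlinarith [abs_nonneg (p - r), mul_nonneg hq.le (abs_nonneg (p - r)),
          mul_nonneg (abs_nonneg (p - r)) (by positivity : 0 ≤ p + r),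
          mul_pos hq (by positivity : 0 < p + r)]
      nlinarith [mul_pos hapos hbpos]
    rw [mul_pow, div_pow, ← mul_div_assoc, le_div_iff₀ (by positivity)]
    linarith
  have hsum : √μ ≤ √a + √b := by
    rcases le_total μ a with h | h
    · exact (sqrt_le_sqrt h).trans (le_add_of_nonneg_right (sqrt_nonneg _))
    · exact (sqrt_le_sqrt (by linarith)).trans (le_add_of_nonneg_left (sqrt_nonneg _))
  have hr2 : ∀ x : ℝ, 0 < x → x ^ (-(1 / 2) : ℝ) = (√x)⁻¹ := fun x hx => by
    rw [rpow_neg hx.le, sqrt_eq_rpow]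
  rw [abs_of_pos (by positivity : 0 < p * r * sin φ / q), abs_of_pos hapos,
    abs_of_neg (by linarith : q - (p + r) < 0), show -(q - (p + r)) = b by rw [hb]; ring,
    hr2 _ hμpos, hr2 _ hapos, hr2 _ hbpos]
  have sa := sqrt_pos.2 hapos
  have sb := sqrt_pos.2 hbpos
  have sm := sqrt_pos.2 hμpos
  calc (1 : ℝ) ≤ (√μ)⁻¹ * (√a + √b) := by
        rw [inv_mul_eq_div, le_div_iff₀ sm]; linarith
    _ = (√a * √b) * ((√μ)⁻¹ * ((√a)⁻¹ + (√b)⁻¹)) := by field_simp; ring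
    _ ≤ (2 * (p * r * sin φ / q)) * ((√μ)⁻¹ * ((√a)⁻¹ + (√b)⁻¹)) := by gcongr
    _ = _ := by ring

/-- The constant in `lintegral_angle_jb`. -/
def angConst (Θ : ℝ) : ℝ := 4 * singConst Θ + 16

lemma angConst_nonneg (Θ : ℝ) : 0 ≤ angConst Θ := by
  unfold angConst; linarith [singConst_nonneg Θ]

lemma lintegral_angle_jb_aux {Θ : ℝ} (hΘ : 1 < Θ) (hp : 0 < p) (hr : 0 < r) (T : ℝ) :
    ∫⁻ φ in Set.Ioo 0 π, ENNReal.ofReal (jb (T - thirdSide p r φ) ^ (-Θ)) ≤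
      ENNReal.ofReal (2 * singConst Θ * min p r ^ (-(1 / 2) : ℝ) *
        (jb (T - |p - r|) ^ (-(1 / 2) : ℝ) + jb (T - (p + r)) ^ (-(1 / 2) : ℝ))) := by
  have hμ : 0 < min p r := lt_min hp hr
  set c : ℝ := 2 * min p r ^ (-(1 / 2) : ℝ) with hc
  have hcpos : 0 ≤ c := by positivity
  set G : ℝ → ℝ≥0∞ := fun q => ENNReal.ofReal c *
    (ENNReal.ofReal (jb (T - q) ^ (-Θ) * |(q - |p - r|)| ^ (-(1 / 2) : ℝ)) +
      ENNReal.ofReal (jb (T - q) ^ (-Θ) * |q - (p + r)| ^ (-(1 / 2) : ℝ))) with hG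
  have hsing : ∀ d : ℝ, ∫⁻ q : ℝ, ENNReal.ofReal (jb (T - q) ^ (-Θ) * |q - d| ^ (-(1 / 2) : ℝ)) ≤
      ENNReal.ofReal (singConst Θ * jb (T - d) ^ (-(1 / 2) : ℝ)) := by
    intro d
    refine le_trans (le_of_eq ?_) (lintegral_jb_mul_rpow_neg_half hΘ (T - d))
    rw [← lintegral_sub_right_eq_self (μ := volume)
      (fun u => ENNReal.ofReal (jb (T - d - u) ^ (-Θ) * |u| ^ (-(1 / 2) : ℝ))) d]
    refine lintegral_congr fun q => ?_
    rw [show T - d - (q - d) = T - q by ring]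
  calc _ ≤ ∫⁻ φ in Set.Ioo 0 π, ENNReal.ofReal |p * r * sin φ / thirdSide p r φ| *
          G (thirdSide p r φ) := by
        refine setLIntegral_mono' measurableSet_Ioo fun φ hφ => ?_
        have h1 := one_le_deriv_thirdSide_mul hp hr hφ
        have h2 := jb_rpow_nonneg (T - thirdSide p r φ) (-Θ)
        rw [hG]
        simp only
        rw [← ENNReal.ofReal_add (mul_nonneg h2 (by positivity))
          (mul_nonneg h2 (by positivity)), ← ENNReal.ofReal_mul hcpos,
          ← ENNReal.ofReal_mul (abs_nonneg _)]
        refine ENNReal.ofReal_le_ofReal ?_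
        rw [hc]
        linarith [mul_le_mul_of_nonneg_left h1 h2]
    _ = ∫⁻ q in thirdSide p r '' Set.Ioo 0 π, G q :=
        (lintegral_image_eq_lintegral_abs_deriv_mul measurableSet_Ioo
          (fun φ hφ => (hasDerivAt_thirdSide hp hr hφ).hasDerivWithinAt)
          (injOn_thirdSide hp hr) G).symm
    _ ≤ ∫⁻ q, G q := setLIntegral_le_lintegral _ _
    _ ≤ ENNReal.ofReal c * (ENNReal.ofReal (singConst Θ * jb (T - |p - r|) ^ (-(1 / 2) : ℝ)) +
          ENNReal.ofReal (singConst Θ * jb (T - (p + r)) ^ (-(1 / 2) : ℝ))) := by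
        rw [hG, lintegral_const_mul' _ _ ENNReal.ofReal_ne_top, lintegral_add_left (by fun_prop)]
        gcongr <;> exact hsing _
    _ = _ := by
        have hs := singConst_nonneg Θ
        rw [← ENNReal.ofReal_add (mul_nonneg hs (jb_rpow_nonneg _ _))
          (mul_nonneg hs (jb_rpow_nonneg _ _)), ← ENNReal.ofReal_mul hcpos]
        congr 1; rw [hc]; ring

lemma rpow_neg_half_le_of_le_mul {x y : ℝ} (hy : 0 < y) (h : y ≤ 4 * x) :
    x ^ (-(1 / 2) : ℝ) ≤ 2 * y ^ (-(1 / 2) : ℝ) := by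
  calc x ^ (-(1 / 2) : ℝ) ≤ (y / 4) ^ (-(1 / 2) : ℝ) :=
        rpow_le_rpow_of_nonpos (by positivity) (by linarith) (by norm_num)
    _ = 2 * y ^ (-(1 / 2) : ℝ) := by
        rw [div_rpow hy.le (by norm_num), rpow_neg (by norm_num : (0 : ℝ) ≤ 4),
          ← sqrt_eq_rpow, show (4 : ℝ) = 2 ^ 2 by norm_num, sqrt_sq two_pos.le,
          div_inv_eq_mul, mul_comm]

/-- The angular integral of `(1 + |T - q|)^(-Θ)`, where `q` is the length of the third side. -/
lemma lintegral_angle_jb {Θ : ℝ} (hΘ : 1 < Θ) (hp : 0 < p) (hr : 0 ≤ r) (T : ℝ) :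
    ∫⁻ φ in Set.Ioo 0 π, ENNReal.ofReal (jb (T - thirdSide p r φ) ^ (-Θ)) ≤
      ENNReal.ofReal (angConst Θ * (1 + min p r) ^ (-(1 / 2) : ℝ) *
        (jb (T - |p - r|) ^ (-(1 / 2) : ℝ) + jb (T - (p + r)) ^ (-(1 / 2) : ℝ))) := by
  have hμ : 0 ≤ min p r := le_min hp.le hr
  have hs := singConst_nonneg Θ
  set X := jb (T - |p - r|) ^ (-(1 / 2) : ℝ) with hX
  set Y := jb (T - (p + r)) ^ (-(1 / 2) : ℝ) with hY
  have hX0 : 0 ≤ X := jb_rpow_nonneg _ _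
  have hY0 : 0 ≤ Y := jb_rpow_nonneg _ _
  have hm : 0 ≤ (1 + min p r) ^ (-(1 / 2) : ℝ) := by positivity
  rcases le_or_gt 1 (min p r) with h | h
  · have hr' : 0 < r := by linarith [min_le_right p r]
    refine (lintegral_angle_jb_aux hΘ hp hr' T).trans (ENNReal.ofReal_le_ofReal ?_)
    refine mul_le_mul_of_nonneg_right ?_ (add_nonneg hX0 hY0)
    have := rpow_neg_half_le_of_le_mul (x := min p r) (y := 1 + min p r) (by linarith)
      (by linarith)
    unfold angConst
    nlinarith
  · have hpt : ∀ φ, jb (T - thirdSide p r φ) ^ (-Θ) ≤ 2 * X := by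
      intro φ
      refine (rpow_le_rpow_of_exponent_le (one_le_jb _)
        (by linarith : -Θ ≤ (-(1 / 2) : ℝ))).trans ?_
      refine rpow_neg_half_le_of_le_mul (jb_pos _) ?_
      have h1 : |p - r| ≤ thirdSide p r φ := abs_sub_le_thirdSide hp.le hr
      have h2 : thirdSide p r φ ≤ p + r := thirdSide_le_add hp.le hr
      have h3 : p + r - |p - r| = 2 * min p r := by
        rcases le_total p r with h | h
        · rw [min_eq_left h, abs_of_nonpos (by linarith)]; ring
        · rw [min_eq_right h, abs_of_nonneg (by linarith)]; ring
      have h4 := jb_add_le (T - thirdSide p r φ) (thirdSide p r φ - |p - r|)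
      rw [sub_add_sub_cancel, abs_of_nonneg (sub_nonneg.2 h1)] at h4
      linarith [one_le_jb (T - thirdSide p r φ)]
    calc _ ≤ ∫⁻ φ in Set.Ioo 0 π, ENNReal.ofReal (2 * X) :=
          lintegral_mono fun φ => ENNReal.ofReal_le_ofReal (hpt φ)
      _ = ENNReal.ofReal (2 * X * π) := by
          rw [setLIntegral_const, volume_Ioo, sub_zero, ← ENNReal.ofReal_mul (by positivity)]
      _ ≤ _ := by
          refine ENNReal.ofReal_le_ofReal ?_
          have h1 : (1 : ℝ) / 2 ≤ (1 + min p r) ^ (-(1 / 2) : ℝ) := by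
            have := rpow_neg_half_le_of_le_mul (x := 1) (y := 1 + min p r) (by linarith)
              (by linarith)
            rw [one_rpow] at this; linarith
          have h2 : 8 ≤ angConst Θ * (1 + min p r) ^ (-(1 / 2) : ℝ) := by
            unfold angConst; nlinarith
          nlinarith [pi_lt_d2, pi_pos, mul_le_mul_of_nonneg_right h2 (add_nonneg hX0 hY0)]

end thirdSide

/-- Bound for a planar integral of a weight in `‖x‖` times `(1 + |T(‖x‖) - ‖v - x‖|)^(-Θ)`. -/
lemma lintegral_radial_mul_jb {Θ : ℝ} (hΘ : 1 < Θ) (v : ℂ) {f : ℝ → ℝ≥0∞} (hf : Measurable f)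
    {T : ℝ → ℝ} (hT : Measurable T) :
    ∫⁻ x : ℂ, f ‖x‖ * ENNReal.ofReal (jb (T ‖x‖ - ‖v - x‖) ^ (-Θ)) ≤
      ∫⁻ p in Set.Ioi (0 : ℝ), ENNReal.ofReal p * f p *
        ENNReal.ofReal (2 * angConst Θ * (1 + min p ‖v‖) ^ (-(1 / 2) : ℝ) *
          (jb (T p - |p - ‖v‖|) ^ (-(1 / 2) : ℝ) + jb (T p - (p + ‖v‖)) ^ (-(1 / 2) : ℝ))) := by
  set r := ‖v‖ with hr
  have hr0 : 0 ≤ r := norm_nonneg v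
  have hrot : ∫⁻ x : ℂ, f ‖x‖ * ENNReal.ofReal (jb (T ‖x‖ - ‖v - x‖) ^ (-Θ)) =
      ∫⁻ x : ℂ, f ‖x‖ * ENNReal.ofReal (jb (T ‖x‖ - ‖(r : ℂ) - x‖) ^ (-Θ)) := by
    have hv : (Circle.exp v.arg : ℂ) * r = v := by
      rw [Circle.coe_exp, mul_comm]; exact Complex.norm_mul_exp_arg_mul_I v
    rw [← (rotation (Circle.exp v.arg)).measurePreserving.lintegral_comp_emb
      (rotation (Circle.exp v.arg)).toHomeomorph.measurableEmbedding]
    refine lintegral_congr fun x => ?_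
    rw [LinearIsometryEquiv.norm_map]
    congr 5
    rw [← LinearIsometryEquiv.norm_map (rotation (Circle.exp v.arg)) ((r : ℂ) - x), map_sub,
      rotation_apply, rotation_apply, hv]
  have hnorm : ∀ p φ : ℝ, 0 < p → ‖Complex.polarCoord.symm (p, φ)‖ = p := by
    intro p φ hp
    rw [Complex.norm_polarCoord_symm, abs_of_pos hp]
  have hside : ∀ p φ : ℝ, ‖(r : ℂ) - Complex.polarCoord.symm (p, φ)‖ = thirdSide p r φ := by
    intro p φ
    rw [thirdSide, Complex.norm_def, Complex.polarCoord_symm_apply, Complex.normSq_apply]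
    congr 1
    simp [-Complex.ofReal_cos, -Complex.ofReal_sin]
    nlinarith [sin_sq_add_cos_sq φ]
  set g : ℝ → ℝ → ℝ≥0∞ := fun p φ => ENNReal.ofReal (jb (T p - thirdSide p r φ) ^ (-Θ)) with hg
  have hgm : Measurable (Function.uncurry g) := by
    rw [hg]; unfold Function.uncurry; fun_prop
  have hgp : ∀ p, Measurable (g p) := fun p => hgm.comp measurable_prodMk_left
  have heven : ∀ p, ∫⁻ φ in Set.Ioo (-π) π, g p φ ≤ 2 * ∫⁻ φ in Set.Ioo 0 π, g p φ := by
    intro p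
    have hneg : ∫⁻ φ in Set.Ioo (-π) 0, g p φ = ∫⁻ φ in Set.Ioo 0 π, g p φ := by
      rw [← (Measure.measurePreserving_neg (volume : Measure ℝ)).setLIntegral_comp_preimage
        (s := Set.Ioo 0 π) measurableSet_Ioo (hgp p)]
      simp [hg, thirdSide]
    have hsub : Set.Ioo (-π) π ⊆ (Set.Ioo (-π) 0 ∪ {0}) ∪ Set.Ioo 0 π := by
      intro u hu
      rcases lt_trichotomy u 0 with h | h | h
      · exact Or.inl (Or.inl ⟨hu.1, h⟩)
      · exact Or.inl (Or.inr h)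
      · exact Or.inr ⟨h, hu.2⟩
    calc _ ≤ _ := lintegral_mono_set hsub
      _ ≤ _ := (lintegral_union_le _ _ _).trans (add_le_add_left (lintegral_union_le _ _ _) _)
      _ = _ := by
        rw [hneg]
        simp only [Measure.restrict_singleton, volume_singleton, zero_smul,
          lintegral_zero_measure, add_zero]
        rw [two_mul]
  calc _ = ∫⁻ z in polarCoord.target, ENNReal.ofReal z.1 * (f z.1 * g z.1 z.2) := by
        rw [hrot, ← Complex.lintegral_comp_polarCoord_symm]
        refine setLIntegral_congr_fun polarCoord.open_target.measurableSet fun z hz => ?_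
        have hz1 : 0 < z.1 := hz.1
        simp only [smul_eq_mul]
        rw [← Prod.mk.eta (p := z), hnorm _ _ hz1, hside]
    _ = ∫⁻ p in Set.Ioi (0 : ℝ), ENNReal.ofReal p * f p * ∫⁻ φ in Set.Ioo (-π) π, g p φ := by
        rw [polarCoord_target, Measure.volume_eq_prod, ← Measure.prod_restrict, lintegral_prod]
        · refine lintegral_congr fun p => ?_
          rw [← lintegral_const_mul _ (hgp p)]
          simp only [mul_assoc]
        · exact (Measurable.mul (by fun_prop)
            (Measurable.mul (by fun_prop) hgm)).aemeasurable
    _ ≤ _ := by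
        refine setLIntegral_mono' measurableSet_Ioi fun p hp => ?_
        gcongr
        refine (heven p).trans ?_
        refine (mul_le_mul_right (lintegral_angle_jb hΘ hp hr0 (T p)) 2).trans (le_of_eq ?_)
        rw [show (2 : ℝ≥0∞) = ENNReal.ofReal 2 by simp, ← ENNReal.ofReal_mul two_pos.le]
        congr 1; ring

/-! ### Trilinear forms and Schur type tests -/

/-- The frequency space `ℝ × ℂ`: a time frequency and a space frequency. -/
abbrev Freq := ℝ × ℂ

instance : (volume : Measure Freq).IsAddRightInvariant :=
  inferInstanceAs ((volume : Measure ℝ).prod (volume : Measure ℂ)).IsAddRightInvariant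

/-- The `L²` norm of a nonnegative function. -/
def l2 {α : Type*} [MeasureSpace α] (f : α → ℝ≥0∞) : ℝ≥0∞ := (∫⁻ x, f x ^ 2) ^ (1 / 2 : ℝ)

lemma ENNReal.rpow_half_sq (a : ℝ≥0∞) : (a ^ (1 / 2 : ℝ)) ^ 2 = a := by
  rw [← ENNReal.rpow_natCast, ← ENNReal.rpow_mul]; norm_num

lemma ENNReal.sq_rpow_half (a : ℝ≥0∞) : (a ^ 2) ^ (1 / 2 : ℝ) = a := by
  rw [← ENNReal.rpow_natCast, ← ENNReal.rpow_mul]; norm_num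

section l2

variable {α β : Type*} [MeasureSpace α] [MeasureSpace β]

lemma l2_sq (f : α → ℝ≥0∞) : l2 f ^ 2 = ∫⁻ x, f x ^ 2 := ENNReal.rpow_half_sq _

lemma l2_le_of_sq_le {f : α → ℝ≥0∞} {a : ℝ≥0∞} (h : ∫⁻ x, f x ^ 2 ≤ a ^ 2) : l2 f ≤ a :=
  (ENNReal.rpow_le_rpow h (by norm_num)).trans_eq (ENNReal.sq_rpow_half a)

lemma lintegral_mul_le_l2_mul_l2 {f g : α → ℝ≥0∞} (hf : Measurable f) (hg : Measurable g) :
    ∫⁻ x, f x * g x ≤ l2 f * l2 g := by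
  have := ENNReal.lintegral_mul_le_Lp_mul_Lq (volume : Measure α) Real.HolderConjugate.two_two
    hf.aemeasurable hg.aemeasurable
  simpa [l2, ENNReal.rpow_two] using this

end l2

/-- The trilinear form with kernel `√k`. -/
def tri (k : Freq → Freq → ℝ≥0∞) (F G w : Freq → ℝ≥0∞) : ℝ≥0∞ :=
  ∫⁻ x : Freq × Freq, F x.1 * G x.2 * w (x.1 + x.2) * k x.1 x.2 ^ (1 / 2 : ℝ)

/-- Boundedness of the trilinear form with kernel `√k` on `L² × L² × L²`. -/
def TriBound (k : Freq → Freq → ℝ≥0∞) (M : ℝ≥0∞) : Prop :=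
  ∀ F G w : Freq → ℝ≥0∞, Measurable F → Measurable G → Measurable w →
    tri k F G w ≤ M * (l2 F * l2 G * l2 w)

section TriBound

variable {k k' : Freq → Freq → ℝ≥0∞} {M M' : ℝ≥0∞}

lemma TriBound.mono (h : TriBound k' M) (hk : ∀ x y, k x y ≤ k' x y) (hM : M ≤ M') :
    TriBound k M' := by
  intro F G w hF hG hw
  refine le_trans (lintegral_mono fun x => ?_) ((h F G w hF hG hw).trans (by gcongr))
  gcongr
  exact hk _ _

lemma TriBound.of_cover {ι : Type*} [Countable ι] {κ : ι → Freq → Freq → ℝ≥0∞} {m : ι → ℝ≥0∞}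
    (hκ : ∀ i, Measurable (Function.uncurry (κ i))) (h : ∀ i, TriBound (κ i) (m i))
    (hk : ∀ x y, ∃ i, k x y ≤ κ i x y) : TriBound k (∑' i, m i) := by
  intro F G w hF hG hw
  rw [← ENNReal.tsum_mul_right]
  refine le_trans ?_ (ENNReal.tsum_le_tsum fun i => h i F G w hF hG hw)
  unfold tri
  rw [← lintegral_tsum]
  · refine lintegral_mono fun x => ?_
    obtain ⟨i, hi⟩ := hk x.1 x.2
    refine le_trans ?_ (ENNReal.le_tsum i)
    gcongr
  · intro i
    have := hκ i
    exact (((hF.comp measurable_fst).mul (hG.comp measurable_snd)).mul (by fun_prop)).mul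
      (this.pow_const _) |>.aemeasurable

lemma TriBound.symm (h : TriBound (fun x y => k y x) M) : TriBound k M := by
  intro F G w hF hG hw
  refine le_trans (le_of_eq ?_) ((h G F w hG hF hw).trans (by rw [mul_comm (l2 G)]))
  unfold tri
  rw [Measure.volume_eq_prod]
  refine ((Measure.measurePreserving_swap (μ := (volume : Measure Freq))
    (ν := (volume : Measure Freq))).lintegral_comp_emb
      MeasurableEquiv.prodComm.measurableEmbedding _).symm.trans ?_
  refine lintegral_congr fun x => ?_
  simp only [Prod.fst_swap, Prod.snd_swap]
  rw [add_comm x.2, mul_comm (F x.2)]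

lemma lintegral_freq_prod_mul {F G : Freq → ℝ≥0∞} (hF : Measurable F) (hG : Measurable G) :
    ∫⁻ x : Freq × Freq, F x.1 * G x.2 = (∫⁻ x, F x) * ∫⁻ x, G x := by
  rw [Measure.volume_eq_prod]
  exact lintegral_prod_mul hF.aemeasurable hG.aemeasurable

/-- Change of variables `z = x + y` in the second variable. -/
lemma lintegral_freq_add {H : Freq → Freq → ℝ≥0∞} (hH : Measurable (Function.uncurry H)) :
    ∫⁻ x : Freq × Freq, H x.1 x.2 = ∫⁻ z : Freq, ∫⁻ x : Freq, H x (z - x) := by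
  have hm : Measurable fun x : Freq × Freq => H x.1 (x.2 - x.1) :=
    hH.comp (by fun_prop : Measurable fun x : Freq × Freq => (x.1, x.2 - x.1))
  rw [Measure.volume_eq_prod, lintegral_prod (fun x : Freq × Freq => H x.1 x.2) hH.aemeasurable,
    lintegral_lintegral_swap (f := fun z x => H x (z - x))
      (hm.comp measurable_swap).aemeasurable]
  refine lintegral_congr fun x => ?_
  exact (lintegral_sub_right_eq_self (fun y => H x y) x).symm

lemma TriBound.of_lintegral_sub (hk : Measurable (Function.uncurry k))
    (h : ∀ z, ∫⁻ x, k x (z - x) ≤ M) : TriBound k (M ^ (1 / 2 : ℝ)) := by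
  intro F G w hF hG hw
  have hk' : Measurable fun x : Freq × Freq => k x.1 x.2 := hk
  have hF1 : Measurable fun x : Freq × Freq => F x.1 := by fun_prop
  have hG1 : Measurable fun x : Freq × Freq => G x.2 := by fun_prop
  have hw1 : Measurable fun x : Freq × Freq => w (x.1 + x.2) := by fun_prop
  have h1 := lintegral_mul_le_l2_mul_l2 (hF1.mul hG1) (hw1.mul (hk'.pow_const (1 / 2 : ℝ)))
  have h2 : l2 (fun x : Freq × Freq => F x.1 * G x.2) ≤ l2 F * l2 G := by
    refine l2_le_of_sq_le (le_of_eq ?_)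
    simp only [mul_pow, l2_sq]
    exact lintegral_freq_prod_mul (hF.pow_const 2) (hG.pow_const 2)
  have h3 : l2 (fun x : Freq × Freq => w (x.1 + x.2) * k x.1 x.2 ^ (1 / 2 : ℝ)) ≤
      M ^ (1 / 2 : ℝ) * l2 w := by
    refine l2_le_of_sq_le ?_
    simp only [mul_pow, l2_sq, ENNReal.rpow_half_sq]
    rw [lintegral_freq_add (H := fun x y => w (x + y) ^ 2 * k x y) (by
      exact (hw1.pow_const 2).mul hk'), ← lintegral_const_mul _ (by fun_prop)]
    refine lintegral_mono fun z => ?_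
    simp only [add_sub_cancel]
    have hkz : Measurable fun x : Freq => k x (z - x) :=
      hk'.comp (by fun_prop : Measurable fun x : Freq => ((x, z - x) : Freq × Freq))
    rw [lintegral_const_mul _ hkz, mul_comm]
    gcongr
    exact h z
  calc tri k F G w = ∫⁻ x : Freq × Freq, (F x.1 * G x.2) *
        (w (x.1 + x.2) * k x.1 x.2 ^ (1 / 2 : ℝ)) := by simp only [tri, mul_assoc]
    _ ≤ _ := h1
    _ ≤ (l2 F * l2 G) * (M ^ (1 / 2 : ℝ) * l2 w) := mul_le_mul' h2 h3
    _ = _ := by ring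

lemma TriBound.of_lintegral_right (hk : Measurable (Function.uncurry k))
    (h : ∀ x, ∫⁻ y, k x y ≤ M) : TriBound k (M ^ (1 / 2 : ℝ)) := by
  intro F G w hF hG hw
  have hk' : Measurable fun x : Freq × Freq => k x.1 x.2 := hk
  have hF1 : Measurable fun x : Freq × Freq => F x.1 := by fun_prop
  have hG1 : Measurable fun x : Freq × Freq => G x.2 := by fun_prop
  have hw1 : Measurable fun x : Freq × Freq => w (x.1 + x.2) := by fun_prop
  have h1 := lintegral_mul_le_l2_mul_l2 (hG1.mul hw1) (hF1.mul (hk'.pow_const (1 / 2 : ℝ)))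
  have h2 : l2 (fun x : Freq × Freq => G x.2 * w (x.1 + x.2)) ≤ l2 G * l2 w := by
    refine l2_le_of_sq_le (le_of_eq ?_)
    simp only [mul_pow, l2_sq]
    rw [Measure.volume_eq_prod, lintegral_prod_symm _ (by fun_prop),
      ← lintegral_mul_const _ (by fun_prop)]
    refine lintegral_congr fun y => ?_
    simp only
    rw [lintegral_const_mul _ (by fun_prop)]
    congr 1
    exact lintegral_add_right_eq_self (fun z => w z ^ 2) y
  have h3 : l2 (fun x : Freq × Freq => F x.1 * k x.1 x.2 ^ (1 / 2 : ℝ)) ≤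
      M ^ (1 / 2 : ℝ) * l2 F := by
    refine l2_le_of_sq_le ?_
    simp only [mul_pow, l2_sq, ENNReal.rpow_half_sq]
    rw [Measure.volume_eq_prod, lintegral_prod _ (by fun_prop),
      ← lintegral_const_mul _ (by fun_prop)]
    refine lintegral_mono fun x => ?_
    simp only
    have hkx : Measurable fun y : Freq => k x y := hk'.comp measurable_prodMk_left
    rw [lintegral_const_mul _ hkx, mul_comm]
    gcongr
    exact h x
  calc tri k F G w = ∫⁻ x : Freq × Freq, (G x.2 * w (x.1 + x.2)) *
        (F x.1 * k x.1 x.2 ^ (1 / 2 : ℝ)) := by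
        unfold tri; refine lintegral_congr fun x => ?_; ring
    _ ≤ _ := h1
    _ ≤ (l2 G * l2 w) * (M ^ (1 / 2 : ℝ) * l2 F) := mul_le_mul' h2 h3
    _ = _ := by ring

/-- The indicator function of `|a - c| ≤ R`. -/
def window (R a c : ℝ) : ℝ≥0∞ := {c : ℝ | |a - c| ≤ R}.indicator (fun _ => 1) c

lemma window_of_le {R a c : ℝ} (h : |a - c| ≤ R) : window R a c = 1 := by simp [window, h]

lemma window_of_not_le {R a c : ℝ} (h : ¬ |a - c| ≤ R) : window R a c = 0 := by simp [window, h]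

lemma window_sq (R a c : ℝ) : window R a c ^ 2 = window R a c := by
  by_cases h : |a - c| ≤ R <;> simp [window, h]

@[fun_prop]
lemma measurable_window {α : Type*} [MeasurableSpace α] {f g : α → ℝ} {R : ℝ}
    (hf : Measurable f) (hg : Measurable g) : Measurable fun x => window R (f x) (g x) :=
  measurable_const.indicator (f := fun _ : α => (1 : ℝ≥0∞))
    (measurableSet_le (by fun_prop : Measurable fun x => |f x - g x|) measurable_const)

lemma lintegral_window (R a : ℝ) : ∫⁻ c : ℝ, window R a c = ENNReal.ofReal (2 * R) := by
  have : {c : ℝ | |a - c| ≤ R} = Set.Icc (a - R) (a + R) := by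
    ext c; simp only [Set.mem_ofPred_eq, abs_le, Set.mem_Icc]
    constructor <;> rintro ⟨h, h'⟩ <;> constructor <;> linarith
  unfold window
  rw [this, lintegral_indicator measurableSet_Icc, setLIntegral_const, volume_Icc, one_mul]
  congr 1; ring

lemma lintegral_l2_window_sq {F : Freq → ℝ≥0∞} (hF : Measurable F) {ρ : Freq → ℝ}
    (hρ : Measurable ρ) (R : ℝ) :
    ∫⁻ c : ℝ, l2 (fun x => F x * window R (ρ x) c) ^ 2 = ENNReal.ofReal (2 * R) * l2 F ^ 2 := by
  simp only [l2_sq, mul_pow, window_sq]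
  rw [lintegral_lintegral_swap (by fun_prop), ← lintegral_const_mul _ (by fun_prop)]
  refine lintegral_congr fun x => ?_
  rw [lintegral_const_mul _ (by fun_prop), lintegral_window, mul_comm]

lemma measurable_l2_window {F : Freq → ℝ≥0∞} (hF : Measurable F) {ρ : Freq → ℝ}
    (hρ : Measurable ρ) (R : ℝ) : Measurable fun c => l2 (fun x => F x * window R (ρ x) c) := by
  have : Measurable fun q : ℝ × Freq => (F q.2 * window R (ρ q.2) q.1) ^ 2 := by fun_prop
  exact this.lintegral_prod_right'.pow_const _

/-- Localization: if the kernel forces `ρ₁ x` and `ρ₂ y` to be close, it is enough to test on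
sets where `ρ₁` is confined to a short interval. -/
lemma TriBound.of_localized (hk : Measurable (Function.uncurry k)) {ρ₁ ρ₂ : Freq → ℝ}
    (hρ₁ : Measurable ρ₁) (hρ₂ : Measurable ρ₂) {R : ℝ} (hR : 0 < R)
    (hsupp : ∀ x y, k x y ≠ 0 → |ρ₁ x - ρ₂ y| ≤ R)
    (h : ∀ z c, ∫⁻ x in {x | |ρ₁ x - c| ≤ R}, k x (z - x) ≤ M) :
    TriBound k (2 * M ^ (1 / 2 : ℝ)) := by
  intro F G w hF hG hw
  have hk' : Measurable fun x : Freq × Freq => k x.1 x.2 := hk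
  have hloc : ∀ c, TriBound (fun x y => k x y * window R (ρ₁ x) c) (M ^ (1 / 2 : ℝ)) := by
    intro c
    refine TriBound.of_lintegral_sub
      (hk'.mul (by fun_prop)) fun z => ?_
    refine le_trans (le_of_eq ?_) (h z c)
    rw [← lintegral_indicator (measurableSet_le (by fun_prop) measurable_const)]
    refine lintegral_congr fun x => ?_
    by_cases hx : |ρ₁ x - c| ≤ R <;> simp [window, hx]
  have hsplit : ENNReal.ofReal (2 * R) * tri k F G w =
      ∫⁻ c, tri (fun x y => k x y * window R (ρ₁ x) c) (fun x => F x * window R (ρ₁ x) c)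
        (fun y => G y * window (2 * R) (ρ₂ y) c) w := by
    have hm : Measurable fun q : ℝ × (Freq × Freq) => F q.2.1 * window R (ρ₁ q.2.1) q.1 *
        (G q.2.2 * window (2 * R) (ρ₂ q.2.2) q.1) * w (q.2.1 + q.2.2) *
          (k q.2.1 q.2.2 * window R (ρ₁ q.2.1) q.1) ^ (1 / 2 : ℝ) := by
      have h3 : Measurable fun q : ℝ × (Freq × Freq) => k q.2.1 q.2.2 := hk'.comp measurable_snd
      fun_prop
    unfold tri
    rw [lintegral_lintegral_swap hm.aemeasurable, ← lintegral_const_mul _ (by fun_prop)]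
    refine lintegral_congr fun x => ?_
    rw [mul_comm, ← lintegral_window R (ρ₁ x.1), ← lintegral_const_mul _ (by fun_prop)]
    refine lintegral_congr fun c => ?_
    by_cases hx : |ρ₁ x.1 - c| ≤ R
    · by_cases hkx : k x.1 x.2 = 0
      · simp [hkx]
      · have : |ρ₂ x.2 - c| ≤ 2 * R := by
          have h1 := abs_sub_le (ρ₂ x.2) (ρ₁ x.1) c
          have h2 := hsupp _ _ hkx
          rw [abs_sub_comm] at h2
          linarith
        simp [window_of_le hx, window_of_le this]
    · simp [window_of_not_le hx]
  have hcs : ∫⁻ c, l2 (fun x => F x * window R (ρ₁ x) c) *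
      l2 (fun y => G y * window (2 * R) (ρ₂ y) c) ≤
      ENNReal.ofReal (4 * R) * (l2 F * l2 G) := by
    refine (lintegral_mul_le_l2_mul_l2 (measurable_l2_window hF hρ₁ R)
      (measurable_l2_window hG hρ₂ (2 * R))).trans ?_
    have e1 : l2 (fun c => l2 (fun x => F x * window R (ρ₁ x) c)) ≤
        ENNReal.ofReal (4 * R) ^ (1 / 2 : ℝ) * l2 F := by
      refine l2_le_of_sq_le ?_
      rw [lintegral_l2_window_sq hF hρ₁, mul_pow, ENNReal.rpow_half_sq]
      gcongr
      norm_num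
    have e2 : l2 (fun c => l2 (fun x => G x * window (2 * R) (ρ₂ x) c)) ≤
        ENNReal.ofReal (4 * R) ^ (1 / 2 : ℝ) * l2 G := by
      refine l2_le_of_sq_le ?_
      rw [lintegral_l2_window_sq hG hρ₂, mul_pow, ENNReal.rpow_half_sq,
        show 2 * (2 * R) = 4 * R by ring]
    refine (mul_le_mul' e1 e2).trans (le_of_eq ?_)
    nth_rewrite 3 [← ENNReal.rpow_half_sq (ENNReal.ofReal (4 * R))]
    ring
  have hR' : ENNReal.ofReal (2 * R) ≠ 0 := by simpa using hR
  refine (ENNReal.mul_le_mul_iff_right hR' ENNReal.ofReal_ne_top).1 ?_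
  calc ENNReal.ofReal (2 * R) * tri k F G w
      ≤ ∫⁻ c, M ^ (1 / 2 : ℝ) * (l2 (fun x => F x * window R (ρ₁ x) c) *
          l2 (fun y => G y * window (2 * R) (ρ₂ y) c) * l2 w) := by
        rw [hsplit]
        exact lintegral_mono fun c => hloc c _ _ _ (by fun_prop) (by fun_prop) hw
    _ ≤ ENNReal.ofReal (2 * R) * (2 * M ^ (1 / 2 : ℝ) * (l2 F * l2 G * l2 w)) := by
        have hm : Measurable fun c => l2 (fun x => F x * window R (ρ₁ x) c) *
            l2 (fun y => G y * window (2 * R) (ρ₂ y) c) := (measurable_l2_window hF hρ₁ R).mul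
          (measurable_l2_window hG hρ₂ (2 * R))
        rw [lintegral_const_mul _ (hm.mul_const _), lintegral_mul_const _ hm]
        calc _ ≤ M ^ (1 / 2 : ℝ) * (ENNReal.ofReal (4 * R) * (l2 F * l2 G) * l2 w) := by gcongr
          _ = _ := by
            rw [show 4 * R = 2 * R * 2 by ring, ENNReal.ofReal_mul (by positivity),
              ENNReal.ofReal_ofNat]
            ring

end TriBound

/-! ### Integrals along the level sets of `x + y` -/

lemma lintegral_freq_jb {Θ : ℝ} (hΘ : 1 < Θ) {g : ℂ → ℝ≥0∞} (hg : Measurable g) {α β : ℂ → ℝ}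
    (hα : Measurable α) (hβ : Measurable β) (τ : ℝ) :
    ∫⁻ x : Freq, g x.2 *
        ENNReal.ofReal (jb (x.1 - α x.2) ^ (-Θ) * jb (τ - x.1 - β x.2) ^ (-Θ)) ≤
      ENNReal.ofReal (2 ^ Θ * (2 * jbMass Θ)) *
        ∫⁻ ξ, g ξ * ENNReal.ofReal (jb (τ - α ξ - β ξ) ^ (-Θ)) := by
  have hm := jbMass_nonneg Θ
  rw [Measure.volume_eq_prod, lintegral_prod_symm _ (by fun_prop),
    ← lintegral_const_mul _ (by fun_prop)]
  refine lintegral_mono fun ξ => ?_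
  simp only
  rw [lintegral_const_mul _ (by fun_prop), mul_left_comm, ← ENNReal.ofReal_mul (by positivity)]
  gcongr
  exact lintegral_jb_mul_jb hΘ τ (α ξ) (β ξ)

lemma jb_sign_mul_sub {e : ℝ} (he : e = 1 ∨ e = -1) (a q : ℝ) :
    jb (e * a - q) = jb (a - e * q) := by
  rcases he with rfl | rfl
  · simp
  · rw [← jb_neg]; congr 1; ring

/-- The constant in `lintegral_freq_radial`. -/
def radConst (Θ : ℝ) : ℝ := 2 ^ Θ * (2 * jbMass Θ) * (2 * angConst Θ)

lemma radConst_nonneg (Θ : ℝ) : 0 ≤ radConst Θ := by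
  have := jbMass_nonneg Θ
  have := angConst_nonneg Θ
  unfold radConst; positivity

lemma lintegral_freq_radial {Θ e₁ e₂ : ℝ} (hΘ : 1 < Θ) (he₂ : e₂ = 1 ∨ e₂ = -1)
    {g : ℝ → ℝ≥0∞} (hg : Measurable g) (τ : ℝ) (v : ℂ) :
    ∫⁻ x : Freq, g ‖x.2‖ * ENNReal.ofReal
        (jb (x.1 - e₁ * ‖x.2‖) ^ (-Θ) * jb (τ - x.1 - e₂ * ‖v - x.2‖) ^ (-Θ)) ≤
      ENNReal.ofReal (radConst Θ) * ∫⁻ p in Set.Ioi (0 : ℝ), ENNReal.ofReal p * g p *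
        ENNReal.ofReal ((1 + min p ‖v‖) ^ (-(1 / 2) : ℝ) *
          (jb (τ - (e₁ * p + e₂ * |p - ‖v‖|)) ^ (-(1 / 2) : ℝ) +
            jb (τ - (e₁ * p + e₂ * (p + ‖v‖))) ^ (-(1 / 2) : ℝ))) := by
  have h1 := jbMass_nonneg Θ
  have h2 := angConst_nonneg Θ
  refine (lintegral_freq_jb (g := fun ξ => g ‖ξ‖) hΘ (by fun_prop)
    (by fun_prop : Measurable fun ξ : ℂ => e₁ * ‖ξ‖)
    (by fun_prop : Measurable fun ξ : ℂ => e₂ * ‖v - ξ‖) τ).trans ?_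
  have hrad : ENNReal.ofReal (radConst Θ) =
      ENNReal.ofReal (2 ^ Θ * (2 * jbMass Θ)) * ENNReal.ofReal (2 * angConst Θ) :=
    ENNReal.ofReal_mul (by positivity)
  rw [hrad, mul_assoc (ENNReal.ofReal _)]
  gcongr
  have := lintegral_radial_mul_jb hΘ v hg
    (by fun_prop : Measurable fun p : ℝ => e₂ * (τ - e₁ * p))
  simp only [jb_sign_mul_sub he₂] at this
  simp only [sub_sub] at this ⊢
  refine this.trans (le_of_eq ?_)
  rw [← lintegral_const_mul _ (by fun_prop)]
  refine setLIntegral_congr_fun measurableSet_Ioi fun p hp => ?_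
  have hp : 0 < p := hp
  have : 0 ≤ (1 + min p ‖v‖) ^ (-(1 / 2) : ℝ) := by
    have := le_min hp.le (norm_nonneg v)
    positivity
  rw [mul_assoc (2 * angConst Θ), ENNReal.ofReal_mul (by positivity)]
  ring

/-! ### The kernel -/

/-- The square of the kernel of the bilinear estimate, for the branches of the cone selected by
the signs `e₁`, `e₂`. -/
def waveKer (σ A B Θ e₁ e₂ : ℝ) (x y : Freq) : ℝ :=
  (1 + ‖x.2 + y.2‖) ^ (-σ) * jb (|x.1 + y.1| - ‖x.2 + y.2‖) ^ B *
    ((1 + ‖x.2‖) ^ (-A) * (1 + ‖y.2‖) ^ (-A)) *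
      (jb (x.1 - e₁ * ‖x.2‖) ^ (-Θ) * jb (y.1 - e₂ * ‖y.2‖) ^ (-Θ))

/-- Restriction of a kernel to a set. -/
def cut (S : Set (Freq × Freq)) (k : Freq → Freq → ℝ) (x y : Freq) : ℝ≥0∞ :=
  S.indicator (fun q => ENNReal.ofReal (k q.1 q.2)) (x, y)

lemma cut_of_mem {S : Set (Freq × Freq)} {k : Freq → Freq → ℝ} {x y : Freq} (h : (x, y) ∈ S) :
    cut S k x y = ENNReal.ofReal (k x y) := Set.indicator_of_mem h _

lemma cut_of_notMem {S : Set (Freq × Freq)} {k : Freq → Freq → ℝ} {x y : Freq} (h : (x, y) ∉ S) :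
    cut S k x y = 0 := Set.indicator_of_notMem h _

lemma cut_le {S : Set (Freq × Freq)} {k : Freq → Freq → ℝ} {x y : Freq} {a : ℝ≥0∞}
    (h : (x, y) ∈ S → ENNReal.ofReal (k x y) ≤ a) : cut S k x y ≤ a := by
  by_cases hS : (x, y) ∈ S
  · rw [cut_of_mem hS]; exact h hS
  · rw [cut_of_notMem hS]; exact zero_le

lemma measurable_cut {S : Set (Freq × Freq)} (hS : MeasurableSet S) {k : Freq → Freq → ℝ}
    (hk : Measurable fun q : Freq × Freq => k q.1 q.2) :
    Measurable (Function.uncurry (cut S k)) :=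
  hk.ennreal_ofReal.indicator hS

lemma measurable_waveKer (σ A B Θ e₁ e₂ : ℝ) :
    Measurable fun q : Freq × Freq => waveKer σ A B Θ e₁ e₂ q.1 q.2 := by
  unfold waveKer; fun_prop

lemma waveKer_comm (σ A B Θ e₁ e₂ : ℝ) (x y : Freq) :
    waveKer σ A B Θ e₁ e₂ x y = waveKer σ A B Θ e₂ e₁ y x := by
  unfold waveKer
  rw [add_comm y.1, add_comm y.2]
  ring

/-- Exponents for which the bilinear estimate holds, with a gain `η`. -/
structure Admissible (σ A B Θ η : ℝ) : Prop where
  one_le_σ : 1 ≤ σ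
  A_nonneg : 0 ≤ A
  A_le : A ≤ 1 / 2
  B_nonneg : 0 ≤ B
  B_le : B ≤ 1 / 2
  B_le_A : B ≤ 2 * A
  one_lt_Θ : 1 < Θ
  η_pos : 0 < η
  η_le₁ : η ≤ σ + 2 * A - 3 / 2
  η_le₂ : η ≤ σ + 4 * A - B - 2
  η_le₃ : η ≤ σ + 2 * A - B - 1

/-! ### Output frequency dominating one of the inputs -/

/-- The endpoints of the range of `e₁ p + e₂ q`, for `q` ranging over the lengths of the third side
of triangles with sides `p`, `r`. -/
lemma jb_sub_end {e₁ e₂ : ℝ} (he₁ : e₁ = 1 ∨ e₁ = -1) (he₂ : e₂ = 1 ∨ e₂ = -1) {p r τ m : ℝ}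
    (hp : 0 ≤ p) (hr : 0 ≤ r) (hm : m = e₁ * p + e₂ * |p - r| ∨ m = e₁ * p + e₂ * (p + r)) :
    jb (|τ| - r) ≤ jb (τ - m) ∨ (jb (|τ| - r) ≤ jb (τ - m) + 2 * p ∧
      (m = 2 * p - r ∨ m = 2 * p + r ∨ m = -(2 * p - r) ∨ m = -(2 * p + r))) := by
  have hr1 : jb (|τ| - r) ≤ jb (τ - r) := jb_le_jb (by
    have := abs_abs_sub_abs_le τ r; rwa [abs_of_nonneg hr] at this)
  have hr2 : jb (|τ| - r) ≤ jb (τ + r) := jb_le_jb (by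
    have := abs_abs_sub_abs_le τ (-r); rwa [abs_neg, abs_of_nonneg hr, sub_neg_eq_add] at this)
  have h2p : ∀ a b : ℝ, |a - b| ≤ 2 * p → jb a ≤ jb b + 2 * p := fun a b h => by
    have := jb_add_le b (a - b)
    rw [add_sub_cancel] at this
    linarith
  have key : (m = r ∨ m = -r) ∨ (m = 2 * p - r ∨ m = 2 * p + r ∨ m = -(2 * p - r) ∨
      m = -(2 * p + r)) := by
    rcases le_total p r with h | h
    · rw [abs_of_nonpos (by linarith)] at hm
      rcases he₁ with rfl | rfl <;> rcases he₂ with rfl | rfl <;> grind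
    · rw [abs_of_nonneg (by linarith)] at hm
      rcases he₁ with rfl | rfl <;> rcases he₂ with rfl | rfl <;> grind
  rcases key with (rfl | rfl) | h
  · exact Or.inl hr1
  · exact Or.inl (by simpa using hr2)
  · refine Or.inr ⟨?_, h⟩
    have hp2 : |2 * p| ≤ 2 * p := (abs_of_nonneg (by linarith)).le
    rcases h with rfl | rfl | rfl | rfl
    · exact hr2.trans (h2p _ _ (by convert! hp2 using 2; ring))
    · exact hr1.trans (h2p _ _ (by convert! hp2 using 2; ring))
    · exact hr1.trans (h2p _ _ (by rw [← abs_neg]; convert! hp2 using 2; ring))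
    · exact hr2.trans (h2p _ _ (by rw [← abs_neg]; convert! hp2 using 2; ring))

lemma rpow_neg_le_mul_of_le_mul {A c x y : ℝ} (hA : 0 ≤ A) (hA1 : A ≤ 1) (hc : 1 ≤ c)
    (hy : 0 < y) (h : y ≤ c * x) : x ^ (-A) ≤ c * y ^ (-A) := by
  have hc0 : 0 < c := one_pos.trans_le hc
  calc x ^ (-A) ≤ (y / c) ^ (-A) :=
        rpow_le_rpow_of_nonpos (by positivity) (by rw [div_le_iff₀ hc0]; linarith) (by linarith)
    _ = c ^ A * y ^ (-A) := by
        rw [div_rpow hy.le hc0.le, rpow_neg hc0.le, div_inv_eq_mul, mul_comm]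
    _ ≤ c * y ^ (-A) := by
        gcongr
        exact (rpow_le_rpow_of_exponent_le hc hA1).trans_eq (rpow_one c)

/-- Sum of the singularities at the endpoints depending on `p`. -/
def endSum (τ r p : ℝ) : ℝ :=
  jb (p - (τ + r) / 2) ^ (-(1 / 2) : ℝ) + jb (p - (τ - r) / 2) ^ (-(1 / 2) : ℝ) +
    jb (p - (r - τ) / 2) ^ (-(1 / 2) : ℝ) + jb (p - (-τ - r) / 2) ^ (-(1 / 2) : ℝ)

lemma endSum_nonneg (τ r p : ℝ) : 0 ≤ endSum τ r p := by
  have := fun c => jb_rpow_nonneg (p - c) (-(1 / 2))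
  unfold endSum
  linarith [this ((τ + r) / 2), this ((τ - r) / 2), this ((r - τ) / 2), this ((-τ - r) / 2)]

lemma jb_rpow_le_of_abs_le {s t b : ℝ} (hb : 0 ≤ b) (h : |s| ≤ |t|) : jb t ^ (-b) ≤ jb s ^ (-b) :=
  rpow_le_rpow_of_nonpos (jb_pos _) (jb_le_jb h) (by linarith)

lemma rpow_half_mul_jb_end_le {e₁ e₂ : ℝ} (he₁ : e₁ = 1 ∨ e₁ = -1) (he₂ : e₂ = 1 ∨ e₂ = -1)
    {p r τ m : ℝ} (hp : 0 ≤ p) (hr : 0 ≤ r)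
    (hm : m = e₁ * p + e₂ * |p - r| ∨ m = e₁ * p + e₂ * (p + r)) :
    jb (|τ| - r) ^ (1 / 2 : ℝ) * jb (τ - m) ^ (-(1 / 2) : ℝ) ≤ 1 + √(2 * p) * endSum τ r p := by
  have hj := jb_pos (τ - m)
  have hE := endSum_nonneg τ r p
  have hinv : jb (τ - m) ^ (1 / 2 : ℝ) * jb (τ - m) ^ (-(1 / 2) : ℝ) = 1 := by
    rw [← rpow_add hj]; norm_num
  rcases jb_sub_end he₁ he₂ hp hr hm with h | ⟨h, h'⟩
  · calc _ ≤ jb (τ - m) ^ (1 / 2 : ℝ) * jb (τ - m) ^ (-(1 / 2) : ℝ) := by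
          gcongr
          exact (jb_pos _).le
      _ ≤ _ := by rw [hinv]; linarith [mul_nonneg (sqrt_nonneg (2 * p)) hE]
  · have h1 : jb (|τ| - r) ^ (1 / 2 : ℝ) ≤ jb (τ - m) ^ (1 / 2 : ℝ) + √(2 * p) := by
      rw [← sqrt_eq_rpow, ← sqrt_eq_rpow]
      refine (sqrt_le_sqrt h).trans ?_
      rw [sqrt_le_left (by positivity), add_sq, sq_sqrt hj.le, sq_sqrt (by positivity)]
      linarith [mul_nonneg (sqrt_nonneg (jb (τ - m))) (sqrt_nonneg (2 * p))]
    have h2 : jb (τ - m) ^ (-(1 / 2) : ℝ) ≤ endSum τ r p := by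
      have hle : ∀ c, τ - m = c - 2 * p ∨ τ - m = 2 * p - c →
          jb (τ - m) ^ (-(1 / 2) : ℝ) ≤ jb (p - c / 2) ^ (-(1 / 2) : ℝ) := by
        intro c hc
        refine jb_rpow_le_of_abs_le (by norm_num) ?_
        have : |τ - m| = 2 * |p - c / 2| := by
          rw [← abs_of_pos (two_pos : (0 : ℝ) < 2), ← abs_mul, abs_of_pos (two_pos : (0 : ℝ) < 2)]
          rcases hc with hc | hc
          · rw [hc, ← abs_neg]; congr 1; ring
          · rw [hc]; congr 1; ring
        rw [this]
        linarith [abs_nonneg (p - c / 2)]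
      unfold endSum
      have hn := fun c => jb_rpow_nonneg (p - c) (-(1 / 2))
      have n1 := hn ((τ + r) / 2)
      have n2 := hn ((τ - r) / 2)
      have n3 := hn ((r - τ) / 2)
      have n4 := hn ((-τ - r) / 2)
      rcases h' with rfl | rfl | rfl | rfl
      · linarith [hle (τ + r) (Or.inl (by ring))]
      · linarith [hle (τ - r) (Or.inl (by ring))]
      · linarith [hle (r - τ) (Or.inr (by ring))]
      · linarith [hle (-τ - r) (Or.inr (by ring))]
    calc _ ≤ (jb (τ - m) ^ (1 / 2 : ℝ) + √(2 * p)) * jb (τ - m) ^ (-(1 / 2) : ℝ) := by gcongr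
      _ = 1 + √(2 * p) * jb (τ - m) ^ (-(1 / 2) : ℝ) := by rw [add_mul, hinv]
      _ ≤ _ := by gcongr

lemma setLIntegral_endSum {ℓ : ℝ} (hℓ : 0 < ℓ) (τ r : ℝ) :
    ∫⁻ p in Set.Ioc 0 ℓ, ENNReal.ofReal (endSum τ r p) ≤ ENNReal.ofReal (20 * √ℓ) := by
  have hn := fun c p => jb_rpow_nonneg (p - c) (-(1 / 2))
  have h := fun c => setLIntegral_jb_rpow_neg_half (s := Set.Ioc 0 ℓ) hℓ (by simp) c
  unfold endSum
  have e : ∀ p, ENNReal.ofReal (jb (p - (τ + r) / 2) ^ (-(1 / 2) : ℝ) +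
      jb (p - (τ - r) / 2) ^ (-(1 / 2) : ℝ) + jb (p - (r - τ) / 2) ^ (-(1 / 2) : ℝ) +
        jb (p - (-τ - r) / 2) ^ (-(1 / 2) : ℝ)) =
      ENNReal.ofReal (jb (p - (τ + r) / 2) ^ (-(1 / 2) : ℝ)) +
      ENNReal.ofReal (jb (p - (τ - r) / 2) ^ (-(1 / 2) : ℝ)) +
      ENNReal.ofReal (jb (p - (r - τ) / 2) ^ (-(1 / 2) : ℝ)) +
      ENNReal.ofReal (jb (p - (-τ - r) / 2) ^ (-(1 / 2) : ℝ)) := by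
    intro p
    rw [ENNReal.ofReal_add (add_nonneg (add_nonneg (hn _ _) (hn _ _)) (hn _ _)) (hn _ _),
      ENNReal.ofReal_add (add_nonneg (hn _ _) (hn _ _)) (hn _ _),
      ENNReal.ofReal_add (hn _ _) (hn _ _)]
  simp only [e]
  rw [lintegral_add_left (by fun_prop), lintegral_add_left (by fun_prop),
    lintegral_add_left (by fun_prop)]
  calc _ ≤ ENNReal.ofReal (5 * √ℓ) + ENNReal.ofReal (5 * √ℓ) + ENNReal.ofReal (5 * √ℓ) +
        ENNReal.ofReal (5 * √ℓ) := by gcongr <;> exact h _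
    _ = _ := by
      have := sqrt_nonneg ℓ
      rw [← ENNReal.ofReal_add (by positivity) (by positivity),
        ← ENNReal.ofReal_add (by positivity) (by positivity),
        ← ENNReal.ofReal_add (by positivity) (by positivity)]
      congr 1; ring

/-- The region where the output frequency dominates the first input frequency, which is the smaller
one. -/
def lowRegion : Set (Freq × Freq) :=
  {q | ‖q.1.2‖ ≤ 16 * (1 + ‖q.1.2 + q.2.2‖) ∧ ‖q.1.2‖ ≤ ‖q.2.2‖}

lemma measurableSet_lowRegion : MeasurableSet lowRegion := by
  unfold lowRegion
  measurability

section waveKer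

variable {σ A B Θ η e₁ e₂ R : ℝ}

lemma lintegral_cut_lowRegion (hadm : Admissible σ A B Θ η) (he₁ : e₁ = 1 ∨ e₁ = -1)
    (he₂ : e₂ = 1 ∨ e₂ = -1) (z : Freq) :
    ∫⁻ x, cut lowRegion (waveKer σ A B Θ e₁ e₂) x (z - x) ≤
      ENNReal.ofReal (radConst Θ * (10 ^ 6)) := by
  obtain ⟨τ, v⟩ := z
  have hr : 0 ≤ ‖v‖ := norm_nonneg v
  set r := ‖v‖ with hrdef
  have hA := hadm.A_nonneg
  have hA2 := hadm.A_le
  have hB := hadm.B_le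
  set h := jb (|τ| - r) with hh
  have hh1 : 1 ≤ h := one_le_jb _
  have hh0 : 0 < h := jb_pos _
  set g : ℝ → ℝ≥0∞ := (Set.Iic (16 * (1 + r))).indicator fun p =>
    ENNReal.ofReal (2 * (1 + r) ^ (-σ - A) * h ^ (1 / 2 : ℝ) * (1 + p) ^ (-A)) with hg
  have hgm : Measurable g := Measurable.indicator (by fun_prop) measurableSet_Iic
  have h1r : 0 < 1 + r := by positivity
  calc _ ≤ ∫⁻ x : Freq, g ‖x.2‖ * ENNReal.ofReal
        (jb (x.1 - e₁ * ‖x.2‖) ^ (-Θ) * jb (τ - x.1 - e₂ * ‖v - x.2‖) ^ (-Θ)) := by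
        refine lintegral_mono fun x => cut_le fun hx => ?_
        simp only [lowRegion, Set.mem_ofPred_eq, Prod.snd_sub, add_sub_cancel] at hx
        rw [hg, Set.indicator_of_mem (by exact hx.1), ← ENNReal.ofReal_mul (by positivity)]
        refine ENNReal.ofReal_le_ofReal ?_
        unfold waveKer
        simp only [Prod.snd_sub, Prod.fst_sub, add_sub_cancel]
        refine mul_le_mul_of_nonneg_right ?_
          (mul_nonneg (jb_rpow_nonneg _ _) (jb_rpow_nonneg _ _))
        have hq : r ≤ ‖x.2‖ + ‖v - x.2‖ := by
          have := norm_add_le x.2 (v - x.2)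
          rwa [add_sub_cancel] at this
        have h1 : (1 + ‖v - x.2‖) ^ (-A) ≤ 2 * (1 + r) ^ (-A) :=
          rpow_neg_le_mul_of_le_mul hA (by linarith) one_le_two h1r (by linarith [hx.2])
        have h2 : h ^ B ≤ h ^ (1 / 2 : ℝ) := rpow_le_rpow_of_exponent_le hh1 hB
        calc _ ≤ (1 + r) ^ (-σ) * h ^ (1 / 2 : ℝ) *
              ((1 + ‖x.2‖) ^ (-A) * (2 * (1 + r) ^ (-A))) := by gcongr
          _ = _ := by rw [sub_eq_add_neg, rpow_add h1r]; ring
    _ ≤ _ := lintegral_freq_radial hadm.one_lt_Θ he₂ hgm τ v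
    _ ≤ ENNReal.ofReal (radConst Θ) * ENNReal.ofReal (10 ^ 6) := by
        gcongr
        set K : ℝ := 1156 * ((1 + r) ^ (-σ - A) * (1 + r) ^ (1 / 2 - A)) with hK
        have hK0 : 0 ≤ K := by positivity
        calc _ ≤ ∫⁻ p in Set.Ioi (0 : ℝ), (Set.Iic (16 * (1 + r))).indicator (fun p =>
              ENNReal.ofReal (K * (1 + 6 * √(1 + r) * endSum τ r p))) p := by
              refine setLIntegral_mono' measurableSet_Ioi fun p hp => ?_
              have hp : 0 < p := hp
              by_cases hp2 : p ∈ Set.Iic (16 * (1 + r))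
              swap
              · rw [hg, Set.indicator_of_notMem hp2]; simp
              rw [hg, Set.indicator_of_mem hp2, Set.indicator_of_mem hp2,
                ← ENNReal.ofReal_mul (by positivity), ← ENNReal.ofReal_mul (by positivity)]
              refine ENNReal.ofReal_le_ofReal ?_
              have hp2 : p ≤ 16 * (1 + r) := hp2
              have h1p : 0 < 1 + p := by positivity
              have hmin : 0 ≤ min p r := le_min hp.le hr
              have hE := endSum_nonneg τ r p
              have e1 : (1 + min p r) ^ (-(1 / 2) : ℝ) ≤ 17 * (1 + p) ^ (-(1 / 2) : ℝ) := by
                refine rpow_neg_le_mul_of_le_mul (by norm_num) (by norm_num) (by norm_num) h1p ?_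
                rcases le_total p r with hpr | hpr
                · rw [min_eq_left hpr]; linarith
                · rw [min_eq_right hpr]; linarith
              have e2 : p * (1 + p) ^ (-A) * (1 + min p r) ^ (-(1 / 2) : ℝ) ≤
                  289 * (1 + r) ^ (1 / 2 - A) := by
                calc _ ≤ (1 + p) * (1 + p) ^ (-A) * (17 * (1 + p) ^ (-(1 / 2) : ℝ)) := by
                      gcongr; linarith
                  _ = 17 * (1 + p) ^ (1 / 2 - A) := by
                      rw [show (1 / 2 - A) = 1 + -A + -(1 / 2) by ring, rpow_add h1p, rpow_add h1p,
                        rpow_one]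
                      ring
                  _ ≤ 17 * (17 * (1 + r)) ^ (1 / 2 - A) := by gcongr; linarith
                  _ ≤ 17 * (17 * (1 + r) ^ (1 / 2 - A)) := by
                      rw [mul_rpow (by norm_num) h1r.le]
                      gcongr
                      exact rpow_le_self_of_one_le (by norm_num) (by linarith)
                  _ = _ := by ring
              have e3 := rpow_half_mul_jb_end_le he₁ he₂ hp.le hr (τ := τ) (Or.inl rfl)
              have e4 := rpow_half_mul_jb_end_le he₁ he₂ hp.le hr (τ := τ) (Or.inr rfl)
              rw [← hh] at e3 e4
              have e5 : √(2 * p) ≤ 6 * √(1 + r) := by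
                rw [sqrt_le_left (by positivity), mul_pow, sq_sqrt h1r.le]
                linarith
              have e6 : h ^ (1 / 2 : ℝ) *
                  (jb (τ - (e₁ * p + e₂ * |p - r|)) ^ (-(1 / 2) : ℝ) +
                    jb (τ - (e₁ * p + e₂ * (p + r))) ^ (-(1 / 2) : ℝ)) ≤
                  2 * (1 + 6 * √(1 + r) * endSum τ r p) := by
                have := mul_le_mul_of_nonneg_right e5 hE
                linarith
              calc _ = 2 * (1 + r) ^ (-σ - A) *
                    (p * (1 + p) ^ (-A) * (1 + min p r) ^ (-(1 / 2) : ℝ)) *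
                    (h ^ (1 / 2 : ℝ) * (jb (τ - (e₁ * p + e₂ * |p - r|)) ^ (-(1 / 2) : ℝ) +
                      jb (τ - (e₁ * p + e₂ * (p + r))) ^ (-(1 / 2) : ℝ))) := by ring
                _ ≤ 2 * (1 + r) ^ (-σ - A) * (289 * (1 + r) ^ (1 / 2 - A)) *
                    (2 * (1 + 6 * √(1 + r) * endSum τ r p)) := by
                    gcongr
                    exact mul_nonneg (by positivity) (add_nonneg (jb_rpow_nonneg _ _)
                      (jb_rpow_nonneg _ _))
                _ = _ := by rw [hK]; ring
          _ = ∫⁻ p in Set.Ioc (0 : ℝ) (16 * (1 + r)),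
              ENNReal.ofReal (K * (1 + 6 * √(1 + r) * endSum τ r p)) := by
              rw [setLIntegral_indicator measurableSet_Iic, Set.inter_comm, Set.Ioi_inter_Iic]
          _ ≤ ENNReal.ofReal (K * (16 * (1 + r) + 480 * (1 + r))) := by
              have hE := endSum_nonneg τ r
              have hEm : Measurable (endSum τ r) := by unfold endSum; fun_prop
              have e : ∀ p, ENNReal.ofReal (K * (1 + 6 * √(1 + r) * endSum τ r p)) =
                  ENNReal.ofReal K * (1 + ENNReal.ofReal (6 * √(1 + r)) *
                    ENNReal.ofReal (endSum τ r p)) := by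
                intro p
                have := mul_nonneg (by positivity : 0 ≤ 6 * √(1 + r)) (hE p)
                rw [ENNReal.ofReal_mul hK0, ENNReal.ofReal_add zero_le_one this,
                  ENNReal.ofReal_mul (p := 6 * √(1 + r)) (by positivity), ENNReal.ofReal_one]
              simp only [e]
              rw [lintegral_const_mul _ (by fun_prop), lintegral_add_left (by fun_prop),
                lintegral_const_mul _ (by fun_prop), setLIntegral_const, volume_Ioc, sub_zero,
                one_mul, ENNReal.ofReal_mul hK0, ENNReal.ofReal_add (by positivity) (by positivity)]
              gcongr
              refine (mul_le_mul_right (setLIntegral_endSum (by positivity) τ r) _).trans ?_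
              rw [← ENNReal.ofReal_mul (by positivity)]
              refine ENNReal.ofReal_le_ofReal (le_of_eq ?_)
              rw [sqrt_mul (by norm_num), show (16 : ℝ) = 4 ^ 2 by norm_num,
                sqrt_sq (by norm_num)]
              nlinarith [mul_self_sqrt h1r.le]
          _ ≤ _ := by
              refine ENNReal.ofReal_le_ofReal ?_
              have : (1 + r) ^ (-σ - A) * (1 + r) ^ (1 / 2 - A) * (1 + r) ≤ 1 := by
                nth_rewrite 3 [← rpow_one (1 + r)]
                rw [← rpow_add h1r, ← rpow_add h1r]
                exact rpow_le_one_of_one_le_of_nonpos (by linarith)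
                  (by linarith [hadm.η_le₁, hadm.η_pos])
              rw [hK]; nlinarith
    _ = _ := (ENNReal.ofReal_mul (radConst_nonneg Θ)).symm

/-! ### High-high interactions -/

lemma Admissible.rpow_mul_rpow_le (hadm : Admissible σ A B Θ η) {H : ℝ} (hR : 1 ≤ R) (hH : 1 ≤ H)
    (hHR : H ≤ 8 * R) : R ^ (3 / 2 - σ - 2 * A) * H ^ (1 / 2 + B - 2 * A) ≤ 8 * R ^ (-η) := by
  have hR0 : 0 < R := one_pos.trans_le hR
  rcases le_total (1 / 2 + B - 2 * A) 0 with h | h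
  · calc _ ≤ R ^ (-η) * 1 := by
          gcongr
          · linarith [hadm.η_le₁]
          · exact rpow_le_one_of_one_le_of_nonpos hH h
      _ ≤ _ := by linarith [rpow_nonneg hR0.le (-η)]
  · calc _ ≤ R ^ (3 / 2 - σ - 2 * A) * (8 * R) ^ (1 / 2 + B - 2 * A) := by gcongr
      _ ≤ R ^ (3 / 2 - σ - 2 * A) * (8 * R ^ (1 / 2 + B - 2 * A)) := by
          rw [mul_rpow (by norm_num) hR0.le]
          gcongr
          exact rpow_le_self_of_one_le (by norm_num) (by linarith [hadm.B_le, hadm.A_nonneg])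
      _ = 8 * R ^ (3 / 2 - σ - 2 * A + (1 / 2 + B - 2 * A)) := by rw [rpow_add hR0]; ring
      _ ≤ 8 * R ^ (-η) := by
          gcongr
          linarith [hadm.η_le₂]

/-- The region where both input frequencies are much larger than the output frequency, which is
comparable to `R`. -/
def highRegion (R : ℝ) : Set (Freq × Freq) :=
  {q | R ≤ 1 + ‖q.1.2 + q.2.2‖ ∧ 1 + ‖q.1.2 + q.2.2‖ < 2 * R ∧
    16 * (1 + ‖q.1.2 + q.2.2‖) < ‖q.1.2‖}

lemma measurableSet_highRegion (R : ℝ) : MeasurableSet (highRegion R) := by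
  unfold highRegion
  measurability

/-- The distance of the output frequency to the cone. -/
def outMod (x y : Freq) : ℝ := jb (|x.1 + y.1| - ‖x.2 + y.2‖)

lemma one_le_outMod (x y : Freq) : 1 ≤ outMod x y := one_le_jb _

lemma measurable_outMod : Measurable fun q : Freq × Freq => outMod q.1 q.2 := by
  unfold outMod; fun_prop

lemma waveKer_le_of_mem_highRegion (hadm : Admissible σ A B Θ η) (hR : 1 ≤ R) {x y : Freq}
    (h : (x, y) ∈ highRegion R) :
    waveKer σ A B Θ e₁ e₂ x y ≤ 2 * R ^ (-σ) * outMod x y ^ B * ‖x.2‖ ^ (-(2 * A)) *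
      (jb (x.1 - e₁ * ‖x.2‖) ^ (-Θ) * jb (y.1 - e₂ * ‖y.2‖) ^ (-Θ)) := by
  obtain ⟨h1, -, h3⟩ := h
  simp only at h1 h3
  have hR0 : 0 < R := one_pos.trans_le hR
  have hx : 0 < ‖x.2‖ := by linarith
  have hA := hadm.A_nonneg
  have hA2 := hadm.A_le
  have hxy : ‖x.2‖ ≤ ‖x.2 + y.2‖ + ‖y.2‖ := by
    have := norm_sub_le (x.2 + y.2) y.2
    rwa [add_sub_cancel_right] at this
  have hout : 0 ≤ outMod x y ^ B := jb_rpow_nonneg _ _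
  unfold waveKer
  refine mul_le_mul_of_nonneg_right ?_ (mul_nonneg (jb_rpow_nonneg _ _) (jb_rpow_nonneg _ _))
  change (1 + ‖x.2 + y.2‖) ^ (-σ) * outMod x y ^ B * _ ≤ _
  calc _ ≤ R ^ (-σ) * outMod x y ^ B * (‖x.2‖ ^ (-A) * (2 * ‖x.2‖ ^ (-A))) := by
        gcongr ?_ * _ * (?_ * ?_)
        · exact rpow_le_rpow_of_nonpos hR0 h1 (by linarith [hadm.one_le_σ])
        · exact rpow_le_rpow_of_nonpos hx (by linarith) (by linarith)
        · exact rpow_neg_le_mul_of_le_mul hA (by linarith) one_le_two hx (by linarith)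
    _ = _ := by
        rw [show -(2 * A) = -A + -A by ring, rpow_add hx]; ring

lemma TriBound.of_or {k k₁ k₂ : Freq → Freq → ℝ≥0∞} {M₁ M₂ : ℝ≥0∞}
    (hm₁ : Measurable (Function.uncurry k₁)) (hm₂ : Measurable (Function.uncurry k₂))
    (h₁ : TriBound k₁ M₁) (h₂ : TriBound k₂ M₂) (h : ∀ x y, k x y ≤ k₁ x y ∨ k x y ≤ k₂ x y) :
    TriBound k (M₁ + M₂) := by
  have := TriBound.of_cover (k := k) (κ := fun b : Bool => cond b k₂ k₁)
    (m := fun b : Bool => cond b M₂ M₁) (by rintro (_ | _) <;> assumption)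
    (by rintro (_ | _) <;> assumption)
    fun x y => (h x y).elim (fun h => ⟨false, h⟩) (fun h => ⟨true, h⟩)
  simpa [tsum_bool, add_comm] using this

/-! #### Large modulation of the output -/

lemma triBound_ball_jb (hΘ : 1 < Θ) (e : ℝ) (hR : 0 ≤ R) {c : ℝ} (hc : 0 ≤ c) :
    TriBound (fun x y => (Metric.closedBall (0 : ℂ) (2 * R)).indicator (fun _ => 1) (x.2 + y.2) *
      ENNReal.ofReal (c * jb (y.1 - e * ‖y.2‖) ^ (-Θ)))
      (ENNReal.ofReal (c * jbMass Θ * (16 * R ^ 2)) ^ (1 / 2 : ℝ)) := by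
  have hm := jbMass_nonneg Θ
  have hind : Measurable ((Metric.closedBall (0 : ℂ) (2 * R)).indicator fun _ => (1 : ℝ≥0∞)) :=
    measurable_const.indicator Metric.isClosed_closedBall.measurableSet
  refine TriBound.of_lintegral_right (by unfold Function.uncurry; fun_prop) fun x => ?_
  rw [Measure.volume_eq_prod, lintegral_prod_symm _ (by fun_prop)]
  have e1 : ∀ ξ : ℂ, ∫⁻ t : ℝ, (Metric.closedBall (0 : ℂ) (2 * R)).indicator (fun _ => 1)
      (x.2 + ξ) * ENNReal.ofReal (c * jb (t - e * ‖ξ‖) ^ (-Θ)) =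
      ENNReal.ofReal (c * jbMass Θ) *
        (Metric.closedBall (0 : ℂ) (2 * R)).indicator (fun _ => 1) (x.2 + ξ) := by
    intro ξ
    rw [lintegral_const_mul _ (by fun_prop), mul_comm]
    congr 1
    simp only [ENNReal.ofReal_mul hc]
    rw [lintegral_const_mul _ (by fun_prop), lintegral_jb_sub_right hΘ]
  simp only [e1]
  rw [lintegral_const_mul _ (by fun_prop), ENNReal.ofReal_mul (p := c * jbMass Θ) (by positivity)]
  refine mul_le_mul_right ?_ _
  rw [lintegral_add_left_eq_self
    ((Metric.closedBall (0 : ℂ) (2 * R)).indicator fun _ => (1 : ℝ≥0∞)) x.2,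
    lintegral_indicator Metric.isClosed_closedBall.measurableSet, setLIntegral_one,
    Complex.volume_closedBall, ← ENNReal.ofReal_pow (by positivity)]
  calc _ ≤ ENNReal.ofReal ((2 * R) ^ 2) * ENNReal.ofReal 4 := by
        gcongr
        rw [← ENNReal.ofReal_coe_nnreal]
        exact ENNReal.ofReal_le_ofReal pi_le_four
    _ = _ := by
        rw [← ENNReal.ofReal_mul (by positivity)]; congr 1; ring

/-- The part of the high-high region where the output modulation is controlled by the sum of the
input modulations. -/
def modRegion (e₁ e₂ R : ℝ) : Set (Freq × Freq) :=
  highRegion R ∩ {q | 8 * R ≤ outMod q.1 q.2 ∧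
    outMod q.1 q.2 ≤ 2 * (jb (q.1.1 - e₁ * ‖q.1.2‖) + jb (q.2.1 - e₂ * ‖q.2.2‖))}

lemma measurableSet_modRegion (e₁ e₂ R : ℝ) : MeasurableSet (modRegion e₁ e₂ R) := by
  have := measurable_outMod
  exact (measurableSet_highRegion R).inter <| (measurableSet_le measurable_const this).inter
    (measurableSet_le this (by fun_prop))

lemma mul_rpow_le_of_outMod_le (hadm : Admissible σ A B Θ η) (hR : 1 ≤ R) {p h a b : ℝ}
    (hp : R ≤ p) (hh : R ≤ h) (hb : 0 ≤ b) (ha : h ≤ 4 * a) :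
    2 * R ^ (-σ) * h ^ B * p ^ (-(2 * A)) * (a ^ (-Θ) * b ^ (-Θ)) ≤
      2 * 4 ^ Θ * R ^ (-(1 / 2) - σ - 2 * A) * b ^ (-Θ) := by
  have hR0 : 0 < R := one_pos.trans_le hR
  have hh0 : 0 < h := hR0.trans_le hh
  have hΘ := hadm.one_lt_Θ
  have h1 : a ^ (-Θ) ≤ 4 ^ Θ * h ^ (-Θ) := by
    calc a ^ (-Θ) ≤ (h / 4) ^ (-Θ) :=
          rpow_le_rpow_of_nonpos (by positivity) (by linarith) (by linarith)
      _ = _ := by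
          rw [div_rpow hh0.le (by norm_num), rpow_neg (by norm_num : (0 : ℝ) ≤ 4), div_inv_eq_mul,
            mul_comm]
  have h2 : h ^ B * h ^ (-Θ) ≤ R ^ (-(1 / 2) : ℝ) := by
    rw [← rpow_add hh0]
    calc _ ≤ h ^ (-(1 / 2) : ℝ) :=
          rpow_le_rpow_of_exponent_le (hR.trans hh) (by linarith [hadm.B_le])
      _ ≤ _ := rpow_le_rpow_of_nonpos hR0 hh (by norm_num)
  have h3 : p ^ (-(2 * A)) ≤ R ^ (-(2 * A)) :=
    rpow_le_rpow_of_nonpos hR0 hp (by linarith [hadm.A_nonneg])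
  have hb' : 0 ≤ b ^ (-Θ) := rpow_nonneg hb _
  have hp' : 0 ≤ p ^ (-(2 * A)) := rpow_nonneg (hR0.le.trans hp) _
  calc _ ≤ 2 * R ^ (-σ) * h ^ B * p ^ (-(2 * A)) * (4 ^ Θ * h ^ (-Θ) * b ^ (-Θ)) := by gcongr
    _ = 2 * R ^ (-σ) * 4 ^ Θ * ((h ^ B * h ^ (-Θ)) * p ^ (-(2 * A))) * b ^ (-Θ) := by ring
    _ ≤ 2 * R ^ (-σ) * 4 ^ Θ * (R ^ (-(1 / 2) : ℝ) * R ^ (-(2 * A))) * b ^ (-Θ) := by gcongr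
    _ = _ := by
        rw [show -(1 / 2) - σ - 2 * A = -σ + (-(1 / 2) + -(2 * A)) by ring, rpow_add hR0,
          rpow_add hR0]
        ring

lemma triBound_cut_modRegion (hadm : Admissible σ A B Θ η) (hR : 1 ≤ R) :
    TriBound (cut (modRegion e₁ e₂ R) (waveKer σ A B Θ e₁ e₂))
      (2 * ENNReal.ofReal (32 * 4 ^ Θ * jbMass Θ * R ^ (-η)) ^ (1 / 2 : ℝ)) := by
  have hR0 : 0 < R := one_pos.trans_le hR
  have hm := jbMass_nonneg Θ
  set c := 2 * 4 ^ Θ * R ^ (-(1 / 2) - σ - 2 * A) with hc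
  have hc0 : 0 ≤ c := by positivity
  have hle : c * jbMass Θ * (16 * R ^ 2) ≤ 32 * 4 ^ Θ * jbMass Θ * R ^ (-η) := by
    calc _ = 32 * 4 ^ Θ * jbMass Θ * (R ^ (-(1 / 2) - σ - 2 * A) * R ^ (2 : ℝ)) := by
          rw [hc, rpow_two]; ring
      _ ≤ _ := by
          rw [← rpow_add hR0]
          gcongr
          linarith [hadm.η_le₁]
  have hle' := ENNReal.rpow_le_rpow (ENNReal.ofReal_le_ofReal hle) (by norm_num : (0 : ℝ) ≤ 1 / 2)
  have hind : Measurable ((Metric.closedBall (0 : ℂ) (2 * R)).indicator fun _ => (1 : ℝ≥0∞)) :=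
    measurable_const.indicator Metric.isClosed_closedBall.measurableSet
  rw [two_mul]
  refine TriBound.of_or (by unfold Function.uncurry; fun_prop)
    (by unfold Function.uncurry; fun_prop)
    ((triBound_ball_jb hadm.one_lt_Θ e₂ hR0.le hc0).mono (fun _ _ => le_rfl) hle')
    (TriBound.symm ((triBound_ball_jb hadm.one_lt_Θ e₁ hR0.le hc0).mono (fun _ _ => le_rfl) hle'))
    fun x y => ?_
  by_cases hxy : (x, y) ∈ modRegion e₁ e₂ R
  swap
  · rw [cut_of_notMem hxy]; exact Or.inl zero_le
  rw [cut_of_mem hxy]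
  obtain ⟨hS, h1, h2⟩ := hxy
  have hk := waveKer_le_of_mem_highRegion hadm hR hS (e₁ := e₁) (e₂ := e₂)
  obtain ⟨h3, h4, h5⟩ := hS
  simp only at h1 h2 h3 h4 h5
  have hball : x.2 + y.2 ∈ Metric.closedBall (0 : ℂ) (2 * R) := by
    rw [mem_closedBall_zero_iff]; linarith
  have hball' : y.2 + x.2 ∈ Metric.closedBall (0 : ℂ) (2 * R) := by rwa [add_comm]
  rw [Set.indicator_of_mem hball, Set.indicator_of_mem hball', one_mul, one_mul]
  have hx := jb_pos (x.1 - e₁ * ‖x.2‖)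
  have hy := jb_pos (y.1 - e₂ * ‖y.2‖)
  rcases le_total (jb (y.1 - e₂ * ‖y.2‖)) (jb (x.1 - e₁ * ‖x.2‖)) with h | h
  · exact Or.inl (ENNReal.ofReal_le_ofReal (hk.trans (mul_rpow_le_of_outMod_le hadm hR
      (by linarith) (by linarith) hy.le (by linarith))))
  · refine Or.inr (ENNReal.ofReal_le_ofReal (hk.trans ?_))
    rw [mul_comm (jb (x.1 - e₁ * ‖x.2‖) ^ (-Θ))]
    exact mul_rpow_le_of_outMod_le hadm hR (by linarith) (by linarith) hx.le (by linarith)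

lemma abs_norm_sub_norm_le_norm_add (ξ υ : ℂ) : |‖ξ‖ - ‖υ‖| ≤ ‖ξ + υ‖ := by
  simpa using abs_norm_sub_norm_le ξ (-υ)

/-- With equal signs, the output modulation is controlled either by the input modulations or by the
input frequencies. -/
lemma outMod_le_of_same_sign {e : ℝ} (he : e = 1 ∨ e = -1) {x y : Freq} (hR : 1 ≤ R)
    (h : (x, y) ∈ highRegion R) (hmod : (x, y) ∉ modRegion e e R) : outMod x y ≤ 8 * ‖x.2‖ := by
  have h' := h
  obtain ⟨h3, h4, h5⟩ := h'
  simp only at h3 h4 h5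
  by_cases h8 : 8 * R ≤ outMod x y
  swap
  · linarith
  have h2 : 2 * (jb (x.1 - e * ‖x.2‖) + jb (y.1 - e * ‖y.2‖)) < outMod x y :=
    lt_of_not_ge fun hn => hmod ⟨h, h8, hn⟩
  have h6 : |(|x.1 + y.1|) - (‖x.2‖ + ‖y.2‖)| ≤ |x.1 - e * ‖x.2‖| + |y.1 - e * ‖y.2‖| := by
    have h0 : |e * (‖x.2‖ + ‖y.2‖)| = ‖x.2‖ + ‖y.2‖ := by
      rw [abs_mul, show |e| = 1 by rcases he with rfl | rfl <;> simp, one_mul]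
      exact abs_of_nonneg (by positivity)
    calc _ ≤ |x.1 + y.1 - e * (‖x.2‖ + ‖y.2‖)| := by
          have := abs_abs_sub_abs_le (x.1 + y.1) (e * (‖x.2‖ + ‖y.2‖))
          rwa [h0] at this
      _ = |x.1 - e * ‖x.2‖ + (y.1 - e * ‖y.2‖)| := by congr 1; ring
      _ ≤ _ := abs_add_le _ _
  have h7 := (abs_le.mp (abs_norm_sub_norm_le_norm_add x.2 y.2)).1
  have h9 := norm_add_le x.2 y.2
  have h10 : |(|x.1 + y.1|) - ‖x.2 + y.2‖| ≤ |(|x.1 + y.1|) - (‖x.2‖ + ‖y.2‖)| +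
      (‖x.2‖ + ‖y.2‖ - ‖x.2 + y.2‖) := by
    refine (abs_sub_le _ (‖x.2‖ + ‖y.2‖) _).trans_eq ?_
    rw [abs_of_nonneg (sub_nonneg.2 h9)]
  unfold outMod jb at *
  linarith

/-- With opposite signs, the output modulation is controlled either by the input modulations or by
the output frequency. -/
lemma outMod_le_of_opposite_sign (he₁ : e₁ = 1 ∨ e₁ = -1) {x y : Freq}
    (h : (x, y) ∈ highRegion R) (hmod : (x, y) ∉ modRegion e₁ (-e₁) R) :
    outMod x y ≤ 8 * R := by
  by_contra! h8
  have h' := h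
  obtain ⟨h3, h4, h5⟩ := h'
  simp only at h3 h4 h5
  have h2 : 2 * (jb (x.1 - e₁ * ‖x.2‖) + jb (y.1 - -e₁ * ‖y.2‖)) < outMod x y :=
    lt_of_not_ge fun hn => hmod ⟨h, h8.le, hn⟩
  have h6 : |x.1 + y.1| ≤ |x.1 - e₁ * ‖x.2‖| + |y.1 - -e₁ * ‖y.2‖| + ‖x.2 + y.2‖ := by
    calc _ = |x.1 - e₁ * ‖x.2‖ + (y.1 - -e₁ * ‖y.2‖) + e₁ * (‖x.2‖ - ‖y.2‖)| := by
          congr 1; ring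
      _ ≤ _ := abs_add_three _ _ _
      _ ≤ _ := by
          rw [abs_mul, show |e₁| = 1 by rcases he₁ with rfl | rfl <;> simp, one_mul]
          gcongr
          exact abs_norm_sub_norm_le_norm_add _ _
  have h0 := abs_nonneg (x.1 + y.1)
  unfold outMod jb at *
  rcases abs_cases (|x.1 + y.1| - ‖x.2 + y.2‖) with h7 | h7 <;> linarith

/-! #### Equal signs -/

lemma half_mul_le_of_sq_eq {a b b' X Y : ℝ} (hX : 0 ≤ X) (hXb : X ^ 2 = a ^ 2 + b ^ 2)
    (hYb : Y ^ 2 = a ^ 2 + b' ^ 2) (hab' : |a| ≤ b') (hbb' : b' ≤ b) :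
    1 / 2 * (b - b') ≤ X - Y := by
  have hb' : 0 ≤ b' := (abs_nonneg a).trans hab'
  have ha : a ^ 2 ≤ b' ^ 2 := sq_le_sq' (by linarith [neg_abs_le a]) ((le_abs_self a).trans hab')
  have h1 : X ≤ 2 * b := abs_le_of_sq_le_sq' (by nlinarith) (by linarith) |>.2
  have h2 : Y ≤ 2 * b' := abs_le_of_sq_le_sq' (by nlinarith) (by linarith) |>.2
  have h3 : Y ≤ X := abs_le_of_sq_le_sq' (by nlinarith) hX |>.2
  rcases eq_or_lt_of_le (by linarith : 0 ≤ b + b') with h | h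
  · linarith
  · refine le_of_mul_le_mul_right ?_ h
    nlinarith

lemma le_of_sq_eq_add_sq {a b b' X Y : ℝ} (hX : 0 ≤ X) (hXb : X ^ 2 = a ^ 2 + b ^ 2)
    (hYb : Y ^ 2 = a ^ 2 + b' ^ 2) (hb' : 0 ≤ b') (hbb' : b' ≤ b) : Y ≤ X :=
  abs_le_of_sq_le_sq' (by nlinarith) hX |>.2

lemma half_mul_abs_sub_le_norm_add_norm {ε a b b' : ℝ} {v : ℂ} (hε : ε = 1 ∨ ε = -1)
    (h1 : |a| ≤ ε * b) (h2 : |v.im| ≤ ε * b) (h1' : |a| ≤ ε * b') (h2' : |v.im| ≤ ε * b') :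
    1 / 2 * |b - b'| ≤ |‖(⟨a, b⟩ : ℂ)‖ + ‖v - ⟨a, b⟩‖ - (‖(⟨a, b'⟩ : ℂ)‖ + ‖v - ⟨a, b'⟩‖)| := by
  have hε2 : ε * ε = 1 := by rcases hε with rfl | rfl <;> norm_num
  have hεa : |ε| = 1 := by rcases hε with rfl | rfl <;> norm_num
  have key : ∀ c c' : ℝ, |a| ≤ ε * c' → |v.im| ≤ ε * c' → ε * c' ≤ ε * c →
      1 / 2 * (ε * c - ε * c') ≤
        ‖(⟨a, c⟩ : ℂ)‖ + ‖v - ⟨a, c⟩‖ - (‖(⟨a, c'⟩ : ℂ)‖ + ‖v - ⟨a, c'⟩‖) := by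
    intro c c' hc1 hc2 hcc
    have e1 : ∀ t : ℝ, ‖(⟨a, t⟩ : ℂ)‖ ^ 2 = a ^ 2 + (ε * t) ^ 2 := fun t => by
      rw [Complex.sq_norm, Complex.normSq_mk]; linear_combination (-t ^ 2) * hε2
    have e2 : ∀ t : ℝ, ‖v - (⟨a, t⟩ : ℂ)‖ ^ 2 = (v.re - a) ^ 2 + (ε * t - ε * v.im) ^ 2 :=
      fun t => by
        rw [Complex.sq_norm, Complex.normSq_apply]
        simp only [Complex.sub_re, Complex.sub_im]
        linear_combination (-(t - v.im) ^ 2) * hε2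
    have hv : ε * v.im ≤ |v.im| := by
      calc ε * v.im ≤ |ε * v.im| := le_abs_self _
        _ = |v.im| := by rw [abs_mul, hεa, one_mul]
    have h3 := half_mul_le_of_sq_eq (norm_nonneg _) (e1 c) (e1 c') hc1 hcc
    have h4 := le_of_sq_eq_add_sq (norm_nonneg _) (e2 c) (e2 c') (by linarith) (by linarith)
    linarith
  have habs : |b - b'| = |ε * b - ε * b'| := by rw [← mul_sub, abs_mul, hεa, one_mul]
  rw [habs]
  rcases le_total (ε * b') (ε * b) with h | h
  · rw [abs_of_nonneg (sub_nonneg.2 h)]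
    exact (key b b' h1' h2' h).trans (le_abs_self _)
  · rw [abs_sub_comm, abs_of_nonneg (sub_nonneg.2 h), abs_sub_comm (_ + _)]
    exact (key b' b h1 h2 h).trans (le_abs_self _)

/-- The part of a vertical strip which is far from the horizontal axis. -/
def strip (R c d : ℝ) : Set ℂ := {ξ | |ξ.re - c| ≤ R ∧ |ξ.re| ≤ |ξ.im| ∧ d ≤ |ξ.im|}

lemma measurableSet_strip (R c d : ℝ) : MeasurableSet (strip R c d) := by
  unfold strip
  measurability

lemma setLIntegral_strip_jb (hΘ : 1 < Θ) (R c T : ℝ) (v : ℂ) :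
    ∫⁻ ξ in strip R c |v.im|, ENNReal.ofReal (jb (T - (‖ξ‖ + ‖v - ξ‖)) ^ (-Θ)) ≤
      ENNReal.ofReal (4 ^ (Θ + 1) * jbMass Θ * R) := by
  have hm := jbMass_nonneg Θ
  set f : ℝ → ℝ → ℝ := fun a b => ‖(⟨a, b⟩ : ℂ)‖ + ‖v - ⟨a, b⟩‖ with hf
  set s : ℝ → ℝ → Set ℝ := fun ε a => {b | |a| ≤ ε * b ∧ |v.im| ≤ ε * b} with hs
  have hsm : ∀ ε a, MeasurableSet (s ε a) := fun ε a => by rw [hs]; measurability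
  have hhalf : ∀ ε a, ε = 1 ∨ ε = -1 →
      ∫⁻ b in s ε a, ENNReal.ofReal (jb (T - f a b) ^ (-Θ)) ≤
        ENNReal.ofReal (4 ^ Θ * jbMass Θ) := by
    intro ε a hε
    refine (setLIntegral_jb_of_expanding hΘ (κ := 1 / 2) (by norm_num) (by norm_num) (hsm ε a)
      (fun b hb b' hb' => half_mul_abs_sub_le_norm_add_norm hε hb.1 hb.2 hb'.1 hb'.2) T).trans_eq ?_
    norm_num
  have hmeas : Measurable ((strip R c |v.im|).indicator fun ξ =>
      ENNReal.ofReal (jb (T - (‖ξ‖ + ‖v - ξ‖)) ^ (-Θ))) :=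
    Measurable.indicator (by fun_prop) (measurableSet_strip _ _ _)
  have hmp := Complex.volume_preserving_equiv_real_prod.symm
    Complex.measurableEquivRealProd
  rw [← lintegral_indicator (measurableSet_strip _ _ _),
    ← hmp.lintegral_comp_emb Complex.measurableEquivRealProd.symm.measurableEmbedding,
    Measure.volume_eq_prod, lintegral_prod]
  swap
  · exact (hmeas.comp Complex.measurableEquivRealProd.symm.measurable).aemeasurable
  calc _ ≤ ∫⁻ a in Set.Icc (c - R) (c + R), 2 * ENNReal.ofReal (4 ^ Θ * jbMass Θ) := by
        rw [← lintegral_indicator measurableSet_Icc]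
        refine lintegral_mono fun a => ?_
        by_cases ha : a ∈ Set.Icc (c - R) (c + R)
        swap
        · rw [Set.indicator_of_notMem ha]
          refine (lintegral_eq_zero_of_ae_eq_zero (.of_forall fun b => ?_)).le
          refine Set.indicator_of_notMem (fun h => ha ?_) _
          have := abs_le.mp h.1
          change _ ≤ a - c ∧ a - c ≤ _ at this
          exact ⟨by linarith, by linarith⟩
        rw [Set.indicator_of_mem ha, two_mul]
        calc _ ≤ ∫⁻ b in s 1 a ∪ s (-1) a, ENNReal.ofReal (jb (T - f a b) ^ (-Θ)) := by
              rw [← lintegral_indicator ((hsm _ _).union (hsm _ _))]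
              refine lintegral_mono fun b => ?_
              by_cases hb : (⟨a, b⟩ : ℂ) ∈ strip R c |v.im|
              · have hb' : b ∈ s 1 a ∪ s (-1) a := by
                  rcases le_total 0 b with h0 | h0
                  · exact Or.inl (by simpa [hs, abs_of_nonneg h0] using hb.2)
                  · exact Or.inr (by simpa [hs, abs_of_nonpos h0] using hb.2)
                rw [Set.indicator_of_mem hb']
                exact (Set.indicator_of_mem hb _).le
              · exact (Set.indicator_of_notMem hb _).le.trans zero_le
          _ ≤ _ := (lintegral_union_le _ _ _).trans (add_le_add (hhalf 1 a (by simp))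
              (hhalf (-1) a (by simp)))
    _ = _ := by
        rw [setLIntegral_const, volume_Icc, ← ENNReal.ofReal_ofNat, ← ENNReal.ofReal_mul (by simp),
          ← ENNReal.ofReal_mul (by positivity), rpow_add (by norm_num), rpow_one]
        congr 1; ring

/-- The reflection exchanging the real and imaginary axes. -/
def reimSwap : ℂ ≃ₗᵢ[ℝ] ℂ :=
  Complex.conjLIE.trans (rotation ⟨Complex.I, by simp [Submonoid.unitSphere]⟩)

lemma reimSwap_apply (ξ : ℂ) : reimSwap ξ = ⟨ξ.im, ξ.re⟩ := by
  change Complex.I * (starRingEnd ℂ) ξ = _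
  apply Complex.ext <;> simp

/-- The part of the high-high region where the first input frequency is closer to the vertical axis
than to the horizontal one, after the isometry `φ`. -/
def verticalRegion (φ : ℂ ≃ₗᵢ[ℝ] ℂ) (R : ℝ) : Set (Freq × Freq) :=
  highRegion R ∩ {q | |(φ q.1.2).re| ≤ |(φ q.1.2).im|}

lemma measurableSet_verticalRegion (φ : ℂ ≃ₗᵢ[ℝ] ℂ) (R : ℝ) :
    MeasurableSet (verticalRegion φ R) := by
  have := φ.continuous.measurable
  exact (measurableSet_highRegion R).inter (measurableSet_le (by fun_prop) (by fun_prop))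

lemma triBound_cut_verticalRegion (hΘ : 1 < Θ) {e : ℝ} (he : e = 1 ∨ e = -1) (hR : 1 ≤ R)
    {c : ℝ} (hc : 0 ≤ c) (φ : ℂ ≃ₗᵢ[ℝ] ℂ) :
    TriBound (cut (verticalRegion φ R)
      fun x y => c * (jb (x.1 - e * ‖x.2‖) ^ (-Θ) * jb (y.1 - e * ‖y.2‖) ^ (-Θ)))
      (2 * ENNReal.ofReal (c * (2 ^ Θ * (2 * jbMass Θ)) * (4 ^ (Θ + 1) * jbMass Θ * (2 * R))) ^
        (1 / 2 : ℝ)) := by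
  have hφ := φ.continuous.measurable
  have hm := jbMass_nonneg Θ
  refine TriBound.of_localized (R := 2 * R) (ρ₁ := fun x => (φ x.2).re)
    (ρ₂ := fun y => -(φ y.2).re)
    (measurable_cut (measurableSet_verticalRegion φ R) (by fun_prop)) (by fun_prop) (by fun_prop)
    (by linarith) (fun x y hk => ?_) ?_
  · have hxy : (x, y) ∈ verticalRegion φ R := by
      by_contra h
      exact hk (cut_of_notMem h)
    have h4 := hxy.1.2.1
    simp only at h4
    have := Complex.abs_re_le_norm (φ (x.2 + y.2))
    rw [LinearIsometryEquiv.norm_map, map_add, Complex.add_re] at this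
    rw [sub_neg_eq_add]
    linarith
  rintro ⟨τ, v⟩ d
  set g : ℂ → ℝ≥0∞ := fun ξ => ENNReal.ofReal c * (strip (2 * R) d |(φ v).im|).indicator 1 (φ ξ)
    with hg
  have hstrip : Measurable ((strip (2 * R) d |(φ v).im|).indicator (1 : ℂ → ℝ≥0∞)) :=
    measurable_one.indicator (measurableSet_strip _ _ _)
  have hgm : Measurable g := by fun_prop
  calc _ ≤ ∫⁻ x : Freq, g x.2 * ENNReal.ofReal
        (jb (x.1 - e * ‖x.2‖) ^ (-Θ) * jb (τ - x.1 - e * ‖v - x.2‖) ^ (-Θ)) := by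
        refine (setLIntegral_mono' (measurableSet_le (by fun_prop) measurable_const)
          fun x hx => cut_le fun hxy => ?_).trans (setLIntegral_le_lintegral _ _)
        obtain ⟨⟨-, h4, h5⟩, h6⟩ := hxy
        simp only [Prod.snd_sub, add_sub_cancel, Set.mem_ofPred_eq] at h4 h5 h6 hx
        have h7 := Complex.norm_le_abs_re_add_abs_im (φ x.2)
        have h8 := Complex.abs_im_le_norm (φ v)
        rw [LinearIsometryEquiv.norm_map] at h7 h8
        have h9 := norm_nonneg v
        have hmem : φ x.2 ∈ strip (2 * R) d |(φ v).im| := ⟨hx, h6, by linarith⟩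
        rw [hg]
        simp only [Set.indicator_of_mem hmem, Pi.one_apply, mul_one]
        rw [← ENNReal.ofReal_mul hc, Prod.fst_sub, Prod.snd_sub]
    _ ≤ _ := lintegral_freq_jb hΘ hgm (α := fun ξ => e * ‖ξ‖) (β := fun ξ => e * ‖v - ξ‖)
        (by fun_prop) (by fun_prop) τ
    _ = ENNReal.ofReal (2 ^ Θ * (2 * jbMass Θ)) * (ENNReal.ofReal c *
        ∫⁻ ξ in strip (2 * R) d |(φ v).im|,
          ENNReal.ofReal (jb (e * τ - (‖ξ‖ + ‖φ v - ξ‖)) ^ (-Θ))) := by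
        congr 1
        symm
        rw [← lintegral_const_mul _ (by fun_prop),
          ← lintegral_indicator (measurableSet_strip _ _ _),
          ← φ.measurePreserving.lintegral_comp_emb φ.toHomeomorph.measurableEmbedding]
        refine lintegral_congr fun ξ => ?_
        have hj : jb (e * τ - (‖φ ξ‖ + ‖φ v - φ ξ‖)) = jb (τ - e * ‖ξ‖ - e * ‖v - ξ‖) := by
          rw [jb_sign_mul_sub he, ← map_sub, LinearIsometryEquiv.norm_map,
            LinearIsometryEquiv.norm_map]
          congr 1; ring
        by_cases h : φ ξ ∈ strip (2 * R) d |(φ v).im|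
        · simp only [hg, Set.indicator_of_mem h, hj, Pi.one_apply, mul_one]
        · simp [hg, h]
    _ ≤ ENNReal.ofReal (2 ^ Θ * (2 * jbMass Θ)) * (ENNReal.ofReal c *
        ENNReal.ofReal (4 ^ (Θ + 1) * jbMass Θ * (2 * R))) := by
        gcongr
        exact setLIntegral_strip_jb hΘ _ _ _ _
    _ = _ := by
        rw [← ENNReal.ofReal_mul hc, ← ENNReal.ofReal_mul (by positivity)]
        congr 1; ring

/-- The constant in the estimate of the interaction of high frequencies with equal signs. -/
def sameConst (Θ : ℝ) : ℝ := 16 * (2 ^ Θ * (2 * jbMass Θ)) * (4 ^ (Θ + 1) * jbMass Θ * 2)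

lemma triBound_same_sign (hadm : Admissible σ A B Θ η) {e : ℝ} (he : e = 1 ∨ e = -1) (hR : 1 ≤ R) :
    TriBound (cut (highRegion R \ modRegion e e R) (waveKer σ A B Θ e e))
      (4 * ENNReal.ofReal (sameConst Θ * R ^ (-η)) ^ (1 / 2 : ℝ)) := by
  have hR0 : 0 < R := one_pos.trans_le hR
  have hm := jbMass_nonneg Θ
  set c := 16 * R ^ (-σ + (B - 2 * A)) with hc
  have hc0 : 0 ≤ c := by positivity
  have hcR : c * (2 ^ Θ * (2 * jbMass Θ)) * (4 ^ (Θ + 1) * jbMass Θ * (2 * R)) ≤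
      sameConst Θ * R ^ (-η) := by
    calc _ = sameConst Θ * (R ^ (-σ + (B - 2 * A)) * R ^ (1 : ℝ)) := by
          rw [hc, rpow_one, sameConst]; ring
      _ ≤ _ := by
          rw [← rpow_add hR0]
          have : 0 ≤ sameConst Θ := by unfold sameConst; positivity
          gcongr
          linarith [hadm.η_le₃]
  have hcR' := ENNReal.rpow_le_rpow (ENNReal.ofReal_le_ofReal hcR) (by norm_num : (0 : ℝ) ≤ 1 / 2)
  have hreg := fun φ => (triBound_cut_verticalRegion hadm.one_lt_Θ he hR hc0 φ).mono
    (fun _ _ => le_rfl) (mul_le_mul_right hcR' 2)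
  have hmeas := fun φ => measurable_cut (measurableSet_verticalRegion φ R)
    (k := fun x y => c * (jb (x.1 - e * ‖x.2‖) ^ (-Θ) * jb (y.1 - e * ‖y.2‖) ^ (-Θ)))
    (by fun_prop)
  have hker : ∀ x y : Freq, (x, y) ∈ highRegion R \ modRegion e e R →
      waveKer σ A B Θ e e x y ≤
        c * (jb (x.1 - e * ‖x.2‖) ^ (-Θ) * jb (y.1 - e * ‖y.2‖) ^ (-Θ)) := by
    intro x y hxy
    refine (waveKer_le_of_mem_highRegion hadm hR hxy.1).trans ?_
    refine mul_le_mul_of_nonneg_right ?_ (mul_nonneg (jb_rpow_nonneg _ _) (jb_rpow_nonneg _ _))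
    have h1 := outMod_le_of_same_sign he hR hxy.1 hxy.2
    have h0 := one_le_outMod x y
    have hp : R ≤ ‖x.2‖ := by
      have h3 := hxy.1.1
      have h5 := hxy.1.2.2
      simp only at h3 h5
      linarith
    have hp0 : 0 < ‖x.2‖ := hR0.trans_le hp
    have hB := hadm.B_nonneg
    calc _ ≤ 2 * R ^ (-σ) * (8 * ‖x.2‖) ^ B * ‖x.2‖ ^ (-(2 * A)) := by gcongr
      _ ≤ 2 * R ^ (-σ) * (8 * ‖x.2‖ ^ B) * ‖x.2‖ ^ (-(2 * A)) := by
          rw [mul_rpow (by norm_num) hp0.le]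
          gcongr
          exact rpow_le_self_of_one_le (by norm_num) (by linarith [hadm.B_le])
      _ = 16 * R ^ (-σ) * ‖x.2‖ ^ (B - 2 * A) := by
          rw [sub_eq_add_neg, rpow_add hp0]; ring
      _ ≤ 16 * R ^ (-σ) * R ^ (B - 2 * A) := by
          exact mul_le_mul_of_nonneg_left
            (rpow_le_rpow_of_nonpos hR0 hp (by linarith [hadm.B_le_A])) (by positivity)
      _ = c := by rw [hc, rpow_add hR0]; ring
  have h4 : (4 : ℝ≥0∞) = 2 + 2 := by norm_num
  rw [h4, add_mul]
  refine TriBound.of_or (hmeas (.refl ℝ ℂ)) (hmeas reimSwap) (hreg _) (hreg _) fun x y => ?_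
  by_cases hxy : (x, y) ∈ highRegion R \ modRegion e e R
  swap
  · rw [cut_of_notMem hxy]; exact Or.inl zero_le
  rw [cut_of_mem hxy]
  rcases le_total |x.2.re| |x.2.im| with h | h
  · refine Or.inl ?_
    rw [cut_of_mem (S := verticalRegion _ R) ⟨hxy.1, by simpa using h⟩]
    exact ENNReal.ofReal_le_ofReal (hker x y hxy)
  · refine Or.inr ?_
    rw [cut_of_mem (S := verticalRegion _ R) ⟨hxy.1, by simpa [reimSwap_apply] using h⟩]
    exact ENNReal.ofReal_le_ofReal (hker x y hxy)

/-! #### Opposite signs, input frequencies not too large -/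

/-- The part of the high-high region where the input frequencies are controlled by the output. -/
def nearRegion (R : ℝ) : Set (Freq × Freq) :=
  highRegion R ∩ {q | outMod q.1 q.2 ≤ 8 * R ∧ ‖q.1.2‖ ≤ outMod q.1 q.2 * R}

/-- The part of the high-high region where the input frequencies dominate. -/
def farRegion (R : ℝ) : Set (Freq × Freq) :=
  highRegion R ∩ {q | outMod q.1 q.2 ≤ 8 * R ∧ outMod q.1 q.2 * R < ‖q.1.2‖}

lemma measurableSet_nearRegion (R : ℝ) : MeasurableSet (nearRegion R) := by
  have := measurable_outMod
  exact (measurableSet_highRegion R).inter <| (measurableSet_le this measurable_const).inter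
    (measurableSet_le (by fun_prop : Measurable fun q : Freq × Freq => ‖q.1.2‖)
      (this.mul_const R))

lemma measurableSet_farRegion (R : ℝ) : MeasurableSet (farRegion R) := by
  have := measurable_outMod
  exact (measurableSet_highRegion R).inter <| (measurableSet_le this measurable_const).inter
    (measurableSet_lt (this.mul_const R)
      (by fun_prop : Measurable fun q : Freq × Freq => ‖q.1.2‖))

lemma jb_abs_sub_le {e τ r : ℝ} (he : e = 1 ∨ e = -1) (hr : 0 ≤ r) :
    jb (|τ| - r) ≤ jb (τ - e * r) := by
  refine jb_le_jb ?_
  have h0 : |e * r| = r := by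
    rw [abs_mul, show |e| = 1 by rcases he with rfl | rfl <;> simp, one_mul, abs_of_nonneg hr]
  have := abs_abs_sub_abs_le τ (e * r)
  rwa [h0] at this

lemma setLIntegral_cut_nearRegion (hadm : Admissible σ A B Θ η) {e : ℝ} (he : e = 1 ∨ e = -1)
    (hR : 1 ≤ R) (z : Freq) (c : ℝ) :
    ∫⁻ x in {x : Freq | |‖x.2‖ - c| ≤ 2 * R},
      cut (nearRegion R) (waveKer σ A B Θ e (-e)) x (z - x) ≤
        ENNReal.ofReal (radConst Θ * (128 * R ^ (-η))) := by
  obtain ⟨τ, v⟩ := z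
  have hR0 : 0 < R := one_pos.trans_le hR
  have hrad := radConst_nonneg Θ
  set r := ‖v‖ with hrdef
  have hr0 : 0 ≤ r := norm_nonneg v
  set h := jb (|τ| - r) with hh
  have hh1 : 1 ≤ h := one_le_jb _
  have hh0 : 0 < h := jb_pos _
  by_cases hcase : R ≤ 1 + r ∧ h ≤ 8 * R
  swap
  · refine (lintegral_eq_zero_of_ae_eq_zero (.of_forall fun x => ?_)).trans_le zero_le
    refine cut_of_notMem fun hx => hcase ?_
    obtain ⟨⟨h1, -, -⟩, h2, -⟩ := hx
    simp only [outMod, Prod.fst_sub, Prod.snd_sub, add_sub_cancel] at h1 h2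
    exact ⟨h1, h2⟩
  obtain ⟨hRr, hhR⟩ := hcase
  have hA := hadm.A_nonneg
  have hA2 := hadm.A_le
  set P : Set ℝ := {p | |p - c| ≤ 2 * R} ∩ Set.Ioc r (h * R) with hP
  have hPm : MeasurableSet P := by
    rw [hP]; measurability
  set g : ℝ → ℝ≥0∞ := P.indicator fun p =>
    ENNReal.ofReal (2 * R ^ (-σ) * h ^ B * p ^ (-(2 * A))) with hg
  have hgm : Measurable g := Measurable.indicator (by fun_prop) hPm
  calc _ ≤ ∫⁻ x : Freq, g ‖x.2‖ * ENNReal.ofReal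
        (jb (x.1 - e * ‖x.2‖) ^ (-Θ) * jb (τ - x.1 - -e * ‖v - x.2‖) ^ (-Θ)) := by
        refine (setLIntegral_mono' (measurableSet_le (by fun_prop) measurable_const)
          fun x hx => cut_le fun hxy => ?_).trans (setLIntegral_le_lintegral _ _)
        have hker := waveKer_le_of_mem_highRegion hadm hR hxy.1 (e₁ := e) (e₂ := -e)
        obtain ⟨⟨-, -, h3⟩, -, h4⟩ := hxy
        simp only [outMod, Prod.fst_sub, Prod.snd_sub, add_sub_cancel] at h3 h4 hker
        have hmem : ‖x.2‖ ∈ P := ⟨hx, by linarith, h4⟩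
        rw [hg, Set.indicator_of_mem hmem, ← ENNReal.ofReal_mul (by positivity)]
        exact ENNReal.ofReal_le_ofReal hker
    _ ≤ _ := lintegral_freq_radial hadm.one_lt_Θ (by rcases he with rfl | rfl <;> simp) hgm τ v
    _ ≤ ENNReal.ofReal (radConst Θ) * ∫⁻ p in Set.Icc (c - 2 * R) (c + 2 * R),
          ENNReal.ofReal (4 * R ^ (1 / 2 - σ - 2 * A) * h ^ (1 / 2 + B - 2 * A)) := by
        refine mul_le_mul_right ?_ _
        rw [← lintegral_indicator measurableSet_Icc]
        refine (setLIntegral_mono' measurableSet_Ioi fun p hp => ?_).trans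
          (setLIntegral_le_lintegral _ _)
        by_cases hpP : p ∈ P
        swap
        · rw [hg, Set.indicator_of_notMem hpP]; simp
        obtain ⟨hpc, hrp, hphR⟩ := hpP
        have hp : 0 < p := hp
        have hpc' := abs_le.mp (show |p - c| ≤ 2 * R from hpc)
        rw [hg, Set.indicator_of_mem (show p ∈ P from ⟨hpc, hrp, hphR⟩),
          Set.indicator_of_mem (show p ∈ Set.Icc (c - 2 * R) (c + 2 * R) from
            ⟨by linarith, by linarith⟩), ← ENNReal.ofReal_mul (by positivity),
          ← ENNReal.ofReal_mul (by positivity)]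
        refine ENNReal.ofReal_le_ofReal ?_
        have h1 : jb (τ - (e * p + -e * |p - r|)) ^ (-(1 / 2) : ℝ) ≤ h ^ (-(1 / 2) : ℝ) := by
          refine rpow_le_rpow_of_nonpos hh0 ?_ (by norm_num)
          rw [abs_of_nonneg (by linarith), show e * p + -e * (p - r) = e * r by ring]
          exact jb_abs_sub_le he hr0
        have h2 : jb (τ - (e * p + -e * (p + r))) ^ (-(1 / 2) : ℝ) ≤ h ^ (-(1 / 2) : ℝ) := by
          refine rpow_le_rpow_of_nonpos hh0 ?_ (by norm_num)
          rw [show e * p + -e * (p + r) = (-e) * r by ring]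
          exact jb_abs_sub_le (by rcases he with rfl | rfl <;> simp) hr0
        have h3 : (1 + min p r) ^ (-(1 / 2) : ℝ) ≤ R ^ (-(1 / 2) : ℝ) := by
          rw [min_eq_right hrp.le]
          exact rpow_le_rpow_of_nonpos hR0 hRr (by norm_num)
        have h4 : p * p ^ (-(2 * A)) ≤ h ^ (1 - 2 * A) * R ^ (1 - 2 * A) := by
          rw [← mul_rpow hh0.le hR0.le]
          nth_rewrite 1 [← rpow_one p]
          rw [← rpow_add hp]
          exact rpow_le_rpow hp.le hphR (by linarith)
        have h5 : 0 ≤ (1 + min p r) ^ (-(1 / 2) : ℝ) := by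
          rw [min_eq_right hrp.le]; positivity
        have h6 := jb_rpow_nonneg (τ - (e * p + -e * |p - r|)) (-(1 / 2))
        have h7 := jb_rpow_nonneg (τ - (e * p + -e * (p + r))) (-(1 / 2))
        calc _ = 2 * R ^ (-σ) * h ^ B * (p * p ^ (-(2 * A))) * ((1 + min p r) ^ (-(1 / 2) : ℝ) *
              (jb (τ - (e * p + -e * |p - r|)) ^ (-(1 / 2) : ℝ) +
                jb (τ - (e * p + -e * (p + r))) ^ (-(1 / 2) : ℝ))) := by ring
          _ ≤ 2 * R ^ (-σ) * h ^ B * (h ^ (1 - 2 * A) * R ^ (1 - 2 * A)) * (R ^ (-(1 / 2) : ℝ) *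
              (h ^ (-(1 / 2) : ℝ) + h ^ (-(1 / 2) : ℝ))) := by gcongr
          _ = 4 * (R ^ (-σ) * R ^ (1 - 2 * A) * R ^ (-(1 / 2) : ℝ)) *
              (h ^ B * h ^ (1 - 2 * A) * h ^ (-(1 / 2) : ℝ)) := by ring
          _ = _ := by
              rw [← rpow_add hR0, ← rpow_add hR0, ← rpow_add hh0, ← rpow_add hh0]
              ring_nf
    _ ≤ _ := by
        rw [setLIntegral_const, volume_Icc, ← ENNReal.ofReal_mul (by positivity),
          ← ENNReal.ofReal_mul hrad]
        refine ENNReal.ofReal_le_ofReal (mul_le_mul_of_nonneg_left ?_ hrad)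
        calc _ = 16 * (R ^ (1 : ℝ) * R ^ (1 / 2 - σ - 2 * A) * h ^ (1 / 2 + B - 2 * A)) := by
              rw [rpow_one]; ring
          _ = 16 * (R ^ (3 / 2 - σ - 2 * A) * h ^ (1 / 2 + B - 2 * A)) := by
              rw [← rpow_add hR0]; ring_nf
          _ ≤ 16 * (8 * R ^ (-η)) :=
              mul_le_mul_of_nonneg_left (hadm.rpow_mul_rpow_le hR hh1 hhR) (by norm_num)
          _ = _ := by ring

lemma triBound_cut_nearRegion (hadm : Admissible σ A B Θ η) {e : ℝ} (he : e = 1 ∨ e = -1)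
    (hR : 1 ≤ R) :
    TriBound (cut (nearRegion R) (waveKer σ A B Θ e (-e)))
      (2 * ENNReal.ofReal (radConst Θ * (128 * R ^ (-η))) ^ (1 / 2 : ℝ)) := by
  refine TriBound.of_localized (R := 2 * R) (ρ₁ := fun x => ‖x.2‖) (ρ₂ := fun y => ‖y.2‖)
    (measurable_cut (measurableSet_nearRegion R) (measurable_waveKer ..)) (by fun_prop)
    (by fun_prop) (by linarith) (fun x y hk => ?_) (setLIntegral_cut_nearRegion hadm he hR)
  have hxy : (x, y) ∈ nearRegion R := by
    by_contra h
    exact hk (cut_of_notMem h)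
  have h4 := hxy.1.2.1
  simp only at h4
  have := abs_norm_sub_norm_le_norm_add x.2 y.2
  linarith

/-! #### Opposite signs, large input frequencies -/

lemma volume_abs_sub_le_le (ρ H : ℝ) :
    volume {τ : ℝ | |(|τ| - ρ)| ≤ H} ≤ ENNReal.ofReal (4 * H) := by
  rcases lt_or_ge H 0 with hH | hH
  · have : {τ : ℝ | |(|τ| - ρ)| ≤ H} = ∅ :=
      Set.eq_empty_of_forall_notMem fun τ hτ => hH.not_ge ((abs_nonneg _).trans hτ)
    simp [this]
  have hsub : {τ : ℝ | |(|τ| - ρ)| ≤ H} ⊆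
      Set.Icc (ρ - H) (ρ + H) ∪ Set.Icc (-ρ - H) (-ρ + H) := by
    intro τ hτ
    obtain ⟨h1, h2⟩ := abs_le.mp (show |(|τ| - ρ)| ≤ H from hτ)
    rcases abs_cases τ with ⟨h3, -⟩ | ⟨h3, -⟩
    · exact Or.inl ⟨by linarith, by linarith⟩
    · exact Or.inr ⟨by linarith, by linarith⟩
  refine (measure_mono hsub).trans ((measure_union_le _ _).trans_eq ?_)
  rw [volume_Icc, volume_Icc, ← ENNReal.ofReal_add (by linarith) (by linarith)]
  congr 1; ring

lemma setLIntegral_jb_sign {e : ℝ} (he : e = 1 ∨ e = -1) {H : ℝ} (hH : 0 < H) (ρ t m : ℝ) :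
    ∫⁻ τ in {τ : ℝ | |(|τ| - ρ)| ≤ H}, ENNReal.ofReal (jb (e * (τ - t) - m) ^ (-(1 / 2) : ℝ)) ≤
      ENNReal.ofReal (10 * √H) := by
  simp only [jb_sign_mul_sub he, sub_sub]
  refine (setLIntegral_jb_rpow_neg_half (by positivity) (volume_abs_sub_le_le ρ H) _).trans_eq ?_
  rw [sqrt_mul (by norm_num), show (4 : ℝ) = 2 ^ 2 by norm_num, sqrt_sq (by norm_num)]
  congr 1; ring

lemma lintegral_far_jb (hΘ : 1 < Θ) {e : ℝ} (he : e = 1 ∨ e = -1) (hR : 1 ≤ R) {H : ℝ}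
    (hH : 0 < H) (t : ℝ) {v : ℂ} (hv : 2 * R ≤ ‖v‖) :
    ∫⁻ z : Freq, {q : ℝ × ℝ | 1 + q.2 ≤ 2 * R ∧ |(|q.1| - q.2)| ≤ H}.indicator
        (1 : ℝ × ℝ → ℝ≥0∞) (z.1, ‖z.2‖) *
        ENNReal.ofReal (jb (z.1 - t - e * ‖v - z.2‖) ^ (-Θ)) ≤
      ENNReal.ofReal (160 * angConst Θ * R ^ (3 / 2 : ℝ) * √H) := by
  have hR0 : 0 < R := one_pos.trans_le hR
  have hang := angConst_nonneg Θ
  set S : Set (ℝ × ℝ) := {q | 1 + q.2 ≤ 2 * R ∧ |(|q.1| - q.2)| ≤ H} with hS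
  have hSm : MeasurableSet S := by rw [hS]; measurability
  have hSi : Measurable (S.indicator (1 : ℝ × ℝ → ℝ≥0∞)) := measurable_one.indicator hSm
  set J : ℝ → ℝ → ℝ := fun τ ρ => jb (e * (τ - t) - (‖v‖ - ρ)) ^ (-(1 / 2) : ℝ) +
    jb (e * (τ - t) - (ρ + ‖v‖)) ^ (-(1 / 2) : ℝ) with hJ
  rw [Measure.volume_eq_prod, lintegral_prod _ (by fun_prop)]
  calc _ ≤ ∫⁻ τ : ℝ, ∫⁻ ρ in Set.Ioc (0 : ℝ) (2 * R), ENNReal.ofReal (4 * angConst Θ * √R) *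
        (S.indicator 1 (τ, ρ) * ENNReal.ofReal (J τ ρ)) := by
        refine lintegral_mono fun τ => ?_
        have h1 := lintegral_radial_mul_jb hΘ v (f := fun ρ => S.indicator 1 (τ, ρ))
          (by fun_prop) (T := fun _ => e * (τ - t)) measurable_const
        simp only [jb_sign_mul_sub he] at h1
        refine h1.trans ?_
        have hsub : Set.Ioc (0 : ℝ) (2 * R) ⊆ Set.Ioi 0 := Set.Ioc_subset_Ioi_self
        rw [← lintegral_indicator measurableSet_Ioi, ← lintegral_indicator measurableSet_Ioc]
        refine lintegral_mono fun ρ => ?_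
        by_cases hρ : 0 < ρ
        swap
        · rw [Set.indicator_of_notMem (by simpa using hρ)]; exact zero_le
        rw [Set.indicator_of_mem (show ρ ∈ Set.Ioi (0 : ℝ) from hρ)]
        by_cases hρS : (τ, ρ) ∈ S
        swap
        · simp only [Set.indicator_of_notMem hρS, mul_zero, zero_mul]; exact zero_le
        have hρ2 : 1 + ρ ≤ 2 * R := hρS.1
        rw [Set.indicator_of_mem (show ρ ∈ Set.Ioc (0 : ℝ) (2 * R) from ⟨hρ, by linarith⟩)]
        simp only [Set.indicator_of_mem hρS, Pi.one_apply, mul_one, one_mul]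
        rw [← ENNReal.ofReal_mul hρ.le, ← ENNReal.ofReal_mul (by positivity)]
        refine ENNReal.ofReal_le_ofReal ?_
        rw [min_eq_left (by linarith), abs_sub_comm, abs_of_nonneg (by linarith)]
        have hJ0 : 0 ≤ J τ ρ := add_nonneg (jb_rpow_nonneg _ _) (jb_rpow_nonneg _ _)
        have h1ρ : 0 < 1 + ρ := by positivity
        have h2 : ρ * (1 + ρ) ^ (-(1 / 2) : ℝ) ≤ 2 * √R := by
          calc _ ≤ (1 + ρ) * (1 + ρ) ^ (-(1 / 2) : ℝ) := by gcongr; linarith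
            _ = √(1 + ρ) := by
                nth_rewrite 1 [← rpow_one (1 + ρ)]
                rw [← rpow_add h1ρ, sqrt_eq_rpow]; norm_num
            _ ≤ 2 * √R := by
                rw [sqrt_le_left (by positivity), mul_pow, sq_sqrt hR0.le]; linarith
        have := mul_le_mul_of_nonneg_right (mul_le_mul_of_nonneg_left h2
          (by positivity : 0 ≤ 2 * angConst Θ)) hJ0
        simp only [hJ, jb_sign_mul_sub he] at this ⊢
        linarith
    _ = ENNReal.ofReal (4 * angConst Θ * √R) * ∫⁻ ρ in Set.Ioc (0 : ℝ) (2 * R), ∫⁻ τ : ℝ,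
          S.indicator 1 (τ, ρ) * ENNReal.ofReal (J τ ρ) := by
        rw [← lintegral_lintegral_swap (by fun_prop), ← lintegral_const_mul _ (by fun_prop)]
        refine lintegral_congr fun τ => ?_
        rw [lintegral_const_mul _ (by fun_prop)]
    _ ≤ ENNReal.ofReal (4 * angConst Θ * √R) * ∫⁻ ρ in Set.Ioc (0 : ℝ) (2 * R),
          ENNReal.ofReal (20 * √H) := by
        refine mul_le_mul_right (lintegral_mono fun ρ => ?_) _
        calc _ ≤ ∫⁻ τ in {τ : ℝ | |(|τ| - ρ)| ≤ H}, ENNReal.ofReal (J τ ρ) := by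
              rw [← lintegral_indicator (measurableSet_le (by fun_prop) measurable_const)]
              refine lintegral_mono fun τ => ?_
              by_cases hρS : (τ, ρ) ∈ S
              · rw [Set.indicator_of_mem hρS, Set.indicator_of_mem (by exact hρS.2), Pi.one_apply,
                  one_mul]
              · rw [Set.indicator_of_notMem hρS, zero_mul]; exact zero_le
          _ ≤ ENNReal.ofReal (10 * √H) + ENNReal.ofReal (10 * √H) := by
              have hJe : ∀ τ, ENNReal.ofReal (J τ ρ) =
                  ENNReal.ofReal (jb (e * (τ - t) - (‖v‖ - ρ)) ^ (-(1 / 2) : ℝ)) +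
                    ENNReal.ofReal (jb (e * (τ - t) - (ρ + ‖v‖)) ^ (-(1 / 2) : ℝ)) :=
                fun τ => ENNReal.ofReal_add (jb_rpow_nonneg _ _) (jb_rpow_nonneg _ _)
              simp only [hJe]
              rw [lintegral_add_left (by fun_prop)]
              exact add_le_add (setLIntegral_jb_sign he hH _ _ _) (setLIntegral_jb_sign he hH _ _ _)
          _ = _ := by
              rw [← ENNReal.ofReal_add (by positivity) (by positivity)]; congr 1; ring
    _ = _ := by
        rw [setLIntegral_const, volume_Ioc, ← ENNReal.ofReal_mul (by positivity),
          ← ENNReal.ofReal_mul (by positivity)]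
        congr 1
        rw [show (3 / 2 : ℝ) = 1 + 1 / 2 by norm_num, rpow_add hR0, rpow_one, sqrt_eq_rpow]
        ring

lemma lintegral_cut_farRegion (hadm : Admissible σ A B Θ η) (he₂ : e₂ = 1 ∨ e₂ = -1)
    (hR : 1 ≤ R) (x : Freq) :
    ∫⁻ y, cut (farRegion R) (waveKer σ A B Θ e₁ e₂) x y ≤
      ENNReal.ofReal (2560 * angConst Θ * R ^ (-η)) := by
  have hR0 : 0 < R := one_pos.trans_le hR
  have hang := angConst_nonneg Θ
  set p := ‖x.2‖ with hp
  by_cases hpR : 16 * R < p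
  swap
  · refine (lintegral_eq_zero_of_ae_eq_zero (.of_forall fun y => ?_)).trans_le zero_le
    refine cut_of_notMem fun hy => hpR ?_
    obtain ⟨⟨h1, -, h3⟩, -⟩ := hy
    simp only at h1 h3
    linarith
  have hp0 : 0 < p := by linarith
  have hA := hadm.A_nonneg
  have hB := hadm.B_nonneg
  set H := min (8 * R) (p / R) with hH
  have hH1 : 1 ≤ H := le_min (by linarith) (by rw [le_div_iff₀ hR0]; linarith)
  have hH0 : 0 < H := one_pos.trans_le hH1
  have hHp : H * R ≤ p := by
    rw [← le_div_iff₀ hR0]; exact min_le_right _ _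
  set c := 2 * R ^ (-σ) * H ^ B * p ^ (-(2 * A)) with hc
  have hc0 : 0 ≤ c := by positivity
  set S : Set (ℝ × ℝ) := {q | 1 + q.2 ≤ 2 * R ∧ |(|q.1| - q.2)| ≤ H} with hS
  have hSm : MeasurableSet S := by rw [hS]; measurability
  have hSi : Measurable (S.indicator (1 : ℝ × ℝ → ℝ≥0∞)) := measurable_one.indicator hSm
  set Φ : Freq → ℝ≥0∞ := fun z => S.indicator 1 (z.1, ‖z.2‖) *
    ENNReal.ofReal (jb (z.1 - x.1 - e₂ * ‖x.2 - z.2‖) ^ (-Θ)) with hΦ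
  have hΦm : Measurable Φ := by fun_prop
  calc _ ≤ ∫⁻ y, ENNReal.ofReal c * Φ (x + y) := by
        refine lintegral_mono fun y => cut_le fun hy => ?_
        have hker := waveKer_le_of_mem_highRegion hadm hR hy.1 (e₁ := e₁) (e₂ := e₂)
        obtain ⟨⟨h1, h2, -⟩, h3, h4⟩ := hy
        simp only at h1 h2 h3 h4
        have hoH : outMod x y ≤ H := le_min h3 (by rw [le_div_iff₀ hR0]; exact h4.le)
        have hmem : ((x + y).1, ‖(x + y).2‖) ∈ S := by
          refine ⟨h2.le, ?_⟩
          have : 1 + |(|x.1 + y.1| - ‖x.2 + y.2‖)| ≤ H := hoH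
          simp only [Prod.fst_add, Prod.snd_add]
          linarith
        have hnorm : ‖x.2 - (x + y).2‖ = ‖y.2‖ := by
          rw [Prod.snd_add, sub_add_cancel_left, norm_neg]
        rw [hΦ]
        simp only [Set.indicator_of_mem hmem, Pi.one_apply, one_mul]
        rw [hnorm, Prod.fst_add, add_sub_cancel_left, ← ENNReal.ofReal_mul hc0]
        refine ENNReal.ofReal_le_ofReal (hker.trans ?_)
        have h5 : jb (x.1 - e₁ * ‖x.2‖) ^ (-Θ) ≤ 1 :=
          jb_rpow_neg_le_one _ (by linarith [hadm.one_lt_Θ])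
        have h6 := jb_rpow_nonneg (y.1 - e₂ * ‖y.2‖) (-Θ)
        have h7 := one_le_outMod x y
        calc _ ≤ 2 * R ^ (-σ) * H ^ B * p ^ (-(2 * A)) *
              (1 * jb (y.1 - e₂ * ‖y.2‖) ^ (-Θ)) := by
              have h8 := jb_rpow_nonneg (x.1 - e₁ * ‖x.2‖) (-Θ)
              gcongr
          _ = _ := by rw [hc, one_mul]
    _ = ENNReal.ofReal c * ∫⁻ z, Φ z := by
        rw [lintegral_const_mul _ (by fun_prop), ← lintegral_add_right_eq_self Φ x]
        simp only [add_comm x]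
    _ ≤ ENNReal.ofReal c * ENNReal.ofReal (160 * angConst Θ * R ^ (3 / 2 : ℝ) * √H) :=
        mul_le_mul_right (lintegral_far_jb hadm.one_lt_Θ he₂ hR hH0 x.1 (by linarith)) _
    _ ≤ _ := by
        rw [← ENNReal.ofReal_mul hc0]
        refine ENNReal.ofReal_le_ofReal ?_
        have h1 : p ^ (-(2 * A)) ≤ H ^ (-(2 * A)) * R ^ (-(2 * A)) := by
          rw [← mul_rpow hH0.le hR0.le]
          exact rpow_le_rpow_of_nonpos (by positivity) hHp (by linarith)
        calc _ ≤ 2 * R ^ (-σ) * H ^ B * (H ^ (-(2 * A)) * R ^ (-(2 * A))) *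
              (160 * angConst Θ * R ^ (3 / 2 : ℝ) * √H) := by rw [hc]; gcongr
          _ = 320 * angConst Θ * ((R ^ (-σ) * R ^ (-(2 * A)) * R ^ (3 / 2 : ℝ)) *
              (H ^ B * H ^ (-(2 * A)) * H ^ (1 / 2 : ℝ))) := by rw [sqrt_eq_rpow]; ring
          _ = 320 * angConst Θ *
              (R ^ (3 / 2 - σ - 2 * A) * H ^ (1 / 2 + B - 2 * A)) := by
              rw [← rpow_add hR0, ← rpow_add hR0, ← rpow_add hH0, ← rpow_add hH0]
              ring_nf
          _ ≤ 320 * angConst Θ * (8 * R ^ (-η)) :=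
              mul_le_mul_of_nonneg_left (hadm.rpow_mul_rpow_le hR hH1 (min_le_left _ _))
                (by positivity)
          _ = _ := by ring

/-- The constant in the estimate of the interaction of high frequencies with opposite signs. -/
def oppConst (Θ : ℝ) : ℝ := 128 * radConst Θ + 2560 * angConst Θ

lemma oppConst_nonneg (Θ : ℝ) : 0 ≤ oppConst Θ := by
  have := radConst_nonneg Θ
  have := angConst_nonneg Θ
  unfold oppConst; positivity

lemma triBound_opposite_sign (hadm : Admissible σ A B Θ η) {e : ℝ} (he : e = 1 ∨ e = -1)
    (hR : 1 ≤ R) :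
    TriBound (cut (highRegion R \ modRegion e (-e) R) (waveKer σ A B Θ e (-e)))
      (3 * ENNReal.ofReal (oppConst Θ * R ^ (-η)) ^ (1 / 2 : ℝ)) := by
  have hR0 : 0 < R := one_pos.trans_le hR
  have hrad := radConst_nonneg Θ
  have hang := angConst_nonneg Θ
  have he' : -e = 1 ∨ -e = -1 := by rcases he with rfl | rfl <;> simp
  have hRη : 0 ≤ R ^ (-η) := by positivity
  have hr := mul_nonneg hrad hRη
  have ha := mul_nonneg hang hRη
  have hnear : radConst Θ * (128 * R ^ (-η)) ≤ oppConst Θ * R ^ (-η) := by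
    unfold oppConst; linarith
  have hfar : 2560 * angConst Θ * R ^ (-η) ≤ oppConst Θ * R ^ (-η) := by
    unfold oppConst; linarith
  have h3 : (3 : ℝ≥0∞) = 2 + 1 := by norm_num
  rw [h3, add_mul, one_mul]
  refine TriBound.of_or
    (measurable_cut (measurableSet_nearRegion R) (measurable_waveKer σ A B Θ e (-e)))
    (measurable_cut (measurableSet_farRegion R) (measurable_waveKer σ A B Θ e (-e)))
    ((triBound_cut_nearRegion hadm he hR).mono (fun _ _ => le_rfl) (by gcongr))
    ((TriBound.of_lintegral_right (measurable_cut (measurableSet_farRegion R)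
      (measurable_waveKer σ A B Θ e (-e))) (lintegral_cut_farRegion hadm he' hR)).mono
        (fun _ _ => le_rfl) (by gcongr)) fun x y => ?_
  by_cases hxy : (x, y) ∈ highRegion R \ modRegion e (-e) R
  swap
  · rw [cut_of_notMem hxy]; exact Or.inl zero_le
  have h8 := outMod_le_of_opposite_sign he hxy.1 hxy.2
  rw [cut_of_mem hxy]
  rcases le_or_gt ‖x.2‖ (outMod x y * R) with h | h
  · exact Or.inl (cut_of_mem (S := nearRegion R) ⟨hxy.1, h8, h⟩).ge
  · exact Or.inr (cut_of_mem (S := farRegion R) ⟨hxy.1, h8, h⟩).ge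

/-! #### Summation over dyadic output frequencies -/

/-- The constant in the estimate of high-high interactions. -/
def highConst (Θ : ℝ) : ℝ := 32 * 4 ^ Θ * jbMass Θ + (sameConst Θ + oppConst Θ)

lemma triBound_cut_highRegion (hadm : Admissible σ A B Θ η) (he₁ : e₁ = 1 ∨ e₁ = -1)
    (he₂ : e₂ = 1 ∨ e₂ = -1) (hR : 1 ≤ R) :
    TriBound (cut (highRegion R) (waveKer σ A B Θ e₁ e₂))
      (6 * ENNReal.ofReal (highConst Θ * R ^ (-η)) ^ (1 / 2 : ℝ)) := by
  have hm : 0 ≤ jbMass Θ := jbMass_nonneg Θ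
  have ho := oppConst_nonneg Θ
  have hs : 0 ≤ sameConst Θ := by unfold sameConst; positivity
  have hRη : 0 ≤ R ^ (-η) := rpow_nonneg (by linarith) _
  have h4 : 0 ≤ 32 * 4 ^ Θ * jbMass Θ := by positivity
  have hK : ∀ c, c ≤ highConst Θ → ENNReal.ofReal (c * R ^ (-η)) ^ (1 / 2 : ℝ) ≤
      ENNReal.ofReal (highConst Θ * R ^ (-η)) ^ (1 / 2 : ℝ) := fun c hc => by gcongr
  have hdiff : TriBound (cut (highRegion R \ modRegion e₁ e₂ R) (waveKer σ A B Θ e₁ e₂))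
      (4 * ENNReal.ofReal (highConst Θ * R ^ (-η)) ^ (1 / 2 : ℝ)) := by
    have hcase : e₂ = e₁ ∨ e₂ = -e₁ := by
      rcases he₁ with rfl | rfl <;> rcases he₂ with rfl | rfl <;> simp
    rcases hcase with rfl | rfl
    · refine (triBound_same_sign hadm he₂ hR).mono (fun _ _ => le_rfl) ?_
      gcongr 4 * ?_
      exact hK _ (by unfold highConst; linarith)
    · refine (triBound_opposite_sign hadm he₁ hR).mono (fun _ _ => le_rfl) ?_
      exact mul_le_mul' (by norm_num) (hK _ (by unfold highConst; linarith))
  have h6 : (6 : ℝ≥0∞) = 2 + 4 := by norm_num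
  rw [h6, add_mul]
  refine TriBound.of_or
    (measurable_cut (measurableSet_modRegion e₁ e₂ R) (measurable_waveKer σ A B Θ e₁ e₂))
    (measurable_cut ((measurableSet_highRegion R).diff (measurableSet_modRegion e₁ e₂ R))
      (measurable_waveKer σ A B Θ e₁ e₂))
    ((triBound_cut_modRegion hadm hR).mono (fun _ _ => le_rfl)
      (mul_le_mul' le_rfl (hK _ (by unfold highConst; linarith)))) hdiff fun x y => ?_
  by_cases hxy : (x, y) ∈ highRegion R
  swap
  · rw [cut_of_notMem hxy]; exact Or.inl zero_le
  rw [cut_of_mem hxy]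
  by_cases hmod : (x, y) ∈ modRegion e₁ e₂ R
  · exact Or.inl (cut_of_mem hmod).ge
  · exact Or.inr (cut_of_mem (S := highRegion R \ modRegion e₁ e₂ R) ⟨hxy, hmod⟩).ge

lemma tsum_highConst_ne_top (hη : 0 < η) :
    ∑' j : ℕ, 6 * ENNReal.ofReal (highConst Θ * (2 ^ j : ℝ) ^ (-η)) ^ (1 / 2 : ℝ) ≠ ∞ := by
  have h2 : ∀ j : ℕ, ENNReal.ofReal (highConst Θ * (2 ^ j : ℝ) ^ (-η)) ^ (1 / 2 : ℝ) =
      ENNReal.ofReal (highConst Θ) ^ (1 / 2 : ℝ) * (ENNReal.ofReal (2 ^ (-(η / 2)))) ^ j := by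
    intro j
    rw [ENNReal.ofReal_mul' (by positivity), ENNReal.mul_rpow_of_nonneg _ _ (by norm_num),
      ENNReal.ofReal_rpow_of_nonneg (p := 1 / 2) (x := (2 ^ j) ^ (-η)) (by positivity)
        (by norm_num),
      ← ENNReal.ofReal_pow (by positivity), ← rpow_natCast, ← rpow_natCast,
      ← rpow_mul (by norm_num),
      ← rpow_mul (by norm_num), ← rpow_mul (by norm_num)]
    congr 3; ring
  simp only [h2]
  rw [ENNReal.tsum_mul_left, ENNReal.tsum_mul_left, ENNReal.tsum_geometric]
  refine ENNReal.mul_ne_top (by norm_num) (ENNReal.mul_ne_top (by finiteness) ?_)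
  rw [ENNReal.inv_ne_top, ← pos_iff_ne_zero, tsub_pos_iff_lt]
  simpa using rpow_lt_one_of_one_lt_of_neg one_lt_two (by linarith : -(η / 2) < 0)

lemma exists_triBound_waveKer (hadm : Admissible σ A B Θ η) (he₁ : e₁ = 1 ∨ e₁ = -1)
    (he₂ : e₂ = 1 ∨ e₂ = -1) :
    ∃ M ≠ ∞, TriBound (fun x y => ENNReal.ofReal (waveKer σ A B Θ e₁ e₂ x y)) M := by
  have hlow : ∀ e e', (e = 1 ∨ e = -1) → (e' = 1 ∨ e' = -1) →
      TriBound (cut lowRegion (waveKer σ A B Θ e e'))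
        (ENNReal.ofReal (radConst Θ * 10 ^ 6) ^ (1 / 2 : ℝ)) := fun e e' he he' =>
    TriBound.of_lintegral_sub (measurable_cut measurableSet_lowRegion (measurable_waveKer ..))
      (lintegral_cut_lowRegion hadm he he')
  have hswap : TriBound (fun x y => cut lowRegion (waveKer σ A B Θ e₂ e₁) y x)
      (ENNReal.ofReal (radConst Θ * 10 ^ 6) ^ (1 / 2 : ℝ)) :=
    TriBound.symm (k := fun x y => cut lowRegion (waveKer σ A B Θ e₂ e₁) y x)
      (hlow e₂ e₁ he₂ he₁)
  have hmlow : ∀ e e', Measurable (Function.uncurry (cut lowRegion (waveKer σ A B Θ e e'))) :=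
    fun e e' => measurable_cut measurableSet_lowRegion (measurable_waveKer ..)
  have hmhigh : ∀ j : ℕ,
      Measurable (Function.uncurry (cut (highRegion (2 ^ j)) (waveKer σ A B Θ e₁ e₂))) :=
    fun j => measurable_cut (measurableSet_highRegion _) (measurable_waveKer ..)
  refine ⟨_, ?_, TriBound.of_cover
    (κ := fun o : Bool ⊕ ℕ => match o with
      | .inl true => cut lowRegion (waveKer σ A B Θ e₁ e₂)
      | .inl false => fun x y => cut lowRegion (waveKer σ A B Θ e₂ e₁) y x
      | .inr j => cut (highRegion (2 ^ j)) (waveKer σ A B Θ e₁ e₂))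
    (m := fun o : Bool ⊕ ℕ => match o with
      | .inl true => ENNReal.ofReal (radConst Θ * 10 ^ 6) ^ (1 / 2 : ℝ)
      | .inl false => ENNReal.ofReal (radConst Θ * 10 ^ 6) ^ (1 / 2 : ℝ)
      | .inr j => 6 * ENNReal.ofReal (highConst Θ * (2 ^ j : ℝ) ^ (-η)) ^ (1 / 2 : ℝ))
    ?_ ?_ ?_⟩
  · rw [Summable.tsum_sum ENNReal.summable ENNReal.summable, tsum_bool]
    exact ENNReal.add_ne_top.2 ⟨by finiteness, tsum_highConst_ne_top hadm.η_pos⟩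
  · rintro ((_ | _) | j)
    · exact (hmlow e₂ e₁).comp measurable_swap
    · exact hmlow e₁ e₂
    · exact hmhigh j
  · rintro ((_ | _) | j)
    · exact hswap
    · exact hlow e₁ e₂ he₁ he₂
    · exact triBound_cut_highRegion hadm he₁ he₂ (one_le_pow₀ one_le_two)
  · intro x y
    have hhigh : 16 * (1 + ‖x.2 + y.2‖) < ‖x.2‖ → ∃ j : ℕ, (x, y) ∈ highRegion (2 ^ j) := by
      intro h
      obtain ⟨j, hj, hj'⟩ := exists_nat_pow_near
        (by linarith [norm_nonneg (x.2 + y.2)] : 1 ≤ 1 + ‖x.2 + y.2‖) one_lt_two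
      exact ⟨j, hj, by simpa [pow_succ'] using hj', h⟩
    by_cases h1 : 16 * (1 + ‖x.2 + y.2‖) < ‖x.2‖
    · obtain ⟨j, hj⟩ := hhigh h1
      exact ⟨.inr j, (cut_of_mem hj).ge⟩
    rw [not_lt] at h1
    rcases le_total ‖x.2‖ ‖y.2‖ with h2 | h2
    · exact ⟨.inl true, (cut_of_mem (S := lowRegion) ⟨h1, h2⟩).ge⟩
    · refine ⟨.inl false, ?_⟩
      rw [waveKer_comm]
      exact (cut_of_mem (S := lowRegion) (x := y) (y := x)
        ⟨by simpa only [add_comm y.2] using h2.trans h1, h2⟩).ge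

end waveKer

/-! ### Transfer to the Fourier side -/

section Fourier

variable {E : Type*} [NormedAddCommGroup E] [InnerProductSpace ℝ E] [FiniteDimensional ℝ E]
  [MeasurableSpace E] [BorelSpace E]

open scoped SchwartzMap

/-- The Fourier transform of a product is the convolution of the Fourier transforms. -/
lemma fourier_mul_eq_convolution (u v : 𝓢(E, ℂ)) :
    𝓕 (fun x => u x * v x) =
      SchwartzMap.convolution (ContinuousLinearMap.mul ℂ ℂ) (𝓕 u) (𝓕 v) := by
  have h1 : ∀ (f : 𝓢(E, ℂ)) (x : E), 𝓕 (𝓕 f) (-x) = f x := fun f x => by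
    have h : 𝓕⁻ (𝓕 f) x = f x := by rw [FourierTransform.fourierInv_fourier_eq]
    rw [← h, SchwartzMap.fourierInv_coe, SchwartzMap.fourier_coe, Real.fourierInv_eq_fourier_neg]
  have h2 : SchwartzMap.convolution (ContinuousLinearMap.mul ℂ ℂ) (𝓕 u) (𝓕 v) =
      𝓕⁻ (SchwartzMap.pairing (ContinuousLinearMap.mul ℂ ℂ) (𝓕 (𝓕 u)) (𝓕 (𝓕 v))) := by
    rw [← SchwartzMap.fourier_convolution, FourierTransform.fourierInv_fourier_eq]
  rw [h2, SchwartzMap.fourierInv_coe, Real.fourierInv_eq_fourier_comp_neg]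
  congr 1
  ext x
  rw [SchwartzMap.pairing_apply_apply, h1, h1, ContinuousLinearMap.mul_apply']

lemma enorm_fourier_mul_le (u v : 𝓢(E, ℂ)) (z : E) :
    ‖𝓕 (fun x => u x * v x) z‖ₑ ≤ ∫⁻ x, ‖𝓕 u x‖ₑ * ‖𝓕 v (z - x)‖ₑ := by
  rw [fourier_mul_eq_convolution, SchwartzMap.convolution_apply]
  refine (enorm_integral_le_lintegral_enorm _).trans_eq ?_
  simp

/-- Schwartz functions are square integrable against polynomially bounded weights. -/
lemma lintegral_mul_enorm_sq_lt_top (f : 𝓢(E, ℂ)) {W : E → ℝ} {n : ℕ}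
    (hW : ∀ x, W x ≤ (1 + ‖x‖) ^ n) :
    ∫⁻ x, ENNReal.ofReal (W x) * ‖f x‖ₑ ^ 2 < ∞ := by
  obtain ⟨m, hm⟩ := exists_nat_gt (Module.finrank ℝ E : ℝ)
  set K : ℝ := 2 ^ (n + m) * (Finset.Iic (n + m, 0)).sup
    (fun q => SchwartzMap.seminorm ℝ q.1 q.2) f
  have hK : ∀ x, (1 + ‖x‖) ^ (n + m) * ‖f x‖ ≤ K := fun x => by
    simpa using SchwartzMap.one_add_le_sup_seminorm_apply (𝕜 := ℝ) (m := (n + m, 0))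
      le_rfl le_rfl f x
  have hpt : ∀ x, ENNReal.ofReal (W x) * ‖f x‖ₑ ^ 2 ≤
      ENNReal.ofReal (K ^ 2) * ENNReal.ofReal ((1 + ‖x‖) ^ (-(m : ℝ))) := by
    intro x
    have h1 : 1 ≤ 1 + ‖x‖ := by linarith [norm_nonneg x]
    rw [← ofReal_norm, ← ENNReal.ofReal_pow (norm_nonneg _),
      ← ENNReal.ofReal_mul' (by positivity), ← ENNReal.ofReal_mul (by positivity)]
    refine ENNReal.ofReal_le_ofReal ?_
    rw [rpow_neg (by positivity), rpow_natCast, ← div_eq_mul_inv, le_div_iff₀ (by positivity)]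
    calc W x * ‖f x‖ ^ 2 * (1 + ‖x‖) ^ m
        ≤ (1 + ‖x‖) ^ n * ‖f x‖ ^ 2 * (1 + ‖x‖) ^ m := by gcongr; exact hW x
      _ = (1 + ‖x‖) ^ (n + m) * ‖f x‖ ^ 2 := by ring
      _ ≤ (1 + ‖x‖) ^ (2 * (n + m)) * ‖f x‖ ^ 2 := by
        gcongr
        omega
      _ = ((1 + ‖x‖) ^ (n + m) * ‖f x‖) ^ 2 := by ring
      _ ≤ K ^ 2 := by gcongr; exact hK x
  refine (lintegral_mono hpt).trans_lt ?_
  rw [lintegral_const_mul' _ _ ENNReal.ofReal_ne_top]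
  exact ENNReal.mul_lt_top ENNReal.ofReal_lt_top (finite_integral_one_add_norm hm)

end Fourier

/-- The coordinates `(τ, ξ₁ + i ξ₂)` on space-time. -/
def spaceTimeEquiv : SpaceTime ≃ᵐ Freq :=
  (MeasurableEquiv.toLp 2 (Fin 3 → ℝ)).symm.trans <|
    (MeasurableEquiv.piFinSuccAbove (fun _ => ℝ) 0).trans <|
      (MeasurableEquiv.refl ℝ).prodCongr Complex.measurableEquivPi.symm

lemma measurePreserving_spaceTimeEquiv : MeasurePreserving spaceTimeEquiv := by
  refine (EuclideanSpace.volume_preserving_symm_measurableEquiv_toLp (Fin 3)).trans ?_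
  refine (volume_preserving_piFinSuccAbove (fun _ : Fin 3 => ℝ) 0).trans ?_
  exact (MeasurePreserving.id volume).prod
    (Complex.volume_preserving_equiv_pi.symm Complex.measurableEquivPi)

lemma spaceTimeEquiv_apply (ζ : SpaceTime) : spaceTimeEquiv ζ = (ζ 0, ⟨ζ 1, ζ 2⟩) := by
  have h : spaceTimeEquiv ζ = (ζ 0, Complex.measurableEquivPi.symm (Fin.tail ζ.ofLp)) := rfl
  rw [h, Complex.measurableEquivPi_symm_apply]
  simp [Fin.tail, Complex.ext_iff]

lemma spaceTimeEquiv_sub (ζ ω : SpaceTime) :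
    spaceTimeEquiv (ζ - ω) = spaceTimeEquiv ζ - spaceTimeEquiv ω := by
  simp only [spaceTimeEquiv_apply]
  rfl

lemma norm_spaceTimeEquiv_snd (ζ : SpaceTime) : ‖(spaceTimeEquiv ζ).2‖ = spFreq ζ := by
  rw [spaceTimeEquiv_apply, Complex.norm_eq_sqrt_sq_add_sq, spFreq]

lemma spFreq_le_norm (ζ : SpaceTime) : spFreq ζ ≤ ‖ζ‖ := by
  rw [spFreq, EuclideanSpace.norm_eq, Fin.sum_univ_three]
  refine Real.sqrt_le_sqrt ?_
  simp only [Real.norm_eq_abs, sq_abs]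
  linarith [sq_nonneg (ζ 0)]

/-! ### The weights -/

/-- The weight of the wave-Sobolev space `H^{s,b}`. -/
def waveWeight (s b : ℝ) (x : Freq) : ℝ :=
  (1 + ‖x.2‖ ^ 2) ^ s * jb (|x.1| - ‖x.2‖) ^ (2 * b)

lemma waveWeight_pos (s b : ℝ) (x : Freq) : 0 < waveWeight s b x :=
  mul_pos (rpow_pos_of_pos (by positivity) _) (rpow_pos_of_pos (jb_pos _) _)

@[fun_prop]
lemma measurable_waveWeight (s b : ℝ) : Measurable (waveWeight s b) := by
  unfold waveWeight; fun_prop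

lemma waveWeight_inv (s b : ℝ) (x : Freq) : (waveWeight s b x)⁻¹ = waveWeight (-s) (-b) x := by
  rw [waveWeight, mul_inv, ← rpow_neg (by positivity), ← rpow_neg (jb_pos _).le, waveWeight,
    mul_neg]

lemma one_add_sq_rpow_neg_le {s p : ℝ} (hs : 0 ≤ s) (hp : 0 ≤ p) :
    (1 + p ^ 2) ^ (-s) ≤ 2 ^ s * (1 + p) ^ (-(2 * s)) := by
  have h : (1 + p) ^ 2 / 2 ≤ 1 + p ^ 2 := by nlinarith [sq_nonneg (1 - p)]
  calc (1 + p ^ 2) ^ (-s) ≤ ((1 + p) ^ 2 / 2) ^ (-s) :=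
        rpow_le_rpow_of_nonpos (by positivity) h (by linarith)
    _ = 2 ^ s * (1 + p) ^ (-(2 * s)) := by
        rw [div_rpow (by positivity) two_pos.le, rpow_neg two_pos.le, div_inv_eq_mul, mul_comm,
          ← rpow_natCast, ← rpow_mul (by positivity)]
        congr 2
        push_cast; ring

lemma one_add_sq_rpow_neg_le_of_le {s A p : ℝ} (hA : 0 ≤ A) (hAs : A ≤ 2 * s) (hp : 0 ≤ p) :
    (1 + p ^ 2) ^ (-s) ≤ 2 ^ (A / 2) * (1 + p) ^ (-A) := by
  calc (1 + p ^ 2) ^ (-s) ≤ (1 + p ^ 2) ^ (-(A / 2)) :=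
        rpow_le_rpow_of_exponent_le (by nlinarith) (by linarith)
    _ ≤ 2 ^ (A / 2) * (1 + p) ^ (-(2 * (A / 2))) := one_add_sq_rpow_neg_le (by linarith) hp
    _ = _ := by rw [mul_div_cancel₀ A two_ne_zero]

/-- The sign attached to a branch of the light cone. -/
def branchSign (i : Bool) : ℝ := if i then 1 else -1

lemma branchSign_eq (i : Bool) : branchSign i = 1 ∨ branchSign i = -1 := by
  cases i <;> simp [branchSign]

lemma exists_jb_branch (τ p : ℝ) : ∃ i, jb (|τ| - p) = jb (τ - branchSign i * p) := by
  rcases le_total 0 τ with h | h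
  · exact ⟨true, by simp [branchSign, abs_of_nonneg h]⟩
  · refine ⟨false, ?_⟩
    rw [abs_of_nonpos h, ← jb_neg]
    simp [branchSign, add_comm]

lemma waveWeight_mul_inv_le {s₀ β s b A : ℝ} (hs₀ : s₀ ≤ 0) (hA : 0 ≤ A) (hAs : A ≤ 2 * s)
    (x y : Freq) :
    ∃ i j, waveWeight s₀ β (x + y) * ((waveWeight s b x)⁻¹ * (waveWeight s b y)⁻¹) ≤
      2 ^ (-s₀ + A) * waveKer (-(2 * s₀)) A (2 * β) (2 * b) (branchSign i) (branchSign j) x y := by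
  obtain ⟨i, hi⟩ := exists_jb_branch x.1 ‖x.2‖
  obtain ⟨j, hj⟩ := exists_jb_branch y.1 ‖y.2‖
  refine ⟨i, j, ?_⟩
  rw [waveWeight_inv, waveWeight_inv]
  unfold waveWeight waveKer
  rw [hi, hj, mul_neg, Prod.fst_add, Prod.snd_add]
  have h0 := one_add_sq_rpow_neg_le (s := -s₀) (by linarith) (norm_nonneg (x.2 + y.2))
  have hx := one_add_sq_rpow_neg_le_of_le hA hAs (norm_nonneg x.2)
  have hy := one_add_sq_rpow_neg_le_of_le hA hAs (norm_nonneg y.2)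
  rw [neg_neg] at h0
  have hJ : 0 ≤ jb (|x.1 + y.1| - ‖x.2 + y.2‖) ^ (2 * β) := jb_rpow_nonneg _ _
  have hJx : 0 ≤ jb (x.1 - branchSign i * ‖x.2‖) ^ (-(2 * b)) := jb_rpow_nonneg _ _
  have hJy : 0 ≤ jb (y.1 - branchSign j * ‖y.2‖) ^ (-(2 * b)) := jb_rpow_nonneg _ _
  have h2 : (2 : ℝ) ^ (-s₀ + A) = 2 ^ (-s₀) * (2 ^ (A / 2) * 2 ^ (A / 2)) := by
    rw [← rpow_add two_pos, ← rpow_add two_pos, add_halves]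
  rw [h2]
  calc _ ≤ 2 ^ (-s₀) * (1 + ‖x.2 + y.2‖) ^ (-(2 * -s₀)) *
          jb (|x.1 + y.1| - ‖x.2 + y.2‖) ^ (2 * β) *
        (2 ^ (A / 2) * (1 + ‖x.2‖) ^ (-A) * jb (x.1 - branchSign i * ‖x.2‖) ^ (-(2 * b)) *
        (2 ^ (A / 2) * (1 + ‖y.2‖) ^ (-A) * jb (y.1 - branchSign j * ‖y.2‖) ^ (-(2 * b)))) := by
        gcongr
    _ = _ := by
        rw [mul_neg, neg_neg]; ring_nf

lemma TriBound.const_mul {k : Freq → Freq → ℝ≥0∞} {M c : ℝ≥0∞} (h : TriBound k M) (hc : c ≠ ∞) :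
    TriBound (fun x y => c * k x y) (c ^ (1 / 2 : ℝ) * M) := by
  intro F G w hF hG hw
  refine le_of_eq_of_le ?_ ((mul_le_mul_right (h F G w hF hG hw) (c ^ (1 / 2 : ℝ))).trans_eq
    (mul_assoc _ _ _).symm)
  unfold tri
  rw [← lintegral_const_mul' _ _ (ENNReal.rpow_ne_top_of_nonneg (by norm_num) hc)]
  refine lintegral_congr fun x => ?_
  rw [ENNReal.mul_rpow_of_nonneg _ _ (by norm_num)]
  ring

lemma exists_triBound_waveWeight {s₀ β s b A η : ℝ} (hAs : A ≤ 2 * s)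
    (hadm : Admissible (-(2 * s₀)) A (2 * β) (2 * b) η) :
    ∃ M ≠ ∞, TriBound (fun x y => ENNReal.ofReal (waveWeight s₀ β (x + y)) *
      ((ENNReal.ofReal (waveWeight s b x))⁻¹ * (ENNReal.ofReal (waveWeight s b y))⁻¹)) M := by
  choose M hM h using fun q : Bool × Bool =>
    exists_triBound_waveKer hadm (branchSign_eq q.1) (branchSign_eq q.2)
  set c := ENNReal.ofReal (2 ^ (-s₀ + A))
  have hc : c ^ (1 / 2 : ℝ) ≠ ∞ :=
    ENNReal.rpow_ne_top_of_nonneg (by norm_num) ENNReal.ofReal_ne_top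
  refine ⟨∑' q, c ^ (1 / 2 : ℝ) * M q, ?_, TriBound.of_cover
    (fun q => ?_) (fun q => (h q).const_mul ENNReal.ofReal_ne_top) fun x y => ?_⟩
  · rw [tsum_fintype]
    exact ENNReal.sum_ne_top.2 fun q _ => ENNReal.mul_ne_top hc (hM q)
  · exact ((measurable_waveKer _ _ _ _ _ _).ennreal_ofReal.const_mul c)
  · have hs₀ : s₀ ≤ 0 := by linarith [hadm.one_le_σ]
    obtain ⟨i, j, hij⟩ := waveWeight_mul_inv_le (β := β) (b := b) hs₀ hadm.A_nonneg hAs x y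
    refine ⟨(i, j), ?_⟩
    rw [← ENNReal.ofReal_inv_of_pos (waveWeight_pos _ _ _),
      ← ENNReal.ofReal_inv_of_pos (waveWeight_pos _ _ _),
      ← ENNReal.ofReal_mul (inv_nonneg.2 (waveWeight_pos _ _ _).le),
      ← ENNReal.ofReal_mul (waveWeight_pos _ _ _).le, ← ENNReal.ofReal_mul (by positivity)]
    exact ENNReal.ofReal_le_ofReal hij

/-- A weighted bilinear convolution estimate from the boundedness of the trilinear form. -/
lemma TriBound.lintegral_convolution_le {Wo Wi : Freq → ℝ≥0∞} {M : ℝ≥0∞}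
    (h : TriBound (fun x y => Wo (x + y) * ((Wi x)⁻¹ * (Wi y)⁻¹)) M)
    (hWo : Measurable Wo) (hWi : Measurable Wi) (hWi₀ : ∀ x, Wi x ≠ 0) (hWi₁ : ∀ x, Wi x ≠ ∞)
    {F G H : Freq → ℝ≥0∞} (hF : Measurable F) (hG : Measurable G) (hH : Measurable H)
    (hFGH : ∀ z, H z ≤ ∫⁻ x, F x * G (z - x)) :
    ∫⁻ z, Wo z * H z ^ 2 ≤ M * ((∫⁻ x, Wi x * F x ^ 2) ^ (1 / 2 : ℝ) *
      (∫⁻ x, Wi x * G x ^ 2) ^ (1 / 2 : ℝ) * (∫⁻ z, Wo z * H z ^ 2) ^ (1 / 2 : ℝ)) := by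
  have key := h (fun x => Wi x ^ (1 / 2 : ℝ) * F x) (fun x => Wi x ^ (1 / 2 : ℝ) * G x)
    (fun x => Wo x ^ (1 / 2 : ℝ) * H x) (by fun_prop) (by fun_prop) (by fun_prop)
  simp only [l2, mul_pow, ENNReal.rpow_half_sq] at key
  refine le_trans ?_ key
  have h1 : ∀ x, Wi x ^ (1 / 2 : ℝ) * (Wi x ^ (1 / 2 : ℝ))⁻¹ = 1 := fun x =>
    ENNReal.mul_inv_cancel (ENNReal.rpow_pos (hWi₀ x).bot_lt (hWi₁ x)).ne'
      (ENNReal.rpow_ne_top_of_nonneg (by norm_num) (hWi₁ x))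
  have htri : ∀ x : Freq × Freq, Wi x.1 ^ (1 / 2 : ℝ) * F x.1 * (Wi x.2 ^ (1 / 2 : ℝ) * G x.2) *
      (Wo (x.1 + x.2) ^ (1 / 2 : ℝ) * H (x.1 + x.2)) *
        (Wo (x.1 + x.2) * ((Wi x.1)⁻¹ * (Wi x.2)⁻¹)) ^ (1 / 2 : ℝ) =
      Wo (x.1 + x.2) * H (x.1 + x.2) * (F x.1 * G x.2) := by
    intro x
    rw [ENNReal.mul_rpow_of_nonneg _ _ (by norm_num), ENNReal.mul_rpow_of_nonneg _ _ (by norm_num),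
      ENNReal.inv_rpow, ENNReal.inv_rpow]
    calc _ = (Wo (x.1 + x.2) ^ (1 / 2 : ℝ)) ^ 2 * H (x.1 + x.2) * (F x.1 * G x.2) *
          (Wi x.1 ^ (1 / 2 : ℝ) * (Wi x.1 ^ (1 / 2 : ℝ))⁻¹) *
          (Wi x.2 ^ (1 / 2 : ℝ) * (Wi x.2 ^ (1 / 2 : ℝ))⁻¹) := by ring
      _ = _ := by rw [h1, h1, ENNReal.rpow_half_sq, mul_one, mul_one]
  unfold tri
  simp only [htri]
  rw [lintegral_freq_add (H := fun x y => Wo (x + y) * H (x + y) * (F x * G y)) (by fun_prop)]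
  refine lintegral_mono fun z => ?_
  simp only [add_sub_cancel]
  rw [lintegral_const_mul _ (by fun_prop), sq, ← mul_assoc]
  gcongr
  exact hFGH z

/-! ### Wave-Sobolev norms in the frequency coordinates -/

/-- The square of the `H^{s,b}` norm of a function with Fourier transform `g`. -/
def waveEnergy (s b : ℝ) (g : SpaceTime → ℂ) : ℝ≥0∞ :=
  ∫⁻ x : Freq, ENNReal.ofReal (waveWeight s b x) * ‖g (spaceTimeEquiv.symm x)‖ₑ ^ 2

lemma waveEnergy_eq (s b : ℝ) (g : SpaceTime → ℂ) :
    waveEnergy s b g =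
      ∫⁻ ζ, ENNReal.ofReal (waveWeight s b (spaceTimeEquiv ζ)) * ‖g ζ‖ₑ ^ 2 := by
  rw [waveEnergy, ← measurePreserving_spaceTimeEquiv.lintegral_comp_emb
    spaceTimeEquiv.measurableEmbedding]
  simp

lemma waveWeight_spaceTimeEquiv (s b : ℝ) (ζ : SpaceTime) :
    waveWeight s b (spaceTimeEquiv ζ) =
      (1 + spFreq ζ ^ 2) ^ s * (1 + |(|ζ 0| - spFreq ζ)|) ^ (2 * b) := by
  rw [waveWeight, norm_spaceTimeEquiv_snd, spaceTimeEquiv_apply, jb]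

lemma waveNorm_eq (s b : ℝ) {f : SpaceTime → ℂ} (hf : Measurable (𝓕 f)) :
    waveNorm s b f = (waveEnergy s b (𝓕 f)).toReal ^ (1 / 2 : ℝ) := by
  have hW := (measurable_waveWeight s b).comp spaceTimeEquiv.measurable
  simp only [waveNorm, ← waveWeight_spaceTimeEquiv]
  rw [waveEnergy_eq, integral_eq_lintegral_of_nonneg_ae]
  · simp only [← ofReal_norm, ← ENNReal.ofReal_pow (norm_nonneg _),
      ← ENNReal.ofReal_mul (waveWeight_pos _ _ _).le]
  · exact .of_forall fun ζ => mul_nonneg (waveWeight_pos _ _ _).le (by positivity)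
  · exact (hW.mul (hf.norm.pow_const 2)).aestronglyMeasurable

lemma waveEnergy_lt_top {s b : ℝ} (hs : s ≤ 1) (hb : b ≤ 1) (f : SchwartzMap SpaceTime ℂ) :
    waveEnergy s b f < ∞ := by
  rw [waveEnergy_eq]
  refine lintegral_mul_enorm_sq_lt_top (n := 4) f fun ζ => ?_
  rw [waveWeight_spaceTimeEquiv]
  have hp : spFreq ζ ≤ ‖ζ‖ := spFreq_le_norm ζ
  have hp₀ : 0 ≤ spFreq ζ := Real.sqrt_nonneg _
  have hτ : |ζ 0| ≤ ‖ζ‖ := PiLp.norm_apply_le ζ 0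
  have hm : |(|ζ 0| - spFreq ζ)| ≤ ‖ζ‖ :=
    abs_le.2 ⟨by linarith [abs_nonneg (ζ 0)], by linarith⟩
  have h1 : (1 + spFreq ζ ^ 2) ^ s ≤ (1 + ‖ζ‖) ^ 2 := by
    refine (rpow_le_rpow_of_exponent_le (by nlinarith) hs).trans ?_
    rw [rpow_one]
    nlinarith
  have h2 : (1 + |(|ζ 0| - spFreq ζ)|) ^ (2 * b) ≤ (1 + ‖ζ‖) ^ 2 := by
    refine (rpow_le_rpow_of_exponent_le (y := 2 * b) (z := 2)
      (by linarith [abs_nonneg (|ζ 0| - spFreq ζ)]) (by linarith)).trans ?_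
    rw [rpow_two]
    gcongr
  calc _ ≤ (1 + ‖ζ‖) ^ 2 * (1 + ‖ζ‖) ^ 2 := by gcongr
    _ = (1 + ‖ζ‖) ^ 4 := by ring

lemma measurable_fourier_schwartz (f : SchwartzMap SpaceTime ℂ) :
    Measurable (𝓕 (f : SpaceTime → ℂ)) := by
  rw [← SchwartzMap.fourier_coe]
  exact (𝓕 f).continuous.measurable

lemma enorm_fourier_mul_spaceTimeEquiv_symm_le (u v : SchwartzMap SpaceTime ℂ) (z : Freq) :
    ‖𝓕 (fun x => u x * v x) (spaceTimeEquiv.symm z)‖ₑ ≤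
      ∫⁻ x : Freq, ‖𝓕 u (spaceTimeEquiv.symm x)‖ₑ * ‖𝓕 v (spaceTimeEquiv.symm (z - x))‖ₑ := by
  refine (enorm_fourier_mul_le u v _).trans_eq ?_
  rw [← measurePreserving_spaceTimeEquiv.lintegral_comp_emb spaceTimeEquiv.measurableEmbedding]
  refine lintegral_congr fun ζ => ?_
  rw [MeasurableEquiv.symm_apply_apply]
  congr 3
  apply spaceTimeEquiv.injective
  simp [spaceTimeEquiv_sub]

lemma ENNReal.toReal_rpow_half_le {X K : ℝ≥0∞} (hK : K ≠ ∞) (h : X ≤ K * X ^ (1 / 2 : ℝ)) :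
    X.toReal ^ (1 / 2 : ℝ) ≤ K.toReal := by
  rcases eq_or_ne X ∞ with rfl | hX
  · simp
  rcases eq_or_ne X 0 with rfl | hX₀
  · simp
  rw [ENNReal.toReal_rpow]
  refine ENNReal.toReal_mono hK ?_
  have hpos := ENNReal.rpow_pos hX₀.bot_lt hX (p := 1 / 2)
  refine (ENNReal.mul_le_mul_iff_left hpos.ne'
    (ENNReal.rpow_ne_top_of_nonneg (by norm_num) hX)).1 ?_
  rwa [← sq, ENNReal.rpow_half_sq]

lemma TriBound.waveEnergy_mul_le {s₀ β s b : ℝ} {M : ℝ≥0∞}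
    (h : TriBound (fun x y => ENNReal.ofReal (waveWeight s₀ β (x + y)) *
      ((ENNReal.ofReal (waveWeight s b x))⁻¹ * (ENNReal.ofReal (waveWeight s b y))⁻¹)) M)
    {f g₁ g₂ : SpaceTime → ℂ} (hf : Measurable f) (hg₁ : Measurable g₁) (hg₂ : Measurable g₂)
    (hfg : ∀ z : Freq, ‖f (spaceTimeEquiv.symm z)‖ₑ ≤
      ∫⁻ x : Freq, ‖g₁ (spaceTimeEquiv.symm x)‖ₑ * ‖g₂ (spaceTimeEquiv.symm (z - x))‖ₑ) :
    waveEnergy s₀ β f ≤ M * (waveEnergy s b g₁ ^ (1 / 2 : ℝ) * waveEnergy s b g₂ ^ (1 / 2 : ℝ) *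
      waveEnergy s₀ β f ^ (1 / 2 : ℝ)) :=
  TriBound.lintegral_convolution_le
    (Wo := fun x => ENNReal.ofReal (waveWeight s₀ β x))
    (Wi := fun x => ENNReal.ofReal (waveWeight s b x)) h (by fun_prop) (by fun_prop)
    (fun _ => (ENNReal.ofReal_pos.2 (waveWeight_pos _ _ _)).ne') (fun _ => ENNReal.ofReal_ne_top)
    (hg₁.comp spaceTimeEquiv.symm.measurable).enorm
    (hg₂.comp spaceTimeEquiv.symm.measurable).enorm
    (hf.comp spaceTimeEquiv.symm.measurable).enorm hfg

/-- The product estimate in wave-Sobolev spaces, under explicit conditions on the exponents. -/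
theorem exists_waveNorm_mul_le {s₀ β s b A η : ℝ} (hAs : A ≤ 2 * s) (hs : s ≤ 1) (hb : b ≤ 1)
    (hadm : Admissible (-(2 * s₀)) A (2 * β) (2 * b) η) :
    ∃ C > 0, ∀ u v : SchwartzMap SpaceTime ℂ,
      waveNorm s₀ β (fun x => u x * v x) ≤
        C * waveNorm s b (fun x => u x) * waveNorm s b (fun x => v x) := by
  obtain ⟨M, hM, h⟩ := exists_triBound_waveWeight hAs hadm
  refine ⟨M.toReal + 1, by positivity, fun u v => ?_⟩
  have huv : Measurable (𝓕 (fun x => u x * v x)) := by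
    rw [fourier_mul_eq_convolution]
    exact (SchwartzMap.continuous _).measurable
  have hfin : ∀ f : SchwartzMap SpaceTime ℂ, waveEnergy s b f ^ (1 / 2 : ℝ) ≠ ∞ := fun f =>
    ENNReal.rpow_ne_top_of_nonneg (by norm_num) (waveEnergy_lt_top hs hb f).ne
  have key := h.waveEnergy_mul_le huv (SchwartzMap.continuous _).measurable
    (SchwartzMap.continuous _).measurable (enorm_fourier_mul_spaceTimeEquiv_symm_le u v)
  rw [← mul_assoc] at key
  have hle := ENNReal.toReal_rpow_half_le
    (ENNReal.mul_ne_top hM (ENNReal.mul_ne_top (hfin _) (hfin _))) key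
  rw [waveNorm_eq _ _ huv, waveNorm_eq _ _ (measurable_fourier_schwartz u),
    waveNorm_eq _ _ (measurable_fourier_schwartz v), ← SchwartzMap.fourier_coe,
    ← SchwartzMap.fourier_coe, mul_assoc]
  refine hle.trans ?_
  rw [ENNReal.toReal_mul, ENNReal.toReal_mul, ← ENNReal.toReal_rpow, ← ENNReal.toReal_rpow]
  gcongr
  linarith

theorem nullA_high_estimate_1 (s s' θ₀ θ₁ : ℝ)
    (hs1 : 1/4 < s') (hs2 : s' ≤ 1) (hs3 : 1/2 < s) (hs4 : s ≤ 1)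
    (hs5 : max (3/2 - 2 * s) (s/2 - 1/8) < s') (hs6 : s' < 4 * s - 3/2)
    (hθ0 : 1/2 < θ₀) (hθ0b : θ₀ < 3/4)
    (hθ1 : max (1/2) (1 - s') < θ₁)
    (hθ1b : θ₁ < min (3/4) (min (4 * s - s' - 1) (2 * s - 1/2))) :
    ∃ ε₀ > 0, ∀ ε : ℝ, 0 < ε → ε ≤ ε₀ → ∃ C > 0, ∀ u v : SchwartzMap SpaceTime ℂ,
      waveNorm (s' - 3/2) (θ₁ - 1/2 + ε) (fun x => u x * v x) ≤
        C * waveNorm (s - 1/2) θ₀ (fun x => u x) * waveNorm (s - 1/2) θ₀ (fun x => v x) := by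
  obtain ⟨hθ1, -⟩ := max_lt_iff.1 hθ1
  obtain ⟨h1, h2⟩ := lt_min_iff.1 hθ1b
  obtain ⟨h2, h3⟩ := lt_min_iff.1 h2
  refine ⟨min (3 / 4 - θ₁) (min (4 * s - s' - 1 - θ₁) (2 * s - 1 / 2 - θ₁)) / 2,
    half_pos (by simp only [lt_min_iff, sub_pos]; exact ⟨h1, h2, h3⟩), fun ε hε hε₀ => ?_⟩
  have e1 := min_le_left (3 / 4 - θ₁) (min (4 * s - s' - 1 - θ₁) (2 * s - 1 / 2 - θ₁))
  have e2 := min_le_right (3 / 4 - θ₁) (min (4 * s - s' - 1 - θ₁) (2 * s - 1 / 2 - θ₁))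
  obtain ⟨e2, e3⟩ := le_min_iff.1 e2
  obtain ⟨A, hA, hA₁, hA₂⟩ : ∃ A, (A = 2 * s - 1 ∨ A = 1 / 2) ∧ A ≤ 2 * s - 1 ∧ A ≤ 1 / 2 :=
    ⟨min (2 * s - 1) (1 / 2), min_choice _ _, min_le_left _ _, min_le_right _ _⟩
  set σ := -(2 * (s' - 3 / 2)) with hσ
  set B := 2 * (θ₁ - 1 / 2 + ε) with hB
  refine exists_waveNorm_mul_le (A := A) (by linarith) (by linarith) (by linarith)
    (η := min (σ + 2 * A - 3 / 2) (min (σ + 4 * A - B - 2) (σ + 2 * A - B - 1))) ?_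
  refine ⟨?_, ?_, ?_, ?_, ?_, ?_, ?_, ?_, min_le_left _ _,
    (min_le_right _ _).trans (min_le_left _ _), (min_le_right _ _).trans (min_le_right _ _)⟩
  on_goal 8 =>
    refine lt_min ?_ (lt_min ?_ ?_)
  all_goals rcases hA with rfl | rfl <;> linarith

end
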